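/- arXiv:1609.01446 — 2 statements merged into one kernel-verified Lean document; each statement's English description precedes it below -/
import Mathlib

section
/- Let n = 2r + 1 and let K(n) be the restricted contact algebra over k. Then rk(K(n)) = p^r if n + 3 ≢ 0 (mod p), and rk(K(n)) = p^r − 1 if n + 3 ≡ 0 (mod p). -/
/-!
The truncated polynomial ring `A(n) = k[X₁,…,Xₙ]/(X₁^p,…,Xₙ^p)`, its partial derivatives,
the Jacobson–Witt algebra `W(n) = Der(A(n))`, and related Lie algebras of Cartan type.
-/

set_option synthInstance.maxHeartbeats 1000000
set_option maxHeartbeats 1600000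

section Trunc

variable (p : ℕ) (k : Type*) [Field k] (n : ℕ)

/-- The defining ideal `(X₁^p, …, Xₙ^p)`. -/
noncomputable abbrev truncIdeal : Ideal (MvPolynomial (Fin n) k) :=
  Ideal.span {f | ∃ i : Fin n, f = MvPolynomial.X i ^ p}

/-- The truncated polynomial ring `A(n) := k[X₁,…,Xₙ]/(X₁^p,…,Xₙ^p)`. -/
noncomputable abbrev TruncPoly := MvPolynomial (Fin n) k ⧸ truncIdeal p k n

variable [CharP k p]

theorem pderiv_mem_truncIdeal (i : Fin n) {f : MvPolynomial (Fin n) k}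
    (hf : f ∈ truncIdeal p k n) : MvPolynomial.pderiv i f ∈ truncIdeal p k n := by
  induction hf using Submodule.span_induction with
  | mem x hx =>
    obtain ⟨j, rfl⟩ := hx
    have h0 : (p : MvPolynomial (Fin n) k) = 0 := CharP.cast_eq_zero _ p
    rw [Derivation.leibniz_pow]
    rw [nsmul_eq_mul, h0, zero_mul]
    exact Ideal.zero_mem _
  | zero => simp only [map_zero]; exact Ideal.zero_mem _
  | add x y _ _ hx hy => rw [map_add]; exact Ideal.add_mem _ hx hy
  | smul a x hxmem hx =>
    rw [smul_eq_mul, Derivation.leibniz, smul_eq_mul, smul_eq_mul]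
    exact Ideal.add_mem _ (Ideal.mul_mem_left _ _ hx) (Ideal.mul_mem_right _ _ hxmem)

/-- The partial derivative `∂/∂Xᵢ` on the truncated polynomial ring, as a derivation. -/
noncomputable def truncPD (i : Fin n) :
    Derivation k (TruncPoly p k n) (TruncPoly p k n) where
  toFun := fun a => Quotient.liftOn' a
    (fun f => Ideal.Quotient.mk (truncIdeal p k n) (MvPolynomial.pderiv i f))
    (by
      intro f g hfg
      rw [Submodule.quotientRel_def] at hfg
      rw [Ideal.Quotient.eq]
      rw [← map_sub]
      exact pderiv_mem_truncIdeal p k n i hfg)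
  map_add' := by
    rintro ⟨f⟩ ⟨g⟩
    show Ideal.Quotient.mk _ (MvPolynomial.pderiv i (f + g)) =
      Ideal.Quotient.mk _ (MvPolynomial.pderiv i f) +
        Ideal.Quotient.mk _ (MvPolynomial.pderiv i g)
    rw [map_add, map_add]
  map_smul' := by
    rintro c ⟨f⟩
    show Ideal.Quotient.mkₐ k (truncIdeal p k n) (MvPolynomial.pderiv i (c • f)) =
      c • Ideal.Quotient.mkₐ k (truncIdeal p k n) (MvPolynomial.pderiv i f)
    rw [Derivation.map_smul, map_smul]
  map_one_eq_zero' := by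
    show Ideal.Quotient.mk (truncIdeal p k n) (MvPolynomial.pderiv i 1) = 0
    simp only [Derivation.map_one_eq_zero, map_zero]
  leibniz' := by
    rintro ⟨f⟩ ⟨g⟩
    show Ideal.Quotient.mk (truncIdeal p k n) (MvPolynomial.pderiv i (f * g)) =
      (Ideal.Quotient.mk (truncIdeal p k n) f) *
          (Ideal.Quotient.mk (truncIdeal p k n) (MvPolynomial.pderiv i g)) +
        (Ideal.Quotient.mk (truncIdeal p k n) g) *
          (Ideal.Quotient.mk (truncIdeal p k n) (MvPolynomial.pderiv i f))
    rw [Derivation.leibniz, smul_eq_mul, smul_eq_mul, map_add, map_mul, map_mul]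

/-- The image of the variable `Xᵢ` in the truncated polynomial ring. -/
noncomputable def truncX (i : Fin n) : TruncPoly p k n :=
  Ideal.Quotient.mk (truncIdeal p k n) (MvPolynomial.X i)

end Trunc

section CartanAlgebras

variable (p : ℕ) (k : Type*) [Field k] [CharP k p]

/-- The restricted Jacobson–Witt algebra `W(n) := Der(A(n))`. -/
noncomputable abbrev WittAlg (n : ℕ) :=
  Derivation k (TruncPoly p k n) (TruncPoly p k n)

/-- The divergence of a derivation `D = ∑ fᵢ ∂ᵢ`, namely `∑ ∂ᵢ(fᵢ) = ∑ ∂ᵢ(D(xᵢ))`. -/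
noncomputable def divergence (n : ℕ) (D : WittAlg p k n) : TruncPoly p k n :=
  ∑ i : Fin n, truncPD p k n i (D (truncX p k n i))

/-- The linear embedding of `W(n)` into the associative algebra of `k`-linear
endomorphisms of `A(n)`; the `p`-map of `W(n)` is `D ↦ D^p` under this embedding. -/
noncomputable def derToEnd (n : ℕ) :
    WittAlg p k n →ₗ[k] Module.End k (TruncPoly p k n) where
  toFun D := D.toLinearMap
  map_add' := fun _ _ => rfl
  map_smul' := fun _ _ => rfl

/-- The Hamiltonian map `D_H : A(2r) → W(2r)`,
`f ↦ ∑ᵢ (∂ᵢ(f) ∂_{i+r} − ∂_{i+r}(f) ∂ᵢ)`. -/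
noncomputable def DH (r : ℕ) (f : TruncPoly p k (2 * r)) : WittAlg p k (2 * r) :=
  ∑ i : Fin r,
    (truncPD p k (2 * r) ⟨i.1, by have := i.isLt; omega⟩ f •
        truncPD p k (2 * r) ⟨i.1 + r, by have := i.isLt; omega⟩
      - truncPD p k (2 * r) ⟨i.1 + r, by have := i.isLt; omega⟩ f •
        truncPD p k (2 * r) ⟨i.1, by have := i.isLt; omega⟩)

/-- The contact map `D_K : A(2r+1) → W(2r+1)` (Strade–Farnsteiner, §4.5). -/
noncomputable def DK (r : ℕ) (f : TruncPoly p k (2 * r + 1)) : WittAlg p k (2 * r + 1) :=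
  (∑ i : Fin r,
    ((truncX p k (2 * r + 1) ⟨i.1, by have := i.isLt; omega⟩ *
        truncPD p k (2 * r + 1) (Fin.last (2 * r)) f
      - truncPD p k (2 * r + 1) ⟨i.1 + r, by have := i.isLt; omega⟩ f) •
        truncPD p k (2 * r + 1) ⟨i.1, by have := i.isLt; omega⟩
    + (truncX p k (2 * r + 1) ⟨i.1 + r, by have := i.isLt; omega⟩ *
        truncPD p k (2 * r + 1) (Fin.last (2 * r)) f
      + truncPD p k (2 * r + 1) ⟨i.1, by have := i.isLt; omega⟩ f) •
        truncPD p k (2 * r + 1) ⟨i.1 + r, by have := i.isLt; omega⟩))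
  + ((2 : TruncPoly p k (2 * r + 1)) * f
      - ∑ i : Fin (2 * r), truncX p k (2 * r + 1) ⟨i.1, by have := i.isLt; omega⟩ *
          truncPD p k (2 * r + 1) ⟨i.1, by have := i.isLt; omega⟩ f) •
      truncPD p k (2 * r + 1) (Fin.last (2 * r))

/-- The derived subalgebra `[K, K]` of a Lie subalgebra. -/
noncomputable def derivedSub {L : Type*} [LieRing L] [LieAlgebra k L]
    (K : LieSubalgebra k L) : LieSubalgebra k L :=
  LieSubalgebra.lieSpan k L {z | ∃ x ∈ K, ∃ y ∈ K, z = ⁅x, y⁆}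

/-- `K''(2r+1) = {D ∈ W(n) | D(ω_K) ∈ A(n)·ω_K}`, realized as the image of `D_K`. -/
noncomputable def contactAmbient (r : ℕ) : LieSubalgebra k (WittAlg p k (2 * r + 1)) :=
  LieSubalgebra.lieSpan k _ (Set.range (DK p k r))

/-- The restricted contact algebra `K(2r+1) := [K''(2r+1), K''(2r+1)]`. -/
noncomputable def contactAlg (r : ℕ) : LieSubalgebra k (WittAlg p k (2 * r + 1)) :=
  derivedSub k (contactAmbient p k r)

/-- `H'(2r) := D_H(A(2r))`, the image of the Hamiltonian map. -/
noncomputable def hamiltonianAmbient (r : ℕ) : LieSubalgebra k (WittAlg p k (2 * r)) :=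
  LieSubalgebra.lieSpan k _ (Set.range (DH p k r))

/-- The restricted Hamiltonian algebra `H(2r) := H'(2r)^{(1)}`. -/
noncomputable def hamiltonianAlg (r : ℕ) : LieSubalgebra k (WittAlg p k (2 * r)) :=
  derivedSub k (hamiltonianAmbient p k r)

/-- `S̃(n) := {D ∈ W(n) | div(D) = 0}`. -/
noncomputable def specialAmbient (n : ℕ) : LieSubalgebra k (WittAlg p k n) :=
  LieSubalgebra.lieSpan k _ {D | divergence p k n D = 0}

/-- The restricted special algebra `S(n) := S̃(n)^{(1)}`. -/
noncomputable def specialAlg (n : ℕ) : LieSubalgebra k (WittAlg p k n) :=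
  derivedSub k (specialAmbient p k n)

/-- A torus of a `p`-subalgebra `K` of the Jacobson–Witt algebra `W(n)` (whose `p`-map is
`D ↦ D^p`, the `p`-th power in `End_k(A(n))`): a subalgebra of `K` closed under the
`p`-power map and consisting of semisimple elements. -/
def IsTorusIn (n : ℕ) (K : LieSubalgebra k (WittAlg p k n))
    (T : Submodule k (WittAlg p k n)) : Prop :=
  (∀ x ∈ T, x ∈ K) ∧
  (∀ x ∈ T, ∀ y ∈ T, ⁅x, y⁆ ∈ T) ∧
  (∀ x ∈ T, ∃ y ∈ T, derToEnd p k n y = (derToEnd p k n x) ^ p) ∧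
  (∀ x ∈ T, derToEnd p k n x ∈ Submodule.span k
    {z : Module.End k (TruncPoly p k n) | ∃ m : ℕ, 1 ≤ m ∧ z = (derToEnd p k n x) ^ (p ^ m)})

/-- `μ(K)`: the maximal dimension of a torus of `K ⊆ W(n)`. -/
noncomputable def muIn (n : ℕ) (K : LieSubalgebra k (WittAlg p k n)) : ℕ :=
  sSup {d : ℕ | ∃ T : Submodule k (WittAlg p k n),
    IsTorusIn p k n K T ∧ Module.finrank k T = d}

end CartanAlgebras

/-- The rank of a Lie subalgebra `K`: the minimal dimension of a Cartan subalgebra of the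
Lie algebra `K`. -/
noncomputable def lieRankOf (k : Type*) [Field k] {L : Type*} [LieRing L] [LieAlgebra k L]
    (K : LieSubalgebra k L) : ℕ :=
  sInf {d : ℕ | ∃ H : LieSubalgebra k K, H.IsCartanSubalgebra ∧ Module.finrank k H = d}


section PA
/-- Abstract contact coordinates. -/
structure ContactData (k A : Type*) [Field k] [CommRing A] [Algebra k A] (r : ℕ) where
  x : Fin r → A
  y : Fin r → A
  z : A
  dx : Fin r → Derivation k A A
  dy : Fin r → Derivation k A A
  dz : Derivation k A A
  dx_x : ∀ i j, dx i (x j) = if i = j then 1 else 0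
  dx_y : ∀ i j, dx i (y j) = 0
  dx_z : ∀ i, dx i z = 0
  dy_x : ∀ i j, dy i (x j) = 0
  dy_y : ∀ i j, dy i (y j) = if i = j then 1 else 0
  dy_z : ∀ i, dy i z = 0
  dz_x : ∀ j, dz (x j) = 0
  dz_y : ∀ j, dz (y j) = 0
  dz_z : dz z = 1
  ext' : ∀ D D' : Derivation k A A, (∀ j, D (x j) = D' (x j)) → (∀ j, D (y j) = D' (y j)) →
    D z = D' z → D = D'

namespace ContactData
variable {k A : Type*} [Field k] [CommRing A] [Algebra k A] {r : ℕ} (C : ContactData k A r)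

attribute [simp] dx_x dx_y dx_z dy_x dy_y dy_z dz_x dz_y dz_z

/-- contact form -/
noncomputable def om (D : Derivation k A A) : A :=
  D C.z + ∑ j, (C.x j * D (C.y j) - C.y j * D (C.x j))

noncomputable def P (i : Fin r) : Derivation k A A := C.dx i + C.y i • C.dz
noncomputable def Q (i : Fin r) : Derivation k A A := C.dy i - C.x i • C.dz

/-- contact field -/
noncomputable def K (f : A) : Derivation k A A :=
  (2 * f) • C.dz + ∑ i, ((C.P i f) • C.Q i - (C.Q i f) • C.P i)

lemma sum_apply {ι : Type*} (s : Finset ι) (D : ι → Derivation k A A) (a : A) :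
    (∑ i ∈ s, D i) a = ∑ i ∈ s, D i a := by
  classical
  induction s using Finset.induction_on with
  | empty => simp
  | insert i s hi ih => rw [Finset.sum_insert hi, Finset.sum_insert hi, Derivation.add_apply, ih]

@[simp] lemma P_x (i j) : C.P i (C.x j) = if i = j then 1 else 0 := by simp [P]
@[simp] lemma P_y (i j) : C.P i (C.y j) = 0 := by simp [P]
@[simp] lemma P_z (i) : C.P i C.z = C.y i := by simp [P]
@[simp] lemma Q_y (i j) : C.Q i (C.y j) = if i = j then 1 else 0 := by simp [Q]
@[simp] lemma Q_x (i j) : C.Q i (C.x j) = 0 := by simp [Q]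
@[simp] lemma Q_z (i) : C.Q i C.z = - C.x i := by simp [Q]

lemma K_apply (f g : A) : C.K f g = 2 * f * C.dz g + ∑ i, (C.P i f * C.Q i g - C.Q i f * C.P i g) := by
  simp [K, sum_apply]

lemma K_x (f : A) (j) : C.K f (C.x j) = - C.Q j f := by
  simp [K_apply]
lemma K_y (f : A) (j) : C.K f (C.y j) = C.P j f := by
  simp [K_apply]
lemma K_z (f : A) : C.K f C.z = 2 * f - ∑ j, (C.x j * C.P j f + C.y j * C.Q j f) := by
  simp only [K_apply, dz_z, Q_z, P_z, mul_one, sub_eq_add_neg, ← Finset.sum_neg_distrib]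
  congr 1
  exact Finset.sum_congr rfl fun i _ => by ring

lemma om_K (f : A) : C.om (C.K f) = 2 * f := by
  simp only [om, K_x, K_y, K_z]
  rw [sub_add_eq_add_sub, add_sub_assoc, ← Finset.sum_sub_distrib]
  rw [Finset.sum_eq_zero, add_zero]
  intro i _; ring

lemma expand (E : Derivation k A A) :
    E = C.om E • C.dz + ∑ i, (E (C.x i) • C.P i + E (C.y i) • C.Q i) := by
  apply C.ext'
  · intro j; simp [sum_apply]
  · intro j; simp [sum_apply]
  · simp only [Derivation.add_apply, Derivation.smul_apply, sum_apply, P_z, Q_z, dz_z, om, smul_eq_mul,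
      mul_one]
    rw [add_assoc, ← Finset.sum_add_distrib, Finset.sum_eq_zero, add_zero]
    intro i _; ring

lemma expand_apply (E : Derivation k A A) (f : A) :
    E f = C.om E * C.dz f + ∑ i, (E (C.x i) * C.P i f + E (C.y i) * C.Q i f) := by
  conv_lhs => rw [C.expand E]
  simp [sum_apply]

lemma cartan (D E : Derivation k A A) :
    D (C.om E) - C.om ⁅D, E⁆ = E (C.om D) +
      2 * ∑ j, (D (C.x j) * E (C.y j) - D (C.y j) * E (C.x j)) := by
  simp only [om, map_add, map_sum, map_sub, Derivation.leibniz, Derivation.commutator_apply,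
    smul_eq_mul, Finset.mul_sum]
  rw [add_assoc, ← Finset.sum_add_distrib, add_sub_add_comm, ← Finset.sum_sub_distrib]
  rw [sub_sub_cancel]
  congr 1
  exact Finset.sum_congr rfl fun i _ => by ring

def IsContact (D : Derivation k A A) (u : A) : Prop :=
  ∀ E : Derivation k A A, D (C.om E) - C.om ⁅D, E⁆ = u * C.om E

lemma om_sub (D E : Derivation k A A) : C.om (D - E) = C.om D - C.om E := by
  simp only [om, Derivation.sub_apply]
  rw [add_sub_add_comm, ← Finset.sum_sub_distrib]
  congr 1
  exact Finset.sum_congr rfl fun i _ => by ring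

lemma isContact_K (f : A) : C.IsContact (C.K f) (2 * C.dz f) := by
  intro E
  rw [cartan, om_K]
  have := C.expand_apply E f
  rw [Derivation.leibniz, this]
  simp only [K_x, K_y, smul_eq_mul]
  have h2 : E 2 = 0 := by
    have := E.map_natCast 2
    simpa using this
  rw [h2, mul_add, Finset.mul_sum, Finset.mul_sum, mul_zero, add_zero, add_assoc,
    ← Finset.sum_add_distrib, Finset.sum_eq_zero, add_zero]
  · ring
  · intro i _; ring

lemma IsContact.lie {D D' : Derivation k A A} {u u' : A} (h : C.IsContact D u)
    (h' : C.IsContact D' u') : C.IsContact ⁅D, D'⁆ (D u' - D' u) := by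
  intro E
  have e1 : C.om ⁅⁅D, D'⁆, E⁆ = C.om ⁅D, ⁅D', E⁆⁆ - C.om ⁅D', ⁅D, E⁆⁆ := by
    rw [← om_sub, ← lie_lie]
  have a1 := h ⁅D', E⁆
  have a2 := h' ⁅D, E⁆
  have a3 := congrArg D (h' E)
  have a4 := congrArg D' (h E)
  have a5 := h E
  have a6 := h' E
  simp only [map_sub, Derivation.leibniz, smul_eq_mul] at a3 a4
  rw [e1, Derivation.commutator_apply]
  linear_combination a1 - a2 + a3 - a4 - u * a6 + u' * a5

lemma IsContact.eq (h2 : IsUnit (2 : A)) {D D' : Derivation k A A} {u u' : A} (h : C.IsContact D u)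
    (h' : C.IsContact D' u') (hom : C.om D = C.om D') : D = D' := by
  have key : ∀ E, 2 * ∑ j, ((D - D') (C.x j) * E (C.y j) - (D - D') (C.y j) * E (C.x j))
      = (u - u') * C.om E := by
    intro E
    have a := h E
    have b := h' E
    rw [cartan] at a b
    rw [sub_mul, ← a, ← b, hom, add_sub_add_left_eq_sub, ← mul_sub, ← Finset.sum_sub_distrib]
    congr 1
    exact Finset.sum_congr rfl fun i _ => by simp; ring
  have hx : ∀ i, D (C.x i) = D' (C.x i) := by
    intro i
    have := key (C.Q i)
    simp [om] at this
    rw [h2.mul_right_eq_zero] at this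
    exact sub_eq_zero.mp this
  have hy : ∀ i, D (C.y i) = D' (C.y i) := by
    intro i
    have := key (C.P i)
    simp [om] at this
    rw [h2.mul_right_eq_zero] at this
    exact (sub_eq_zero.mp this).symm
  refine C.ext' _ _ hx hy ?_
  simpa [om, hx, hy] using hom

/-- the contact bracket, as linear map in second argument -/
noncomputable def B (f : A) : A →ₗ[k] A :=
  (C.K f).toLinearMap - LinearMap.mulLeft k (2 * C.dz f)

lemma B_apply (f g : A) : C.B f g = C.K f g - 2 * C.dz f * g := rfl

lemma lie_K (h2 : IsUnit (2 : A)) (f g : A) : ⁅C.K f, C.K g⁆ = C.K (C.B f g) := by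
  refine IsContact.eq C h2 (IsContact.lie C (C.isContact_K f) (C.isContact_K g))
    (C.isContact_K _) ?_
  have := C.isContact_K f (C.K g)
  rw [om_K] at this
  have h2 : C.K f 2 = 0 := by
    have := (C.K f).map_natCast 2
    simpa using this
  rw [Derivation.leibniz, h2] at this
  rw [om_K, B_apply]
  simp only [smul_eq_mul] at this
  linear_combination -this

lemma K_add (f g : A) : C.K (f + g) = C.K f + C.K g := by
  ext a
  simp only [K_apply, Derivation.add_apply, map_add]
  rw [add_add_add_comm, ← Finset.sum_add_distrib]
  congr 1
  · ring
  · exact Finset.sum_congr rfl fun i _ => by ring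

lemma K_smul (c : k) (g : A) : C.K (c • g) = c • C.K g := by
  ext a
  simp only [K_apply, Derivation.smul_apply, Derivation.map_smul, smul_add, Finset.smul_sum, smul_sub,
    Algebra.smul_mul_assoc, Algebra.mul_smul_comm]

noncomputable def Klin : A →ₗ[k] Derivation k A A where
  toFun := C.K
  map_add' := C.K_add
  map_smul' := C.K_smul

lemma Klin_injective (h2 : IsUnit (2 : A)) : Function.Injective C.Klin := by
  intro f g h
  have := congrArg C.om (show C.K f = C.K g from h)
  rw [om_K, om_K] at this
  exact h2.mul_left_cancel this

lemma B_add (f g : A) : C.B (f + g) = C.B f + C.B g := by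
  ext a
  simp only [B_apply, K_add, Derivation.add_apply, map_add, LinearMap.add_apply]
  ring
lemma B_smul (c : k) (g : A) : C.B (c • g) = c • C.B g := by
  ext a
  simp only [B_apply, K_smul, Derivation.smul_apply, Derivation.map_smul, LinearMap.smul_apply, smul_sub,
    Algebra.smul_mul_assoc, Algebra.mul_smul_comm]

lemma lie_PQ (i) (g : A) : C.P i (C.Q i g) - C.Q i (C.P i g) = - (2 * C.dz g) := by
  have : ⁅C.P i, C.Q i⁆ = - ((2 : A) • C.dz) := by
    apply C.ext'
    · intro j
      simp only [Derivation.commutator_apply, Q_x, P_x, map_zero]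
      split_ifs <;> simp
    · intro j
      simp only [Derivation.commutator_apply, Q_y, P_y, map_zero]
      split_ifs <;> simp
    · simp only [Derivation.commutator_apply, Q_z, P_z, map_neg, P_x, Q_y]
      simp; ring
  have := DFunLike.congr_fun this g
  simpa [Derivation.commutator_apply] using this

lemma int_B (I : A →ₗ[k] k) (hx : ∀ i g, I (C.dx i g) = 0) (hy : ∀ i g, I (C.dy i g) = 0)
    (hz : ∀ g, I (C.dz g) = 0) (hr : (2 * r + 4 : k) = 0) (f g : A) : I (C.B f g) = 0 := by
  have hP : ∀ i g, I (C.P i g) = 0 := by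
    intro i g
    have : C.P i g = C.dx i g + C.dz (C.y i * g) := by simp [P]
    rw [this, map_add, hx, hz, add_zero]
  have hQ : ∀ i g, I (C.Q i g) = 0 := by
    intro i g
    have : C.Q i g = C.dy i g - C.dz (C.x i * g) := by simp [Q]
    rw [this, map_sub, hy, hz, sub_zero]
  have e : C.B f g = (2 * r + 4 : k) • (f * C.dz g) - (2:k) • C.dz (f * g) +
      ∑ i, (C.P i (f * C.Q i g) - C.Q i (f * C.P i g)) := by
    have : ∀ i ∈ Finset.univ, C.P i (f * C.Q i g) - C.Q i (f * C.P i g) =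
        (C.P i f * C.Q i g - C.Q i f * C.P i g) - 2 * f * C.dz g := by
      intro i _
      have := C.lie_PQ i g
      simp only [Derivation.leibniz, smul_eq_mul]
      linear_combination f * this
    rw [Finset.sum_congr rfl this, Finset.sum_sub_distrib, B_apply, K_apply]
    simp only [Finset.sum_const, Finset.card_univ, Fintype.card_fin, Derivation.leibniz,
      nsmul_eq_mul, smul_eq_mul]
    simp only [Algebra.smul_def, map_add, map_mul, map_natCast, map_ofNat]
    ring
  rw [e, hr, zero_smul, zero_sub, map_add, map_neg, map_smul, hz, map_sum,
    Finset.sum_eq_zero]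
  · simp
  · intro i _
    rw [map_sub, hP, hQ, sub_zero]

end ContactData
end PA

section PB
open Module

/-- polynomial functions -/
def PF (k V : Type*) [Field k] [AddCommGroup V] [Module k V] : Submodule k (k → V) :=
  Submodule.span k {F | ∃ (i : ℕ) (v : V), F = fun s => s ^ i • v}

namespace PF
variable {k V W A : Type*} [Field k] [AddCommGroup V] [Module k V] [AddCommGroup W] [Module k W]
  [CommRing A] [Algebra k A]

lemma const (v : V) : (fun _ => v) ∈ PF k V :=
  Submodule.subset_span ⟨0, v, by simp⟩

lemma comp (T : V →ₗ[k] W) {F : k → V} (hF : F ∈ PF k V) : (fun s => T (F s)) ∈ PF k W := by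
  induction hF using Submodule.span_induction with
  | mem F h =>
    obtain ⟨i, v, rfl⟩ := h
    exact Submodule.subset_span ⟨i, T v, by simp⟩
  | zero => simpa [Pi.zero_def] using (PF k W).zero_mem
  | add F G _ _ hF hG => simpa [Pi.add_def] using (PF k W).add_mem hF hG
  | smul c F _ hF => simpa [Pi.smul_def] using (PF k W).smul_mem c hF

lemma smul {F : k → V} (hF : F ∈ PF k V) : (fun s => s • F s) ∈ PF k V := by
  induction hF using Submodule.span_induction with
  | mem F h =>
    obtain ⟨i, v, rfl⟩ := h
    exact Submodule.subset_span ⟨i + 1, v, by ext s; simp [smul_smul, pow_succ']⟩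
  | zero => simpa [Pi.zero_def] using (PF k V).zero_mem
  | add F G _ _ hF hG => simpa [Pi.add_def] using (PF k V).add_mem hF hG
  | smul c F _ hF =>
    have := (PF k V).smul_mem c hF
    convert this using 1
    ext s; exact smul_comm _ _ _

lemma pow_smul {F : k → V} (hF : F ∈ PF k V) (i : ℕ) : (fun s => s ^ i • F s) ∈ PF k V := by
  induction i with
  | zero => simpa using hF
  | succ i ih =>
    have := smul ih
    convert this using 1
    ext s; simp [smul_smul, pow_succ']

lemma mul {F G : k → A} (hF : F ∈ PF k A) (hG : G ∈ PF k A) : (fun s => F s * G s) ∈ PF k A := by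
  induction hF using Submodule.span_induction with
  | mem F h =>
    obtain ⟨i, v, rfl⟩ := h
    have := pow_smul (comp (LinearMap.mulLeft k v) hG) i
    simpa using this
  | zero => simpa [Pi.zero_def] using (PF k A).zero_mem
  | add F G _ _ hF hG => simpa [Pi.add_def, add_mul] using (PF k A).add_mem hF hG
  | smul c F _ hF => simpa [Pi.smul_def] using (PF k A).smul_mem c hF

lemma add {F G : k → V} (hF : F ∈ PF k V) (hG : G ∈ PF k V) : (fun s => F s + G s) ∈ PF k V :=
  (PF k V).add_mem hF hG

lemma sum {ι : Type*} (t : Finset ι) {F : ι → k → V} (hF : ∀ i ∈ t, F i ∈ PF k V) :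
    (fun s => ∑ i ∈ t, F i s) ∈ PF k V := by
  have := (PF k V).sum_mem hF
  convert this using 1
  ext s; simp

lemma prod {ι : Type*} (t : Finset ι) {F : ι → k → A} (hF : ∀ i ∈ t, F i ∈ PF k A) :
    (fun s => ∏ i ∈ t, F i s) ∈ PF k A := by
  classical
  induction t using Finset.induction_on with
  | empty => simpa using const (1 : A)
  | insert i t hi ih =>
    simp only [Finset.prod_insert hi]
    exact mul (hF i (Finset.mem_insert_self i t))
      (ih fun j hj => hF j (Finset.mem_insert_of_mem hj))

lemma pow {F : k → A} (hF : F ∈ PF k A) (n : ℕ) : (fun s => F s ^ n) ∈ PF k A := by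
  induction n with
  | zero => simpa using const (1 : A)
  | succ n ih => simpa [pow_succ] using mul ih hF

lemma exists_poly {F : k → k} (hF : F ∈ PF k k) : ∃ P : Polynomial k, ∀ s, F s = P.eval s := by
  induction hF using Submodule.span_induction with
  | mem F h =>
    obtain ⟨i, v, rfl⟩ := h
    exact ⟨Polynomial.X ^ i * Polynomial.C v, fun s => by simp; exact mul_comm _ _⟩
  | zero => exact ⟨0, by simp⟩
  | add F G _ _ hF hG =>
    obtain ⟨P, hP⟩ := hF
    obtain ⟨Q, hQ⟩ := hG
    exact ⟨P + Q, by simp [hP, hQ]⟩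
  | smul c F _ hF =>
    obtain ⟨P, hP⟩ := hF
    exact ⟨Polynomial.C c * P, by simp [hP]⟩

lemma finite_not_li {ι : Type*} [Finite ι] {F : ι → k → V} (hF : ∀ i, F i ∈ PF k V) (s₀ : k)
    (h : LinearIndependent k (fun i => F i s₀)) :
    {s | ¬ LinearIndependent k (fun i => F i s)}.Finite := by
  classical
  cases nonempty_fintype ι
  obtain ⟨φ, hφ⟩ : ∃ φ : ι → (V →ₗ[k] k), ∀ i j, φ i (F j s₀) = if i = j then 1 else 0 := by
    let b := Basis.extend (K := k) h.linearIndepOn_id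
    obtain ⟨T, hT⟩ := LinearMap.exists_leftInverse_of_injective
      (Finsupp.linearCombination k (fun i => F i s₀)) (LinearMap.ker_eq_bot.mpr h)
    refine ⟨fun i => Finsupp.lapply i ∘ₗ T, fun i j => ?_⟩
    have := LinearMap.congr_fun hT (Finsupp.single j 1)
    simp only [LinearMap.comp_apply, Finsupp.linearCombination_single, one_smul] at this
    simp [this, Finsupp.single_apply, eq_comm]
  have hdet : (fun s => Matrix.det (Matrix.of fun i j => φ i (F j s))) ∈ PF k k := by
    simp only [Matrix.det_apply, Matrix.of_apply]
    refine sum _ fun σ _ => ?_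
    have := prod Finset.univ (F := fun i s => φ (σ i) (F i s)) (fun i _ => comp (φ (σ i)) (hF i))
    have h2 := comp (V := k) (W := k) ((Equiv.Perm.sign σ : ℤ) • LinearMap.id) this
    simpa [Units.smul_def] using h2
  obtain ⟨P, hP⟩ := exists_poly hdet
  have hP0 : P ≠ 0 := by
    rintro rfl
    have := hP s₀
    simp only [hφ, Polynomial.eval_zero] at this
    have e : (Matrix.of fun i j : ι => if i = j then (1:k) else 0) = 1 := by
      ext i j; simp [Matrix.one_apply]
    rw [e, Matrix.det_one] at this
    exact one_ne_zero this
  refine (P.roots.toFinset.finite_toSet).subset ?_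
  intro s hs
  simp only [Finset.mem_coe, Multiset.mem_toFinset, Polynomial.mem_roots hP0, Polynomial.IsRoot]
  by_contra hne
  apply hs
  rw [← hP] at hne
  rw [Fintype.linearIndependent_iff]
  intro g hg
  have := Matrix.eq_zero_of_mulVec_eq_zero hne (v := g) (by
    ext i
    have := congrArg (φ i) hg
    simp only [map_sum, map_smul, smul_eq_mul, map_zero] at this
    simp only [Matrix.mulVec, dotProduct, Matrix.of_apply, Pi.zero_apply]
    rw [← this]
    exact Finset.sum_congr rfl fun j _ => mul_comm _ _)
  exact fun i => congrFun this i

/-- semicontinuity of the kernel dimension along a line -/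
lemma ker_ge [Infinite k] [FiniteDimensional k V] {ι : Type*} [Fintype ι] (T₀ T₁ : V →ₗ[k] V)
    (F : ι → k → V) (hF : ∀ i, F i ∈ PF k V) (hli : LinearIndependent k (fun i => F i 0))
    (hker : ∀ s i, (T₀ + s • T₁) (F i s) = 0) :
    Fintype.card ι ≤ finrank k (LinearMap.ker (T₀ + T₁)) := by
  have h1 := finite_not_li hF 0 hli
  let b := Module.finBasis k (LinearMap.range (T₀ + T₁))
  choose v hv using fun j => (b j).2
  have h2 := finite_not_li (F := fun j s => T₀ (v j) + s • T₁ (v j))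
    (fun j => add (const _) (smul (const _))) (1:k) (by
      have := b.linearIndependent.map' (Submodule.subtype _) (Submodule.ker_subtype _)
      have e : (fun j => T₀ (v j) + (1:k) • T₁ (v j)) =
          (LinearMap.range (T₀ + T₁)).subtype ∘ b := by
        ext j
        simp [← hv]
      rw [e]
      exact this)
  obtain ⟨s, hs⟩ := (h1.union h2).infinite_compl.nonempty
  simp only [Set.mem_compl_iff, Set.mem_union, Set.mem_ofPred_eq, not_or, not_not] at hs
  obtain ⟨hs1, hs2⟩ := hs
  have e1 : Fintype.card ι ≤ finrank k (LinearMap.ker (T₀ + s • T₁)) := by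
    let w : ι → LinearMap.ker (T₀ + s • T₁) := fun i => ⟨F i s, hker s i⟩
    have : LinearIndependent k w := LinearIndependent.of_comp (Submodule.subtype _) hs1
    exact this.fintype_card_le_finrank
  have e2 : finrank k (LinearMap.range (T₀ + T₁)) ≤ finrank k (LinearMap.range (T₀ + s • T₁)) := by
    let w : Fin (finrank k (LinearMap.range (T₀ + T₁))) → LinearMap.range (T₀ + s • T₁) :=
      fun j => ⟨T₀ (v j) + s • T₁ (v j), ⟨v j, by simp⟩⟩
    have : LinearIndependent k w := LinearIndependent.of_comp (Submodule.subtype _) hs2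
    simpa using this.fintype_card_le_finrank
  have e3 := LinearMap.finrank_range_add_finrank_ker (T₀ + T₁)
  have e4 := LinearMap.finrank_range_add_finrank_ker (T₀ + s • T₁)
  omega
end PF

section dpow
variable {k A : Type*} [Field k] [CommRing A] [Algebra k A] (p : ℕ) [hp : Fact p.Prime] [CharP k p]

lemma der_pow_leibniz (D : Derivation k A A) (i : ℕ) (a b : A) :
    (D.toLinearMap ^ p ^ i) (a * b) =
      a * (D.toLinearMap ^ p ^ i) b + b * (D.toLinearMap ^ p ^ i) a := by
  rcases subsingleton_or_nontrivial A with hA | hA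
  · exact Subsingleton.elim _ _
  let E := Module.End k A
  have : CharP (Module.End k E) p :=
    charP_of_injective_algebraMap (algebraMap k (Module.End k E)).injective p
  let L : E →ₗ[k] E := LinearMap.mulLeft k (D.toLinearMap : E)
  let R : E →ₗ[k] E := LinearMap.mulRight k (D.toLinearMap : E)
  have h := sub_pow_char_pow_of_commute (p := p) (n := i) (x := L) (y := R)
    (LinearMap.commute_mulLeft_right _ _)
  have step : ∀ c : A, (L - R) (LinearMap.mulLeft k c : E) = LinearMap.mulLeft k (D c) := by
    intro c
    ext x
    change D (c * x) - c * D x = D c * x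
    simp
    ring
  have step2 : ∀ (n : ℕ) (c : A), ((L - R) ^ n) (LinearMap.mulLeft k c : E) =
      LinearMap.mulLeft k ((D.toLinearMap ^ n) c) := by
    intro n
    induction n with
    | zero => intro c; rfl
    | succ n ih =>
      intro c
      rw [pow_succ, Module.End.mul_apply, step, ih, pow_succ]
      rfl
  have h3 := step2 (p ^ i) a
  rw [h, LinearMap.pow_mulLeft, LinearMap.pow_mulRight] at h3
  have h4 : (D.toLinearMap ^ p ^ i) (a * b) - a * (D.toLinearMap ^ p ^ i) b =
      (D.toLinearMap ^ p ^ i) a * b := LinearMap.congr_fun h3 b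
  linear_combination h4

/-- iterated `p`-th power of a derivation -/
noncomputable def dpow (D : Derivation k A A) (i : ℕ) : Derivation k A A :=
  Derivation.mk' (D.toLinearMap ^ p ^ i) (fun a b => by
    simpa using der_pow_leibniz p D i a b)

lemma dpow_apply (D : Derivation k A A) (i : ℕ) (a : A) :
    dpow p D i a = (D.toLinearMap ^ p ^ i) a := rfl

lemma lie_dpow (D : Derivation k A A) (i : ℕ) : ⁅D, dpow p D i⁆ = 0 := by
  ext a
  rw [Derivation.commutator_apply, dpow_apply, dpow_apply]
  have h : D.toLinearMap * D.toLinearMap ^ p ^ i = D.toLinearMap ^ p ^ i * D.toLinearMap := by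
    rw [← pow_succ, ← pow_succ']
  have := LinearMap.congr_fun h a
  exact sub_eq_zero.mpr this
end dpow
end PB

section PC
open Module

/-- a generic parameter -/
lemma exists_generic (k : Type*) [Field k] [Infinite k] (p : ℕ) (hp : 2 ≤ p) (N : ℕ) :
    ∃ t : k, Function.Injective (fun i : Fin N => t ^ p ^ (i : ℕ)) := by
  classical
  let S : Set k := ⋃ ij : Fin N × Fin N, if ij.1 = ij.2 then ∅ else
    {t | (Polynomial.X ^ p ^ (ij.1 : ℕ) - Polynomial.X ^ p ^ (ij.2 : ℕ) : Polynomial k).IsRoot t}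
  have hS : S.Finite := by
    refine Set.finite_iUnion fun ij => ?_
    split_ifs with h
    · exact Set.finite_empty
    · refine Polynomial.finite_setOfPred_isRoot ?_
      intro h0
      rw [sub_eq_zero] at h0
      have := congrArg Polynomial.natDegree h0
      rw [Polynomial.natDegree_X_pow, Polynomial.natDegree_X_pow] at this
      exact h (Fin.ext (Nat.pow_right_injective hp this))
  obtain ⟨t, ht⟩ := hS.infinite_compl.nonempty
  refine ⟨t, fun i j hij => ?_⟩
  by_contra hne
  apply ht
  refine Set.mem_iUnion.mpr ⟨(i, j), ?_⟩
  rw [if_neg hne]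
  simpa [Polynomial.IsRoot, sub_eq_zero] using hij

namespace ContactData
variable {k A : Type*} [Field k] [CommRing A] [Algebra k A] {r : ℕ} (C : ContactData k A r)
  (p : ℕ) [hp : Fact p.Prime] [CharP k p]

/-- the Hamiltonian of `D_K(f)^(p^i)` -/
noncomputable def G (i : ℕ) (f : A) : A := (2⁻¹ : k) • C.om (dpow p (C.K f) i)

lemma K_G (i : ℕ) (f : A) : C.K f (C.G p i f) = 2 * C.dz f * C.G p i f := by
  have := C.isContact_K f (dpow p (C.K f) i)
  rw [lie_dpow] at this
  have h0 : C.om (0 : Derivation k A A) = 0 := by simp [om]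
  rw [h0, sub_zero] at this
  rw [G, Derivation.map_smul, this, mul_smul_comm]

lemma G_PF (i : ℕ) (f₀ f₁ : A) : (fun s : k => C.G p i (f₀ + s • f₁)) ∈ PF k A := by
  have key : ∀ (n : ℕ) (a : A),
      (fun s : k => ((C.K (f₀ + s • f₁)).toLinearMap ^ n) a) ∈ PF k A := by
    intro n
    induction n with
    | zero => intro a; exact PF.const a
    | succ n ih =>
      intro a
      have h1 := PF.add (PF.comp (C.K f₀).toLinearMap (ih a))
        (PF.smul (PF.comp (C.K f₁).toLinearMap (ih a)))
      convert h1 using 1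
      ext s
      rw [pow_succ', Module.End.mul_apply]
      simp [K_add, K_smul]
  unfold G om
  refine (PF k A).smul_mem (2⁻¹ : k) ?_
  refine PF.add (key _ _) (PF.sum _ fun j _ => ?_)
  exact (PF k A).sub_mem (PF.mul (PF.const _) (key _ _)) (PF.mul (PF.const _) (key _ _))

noncomputable def u (j : Fin r) : A := (1 + C.x j) * C.y j

lemma pow_eigen (D : Derivation k A A) (c : k) (a : A) (h : D a = c • a) (n : ℕ) :
    (D.toLinearMap ^ n) a = c ^ n • a := by
  induction n with
  | zero => simp
  | succ n ih => rw [pow_succ', Module.End.mul_apply, ih, map_smul]; simp [h, smul_smul, pow_succ]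

lemma f0_P (α : Fin r → k) (j) : C.P j (1 + ∑ i, α i • C.u i) = α j • C.y j := by
  simp only [map_add, Derivation.map_one_eq_zero, zero_add, map_sum, Derivation.map_smul, u,
    Derivation.leibniz, P_x, P_y, smul_eq_mul, mul_zero, mul_ite, mul_one]
  simp

lemma f0_Q (α : Fin r → k) (j) : C.Q j (1 + ∑ i, α i • C.u i) = α j • (1 + C.x j) := by
  simp only [map_add, Derivation.map_one_eq_zero, zero_add, map_sum, Derivation.map_smul, u,
    Derivation.leibniz, Q_x, Q_y, smul_eq_mul, mul_zero, mul_ite, mul_one, add_zero]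
  simp

lemma G_f0 (hp3 : 3 ≤ p) (α : Fin r → k) (i : ℕ) (hi : 1 ≤ i) :
    C.G p i (1 + ∑ i, α i • C.u i) = ∑ j, (α j ^ p ^ i) • C.u j := by
  have h2k : (2 : k) ≠ 0 := by
    intro h
    have : ((2 : ℕ) : k) = 0 := by exact_mod_cast h
    rw [CharP.cast_eq_zero_iff k p] at this
    have := Nat.le_of_dvd (by norm_num) this
    omega
  have hodd : Odd (p ^ i) := (hp.out.odd_of_ne_two (by omega)).pow
  obtain ⟨q, hq⟩ : ∃ q, p ^ i = q + 2 := by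
    have : 3 ≤ p ^ i := hp3.trans (Nat.le_self_pow (by omega) p)
    exact ⟨p ^ i - 2, by omega⟩
  set f := 1 + ∑ i, α i • C.u i with hf
  have hy : ∀ j, dpow p (C.K f) i (C.y j) = α j ^ p ^ i • C.y j := by
    intro j
    rw [dpow_apply]
    refine pow_eigen _ _ _ ?_ _
    rw [K_y, f0_P]
  have hx : ∀ j, dpow p (C.K f) i (C.x j) = - (α j ^ p ^ i • (1 + C.x j)) := by
    intro j
    have h1 : (C.K f) (1 + C.x j) = (- α j) • (1 + C.x j) := by
      rw [map_add, Derivation.map_one_eq_zero, zero_add, K_x, f0_Q, neg_smul]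
    have := pow_eigen _ _ _ h1 (p ^ i)
    rw [← dpow_apply, map_add, Derivation.map_one_eq_zero, zero_add, hodd.neg_pow, neg_smul] at this
    exact this
  have hKz : C.K f C.z = 2 + ∑ j, α j • C.y j := by
    rw [K_z]
    have hP : ∀ j, C.P j f = _ := C.f0_P α
    have hQ : ∀ j, C.Q j f = _ := C.f0_Q α
    simp only [hP, hQ]
    rw [hf, mul_add, mul_one, add_sub_assoc, Finset.mul_sum, ← Finset.sum_sub_distrib]
    congr 1
    refine Finset.sum_congr rfl fun j _ => ?_
    simp only [u, Algebra.smul_def]; ring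
  have hz : dpow p (C.K f) i C.z = ∑ j, α j ^ p ^ i • C.y j := by
    have e1 : ((C.K f).toLinearMap ^ 2) C.z = ∑ j, (α j ^ 2) • C.y j := by
      rw [pow_two, Module.End.mul_apply]
      change C.K f (C.K f C.z) = _
      have h2 : C.K f 2 = 0 := by
        have := (C.K f).map_natCast 2
        simpa using this
      rw [hKz, map_add, h2, zero_add, map_sum]
      refine Finset.sum_congr rfl fun j _ => ?_
      rw [Derivation.map_smul, K_y, f0_P, smul_smul, pow_two]
    rw [dpow_apply, hq, pow_add, Module.End.mul_apply, e1, map_sum]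
    refine Finset.sum_congr rfl fun j _ => ?_
    rw [map_smul, pow_eigen (C.K f) (α j) (C.y j) (by rw [K_y, f0_P]), smul_smul, pow_add, mul_comm]
  rw [G, inv_smul_eq_iff₀ h2k, om, hz, ← Finset.sum_add_distrib, Finset.smul_sum]
  refine Finset.sum_congr rfl fun j _ => ?_
  rw [hx, hy]
  simp only [u, Algebra.smul_def, map_ofNat]; ring

lemma K_pow (D : Derivation k A A) (c a : A) (h : D a = c * a) (n : ℕ) :
    D (a ^ n) = n * c * a ^ n := by
  induction n with
  | zero => simp
  | succ n ih =>
    rw [pow_succ, Derivation.leibniz, ih, h]; push_cast; simp only [smul_eq_mul]; ring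

lemma K_prod (D : Derivation k A A) (c : A) {ι : Type*} (t : Finset ι) (a : ι → A) (e : ι → ℕ)
    (h : ∀ i, D (a i) = c * a i) :
    D (∏ i ∈ t, a i ^ e i) = (∑ i ∈ t, e i : ℕ) * c * ∏ i ∈ t, a i ^ e i := by
  classical
  induction t using Finset.induction_on with
  | empty => simp
  | insert i t hi ih =>
    rw [Finset.prod_insert hi, Derivation.leibniz, ih, K_pow D c (a i) (h i), Finset.sum_insert hi]
    push_cast; simp only [smul_eq_mul]; ring

/-- the kernel elements -/
lemma B_w (f : A) (g : Fin r → A) (hg : ∀ i, C.K f (g i) = 2 * C.dz f * g i)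
    (e : Fin r → ℕ) (he : ∑ i, e i ≤ r * p) :
    C.B f (f ^ (r * p + 1 - ∑ i, e i) * ∏ i, g i ^ e i) = 0 := by
  have hf : C.K f f = 2 * C.dz f * f := by
    rw [K_apply, Finset.sum_eq_zero]
    · ring
    · intro i _; ring
  have hA : ((p : ℕ) : A) = 0 := by
    have : ((p : ℕ) : A) = algebraMap k A (p : k) := (map_natCast (algebraMap k A) p).symm
    rw [this, CharP.cast_eq_zero, map_zero]
  rw [B_apply, Derivation.leibniz, K_pow _ _ _ hf, K_prod _ _ _ _ _ hg]
  have : ((r * p + 1 - ∑ i, e i : ℕ) : A) + ((∑ i, e i : ℕ) : A) = 1 := by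
    rw [← Nat.cast_add, Nat.sub_add_cancel (by omega)]
    push_cast; rw [hA]; ring
  simp only [smul_eq_mul]
  linear_combination 2 * C.dz f * f ^ (r * p + 1 - ∑ i, e i) * (∏ i, g i ^ e i) * this

lemma li_w [Nontrivial A] (hx : ∀ j, C.x j ^ p = 0) (hy : ∀ j, C.y j ^ p = 0)
    (hy' : ∏ j, C.y j ^ (p - 1) ≠ 0) (α : Fin r → k) :
    LinearIndependent k (fun e : Fin r → Fin p =>
      (1 + ∑ i, α i • C.u i) ^ (r * p + 1 - ∑ i, (e i : ℕ)) * ∏ i, C.u i ^ (e i : ℕ)) := by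
  classical
  have : CharP A p := charP_of_injective_algebraMap (algebraMap k A).injective p
  have hu : ∀ j, C.u j ^ p = 0 := fun j => by rw [u, mul_pow, hy, mul_zero]
  set f := 1 + ∑ i, α i • C.u i with hf
  have hfu : IsUnit f := by
    refine IsUnit.of_pow_eq_one (n := p) ?_ hp.out.ne_zero
    rw [hf, add_pow_char, one_pow, sum_pow_char, Finset.sum_eq_zero, add_zero]
    intro i _
    rw [smul_pow, hu, smul_zero]
  have hxu : ∀ j, IsUnit (1 + C.x j) := fun j => by
    refine IsUnit.of_pow_eq_one (n := p) ?_ hp.out.ne_zero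
    rw [add_pow_char, hx, one_pow, add_zero]
  rw [Fintype.linearIndependent_iff]
  intro c hc
  by_contra hne
  push Not at hne
  obtain ⟨e, he, hmin⟩ := Finset.exists_min_image (Finset.univ.filter fun e => c e ≠ 0)
    (fun e => ∑ i, (e i : ℕ)) (by obtain ⟨e, he⟩ := hne; exact ⟨e, by simpa using he⟩)
  simp only [Finset.mem_filter, Finset.mem_univ, true_and] at he hmin
  have hc2 := congrArg (fun a => a * ∏ i, C.u i ^ (p - 1 - (e i : ℕ))) hc
  simp only [zero_mul, Finset.sum_mul] at hc2
  rw [Finset.sum_eq_single e] at hc2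
  · rw [smul_mul_assoc, mul_assoc, ← Finset.prod_mul_distrib] at hc2
    have e1 : ∀ i ∈ Finset.univ, C.u i ^ (e i : ℕ) * C.u i ^ (p - 1 - (e i : ℕ)) =
        (1 + C.x i) ^ (p - 1) * C.y i ^ (p - 1) := by
      intro i _
      rw [← pow_add, ← mul_pow, u]
      congr 1
      have := (e i).2
      omega
    rw [Finset.prod_congr rfl e1, Finset.prod_mul_distrib] at hc2
    rcases smul_eq_zero.mp hc2 with h | h
    · exact he h
    · rw [(hfu.pow _).mul_right_eq_zero] at h
      have hU : IsUnit (∏ i, (1 + C.x i) ^ (p - 1)) := by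
        refine Finset.prod_induction _ IsUnit (fun _ _ ha hb => ha.mul hb) isUnit_one ?_
        intro i _; exact (hxu i).pow _
      rw [hU.mul_right_eq_zero] at h
      exact hy' h
  · intro e' _ hne'
    by_cases hc' : c e' = 0
    · rw [hc', zero_smul, zero_mul]
    · have hle := hmin e' hc'
      obtain ⟨i, hi⟩ : ∃ i, (e i : ℕ) < e' i := by
        by_contra hcon
        push Not at hcon
        have heq : ∑ i, (e' i : ℕ) = ∑ i, (e i : ℕ) :=
          le_antisymm (Finset.sum_le_sum fun i _ => hcon i) hle
        rw [Finset.sum_eq_sum_iff_of_le (fun i _ => hcon i)] at heq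
        exact hne' (funext fun i => Fin.ext (heq i (Finset.mem_univ i)))
      have h0 : (∏ i, C.u i ^ (e' i : ℕ)) * ∏ i, C.u i ^ (p - 1 - (e i : ℕ)) = 0 := by
        rw [← Finset.prod_mul_distrib]
        refine Finset.prod_eq_zero (Finset.mem_univ i) ?_
        rw [← pow_add]
        exact pow_eq_zero_of_le (by have := (e i).2; omega) (hu i)
      rw [smul_mul_assoc, mul_assoc, h0, mul_zero, smul_zero]
  · simp

theorem ker_B_ge [Infinite k] [FiniteDimensional k A] [Nontrivial A] (hp3 : 3 ≤ p)
    (hx : ∀ j, C.x j ^ p = 0) (hy : ∀ j, C.y j ^ p = 0)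
    (hy' : ∏ j, C.y j ^ (p - 1) ≠ 0) (f : A) :
    p ^ r ≤ finrank k (LinearMap.ker (C.B f)) := by
  classical
  obtain ⟨t, ht⟩ := exists_generic k p (by omega) (r + 1)
  let v : Fin r → k := fun i => t ^ p ^ ((i : ℕ) + 1)
  have hv : Function.Injective v := by
    intro i j hij
    have := @ht i.succ j.succ (by simpa using hij)
    simpa using this
  let V := Matrix.vandermonde v
  have hdet : IsUnit V.det := (Matrix.det_vandermonde_ne_zero_iff.mpr hv).isUnit
  let α : Fin r → k := fun j => t ^ (j : ℕ)
  have hV : ∀ i j, V i j = α j ^ p ^ ((i : ℕ) + 1) := by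
    intro i j
    simp only [V, Matrix.vandermonde_apply, v, α, ← pow_mul, mul_comm]
  set f₀ : A := 1 + ∑ i, α i • C.u i with hf0
  let f₁ := f - f₀
  let g : Fin r → k → A := fun j s => ∑ i, (V⁻¹ j i) • C.G p ((i : ℕ) + 1) (f₀ + s • f₁)
  have hg0 : ∀ j, g j 0 = C.u j := by
    intro j
    simp only [g, zero_smul, add_zero]
    have : ∀ i ∈ Finset.univ, (V⁻¹ j i) • C.G p ((i : Fin r) + 1 : ℕ) f₀ =
        ∑ l, (V⁻¹ j i * V i l) • C.u l := by
      intro i _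
      rw [hf0, G_f0 C p hp3 α _ (by omega), Finset.smul_sum]
      refine Finset.sum_congr rfl fun l _ => ?_
      rw [smul_smul, hV]
    rw [Finset.sum_congr rfl this, Finset.sum_comm]
    simp only [← Finset.sum_smul, ← Matrix.mul_apply, Matrix.nonsing_inv_mul V hdet,
      Matrix.one_apply]
    simp
  have hgP : ∀ j, g j ∈ PF k A := by
    intro j
    refine PF.sum _ (F := fun i s => (V⁻¹ j i) • C.G p ((i : ℕ) + 1) (f₀ + s • f₁)) fun i _ => ?_
    exact (PF k A).smul_mem _ (C.G_PF p _ _ _)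
  have hgK : ∀ s j, C.K (f₀ + s • f₁) (g j s) = 2 * C.dz (f₀ + s • f₁) * g j s := by
    intro s j
    simp only [g, map_sum, Derivation.map_smul, K_G, Finset.mul_sum, mul_smul_comm]
  have := PF.ker_ge (C.B f₀) (C.B f₁) (fun (e : Fin r → Fin p) s =>
      (f₀ + s • f₁) ^ (r * p + 1 - ∑ i, (e i : ℕ)) * ∏ i, g i s ^ (e i : ℕ)) ?_ ?_ ?_
  · rw [← B_add, show f₀ + f₁ = f from add_sub_cancel f₀ f] at this
    simpa using this
  · intro e
    exact PF.mul (PF.pow (PF.add (PF.const _) (PF.smul (PF.const _))) _)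
      (PF.prod _ fun i _ => PF.pow (hgP i) _)
  · simp only [hg0, zero_smul, add_zero]
    exact C.li_w p hx hy hy' α
  · intro s e
    rw [← B_smul, ← B_add]
    refine C.B_w p _ (fun i => g i s) (hgK s) (fun i => (e i : ℕ)) ?_
    calc ∑ i, (e i : ℕ) ≤ ∑ _i : Fin r, p := Finset.sum_le_sum fun i _ => (e i).2.le
      _ = r * p := by simp
end ContactData
end PC

section PD
open Module LieSubalgebra LieAlgebra

lemma engel_isCartan_of_min {k L : Type*} [Field k] [Infinite k] [LieRing L] [LieAlgebra k L]
    [FiniteDimensional k L] (x : L)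
    (h : ∀ y : L, finrank k (engel k x) ≤ finrank k (engel k y)) :
    (engel k x).IsCartanSubalgebra := by
  refine ⟨?_, normalizer_engel _ _⟩
  apply isNilpotent_of_forall_le_engel
  intro y hy
  set Ex : {engel k z | z ∈ engel k x} := ⟨engel k x, x, self_mem_engel _ _, rfl⟩
  suffices IsBot Ex from @this ⟨engel k y, y, hy, rfl⟩
  apply engel_isBot_of_isMin (Cardinal.natCast_le_aleph0.trans (Cardinal.infinite_iff.mp ‹_›))
    (engel k x) Ex le_rfl
  rintro ⟨_, y, hy, rfl⟩ hyx
  suffices finrank k (engel k x) ≤ finrank k (engel k y) by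
    suffices engel k y = engel k x from this.ge
    apply LieSubalgebra.toSubmodule_injective
    exact Submodule.eq_of_le_of_finrank_le hyx this
  exact h y

lemma cartan_ge {k L : Type*} [Field k] [Infinite k] [LieRing L] [LieAlgebra k L]
    [FiniteDimensional k L] (m : ℕ) (h : ∀ y : L, m ≤ finrank k (engel k y))
    (H : LieSubalgebra k L) (hH : H.IsCartanSubalgebra) : m ≤ finrank k H := by
  classical
  have hle : ∀ y ∈ H, H ≤ engel k y := by
    intro y hy z hz
    have h1 := le_zeroRootSubalgebra k L H hz
    rw [mem_zeroRootSubalgebra] at h1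
    obtain ⟨n, hn⟩ := h1 ⟨y, hy⟩
    rw [mem_engel_iff]
    exact ⟨n, hn⟩
  have hex : ∃ d, ∃ x ∈ H, finrank k (engel k x) = d := ⟨_, 0, H.zero_mem, rfl⟩
  obtain ⟨x, hx, hxd⟩ := Nat.find_spec hex
  have hmin : ∀ y ∈ H, finrank k (engel k x) ≤ finrank k (engel k y) := fun y hy => by
    rw [hxd]; exact Nat.find_min' hex ⟨y, hy, rfl⟩
  set Ex : {engel k z | z ∈ H} := ⟨engel k x, x, hx, rfl⟩
  have hbot : IsBot Ex := by
    apply engel_isBot_of_isMin (Cardinal.natCast_le_aleph0.trans (Cardinal.infinite_iff.mp ‹_›))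
      H Ex (hle x hx)
    rintro ⟨_, y, hy, rfl⟩ hyx
    suffices engel k y = engel k x from this.ge
    apply LieSubalgebra.toSubmodule_injective
    exact Submodule.eq_of_le_of_finrank_le hyx (hmin y hy)
  have hEH : engel k x ≤ H := by
    intro z hz
    rw [← zeroRootSubalgebra_eq_of_is_cartan k L H, mem_zeroRootSubalgebra]
    rintro ⟨y, hy⟩
    have h2 : engel k x ≤ engel k y := @hbot ⟨engel k y, y, hy, rfl⟩
    exact (mem_engel_iff k y z).mp (h2 hz)
  exact (h x).trans (Submodule.finrank_mono (s := (engel k x).toSubmodule) (t := H.toSubmodule) hEH)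

lemma lieRankOf_eq {k L : Type*} [Field k] [Infinite k] [LieRing L] [LieAlgebra k L]
    (K : LieSubalgebra k L) [FiniteDimensional k K] (m : ℕ)
    (h1 : ∀ y : K, m ≤ finrank k (engel k y)) (h2 : ∃ x : K, finrank k (engel k x) ≤ m) :
    lieRankOf k K = m := by
  obtain ⟨x, hx⟩ := h2
  have hm : m ∈ {d : ℕ | ∃ H : LieSubalgebra k K, H.IsCartanSubalgebra ∧ finrank k H = d} :=
    ⟨engel k x, engel_isCartan_of_min x fun y => hx.trans (h1 y), le_antisymm hx (h1 x)⟩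
  refine le_antisymm (Nat.sInf_le hm) ?_
  refine le_csInf ⟨m, hm⟩ ?_
  rintro d ⟨H, hH, rfl⟩
  exact cartan_ge m h1 H hH
end PD

section PE1
open Module
variable (p : ℕ) (k : Type*) [Field k] (n : ℕ)

namespace TP

/-- exponent as a finsupp -/
noncomputable def ex {p n : ℕ} (e : Fin n → Fin p) : Fin n →₀ ℕ :=
  Finsupp.equivFunOnFinite.symm (fun i => (e i : ℕ))

lemma ex_apply {p n : ℕ} (e : Fin n → Fin p) (i) : ex e i = (e i : ℕ) := rfl

lemma ex_inj {p n : ℕ} (e e' : Fin n → Fin p) (h : ex e = ex e') : e = e' := by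
  funext i
  apply Fin.ext
  have := DFunLike.congr_fun h i
  simpa [ex_apply] using this

/-- monomials -/
noncomputable def mon (e : Fin n → Fin p) : TruncPoly p k n := ∏ i, truncX p k n i ^ (e i : ℕ)

lemma mon_eq (e : Fin n → Fin p) :
    mon p k n e = Ideal.Quotient.mk (truncIdeal p k n) (MvPolynomial.monomial (ex e) 1) := by
  rw [MvPolynomial.monomial_eq, mon]
  simp only [map_one, one_mul, truncX]
  rw [Finsupp.prod_fintype _ _ (by simp)]
  simp [map_prod, ex_apply]

lemma coeff_ideal (d : Fin n →₀ ℕ) (hd : ∀ i, d i < p) (f) (hf : f ∈ truncIdeal p k n) :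
    MvPolynomial.coeff d f = 0 := by
  classical
  induction hf using Submodule.span_induction with
  | mem x hx =>
    obtain ⟨j, rfl⟩ := hx
    rw [MvPolynomial.coeff_X_pow, if_neg]
    rintro rfl
    have := hd j
    simp at this
  | zero => simp
  | add x y _ _ hx hy => simp [hx, hy]
  | smul a x hxmem hx =>
    rw [smul_eq_mul]
    clear hx
    have : ∀ a : MvPolynomial (Fin n) k, ∀ x ∈ truncIdeal p k n, MvPolynomial.coeff d (a * x) = 0 := by
      intro a x hx
      induction hx using Submodule.span_induction generalizing a with
      | mem x hx =>
        obtain ⟨j, rfl⟩ := hx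
        rw [MvPolynomial.X_pow_eq_monomial, MvPolynomial.coeff_mul_monomial', if_neg]
        intro h
        have h1 := h j
        have := hd j
        simp at h1
        omega
      | zero => simp
      | add x y _ _ hx hy => simp [mul_add, hx, hy]
      | smul b x _ hx => rw [smul_eq_mul, ← mul_assoc]; exact hx _
    exact this a x hxmem

/-- coefficient functional -/
noncomputable def coefT (e : Fin n → Fin p) : TruncPoly p k n →ₗ[k] k :=
  ((truncIdeal p k n).restrictScalars k).liftQ (MvPolynomial.lcoeff k (ex e))
    (fun f hf => coeff_ideal p k n _ (fun i => (e i).isLt) f hf) ∘ₗ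
  (Submodule.Quotient.restrictScalarsEquiv k (truncIdeal p k n)).symm.toLinearMap

lemma coefT_mk (e : Fin n → Fin p) (f) :
    coefT p k n e (Ideal.Quotient.mk (truncIdeal p k n) f) = MvPolynomial.coeff (ex e) f := rfl

lemma coefT_mon (e e' : Fin n → Fin p) :
    coefT p k n e (mon p k n e') = if e' = e then 1 else 0 := by
  classical
  rw [mon_eq, coefT_mk, MvPolynomial.coeff_monomial]
  by_cases h : e' = e
  · simp [h]
  · rw [if_neg h, if_neg]
    exact fun h' => h (ex_inj _ _ h')

lemma X_pow_p (i) : truncX p k n i ^ p = 0 := by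
  rw [truncX, ← map_pow, Ideal.Quotient.eq_zero_iff_mem]
  exact Ideal.subset_span ⟨i, rfl⟩

lemma span_mon : ⊤ ≤ Submodule.span k (Set.range (mon p k n)) := by
  rintro f -
  obtain ⟨f, rfl⟩ := Ideal.Quotient.mk_surjective f
  induction f using MvPolynomial.induction_on' with
  | add f g hf hg => rw [map_add]; exact add_mem hf hg
  | monomial d a =>
    have : MvPolynomial.monomial d a = a • MvPolynomial.monomial d (1 : k) := by
      rw [MvPolynomial.smul_monomial]; simp
    rw [this]
    change Ideal.Quotient.mkₐ k _ _ ∈ _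
    rw [map_smul]
    apply Submodule.smul_mem
    change Ideal.Quotient.mk _ _ ∈ _
    by_cases h : ∀ i, d i < p
    · apply Submodule.subset_span
      refine ⟨fun i => ⟨d i, h i⟩, ?_⟩
      rw [mon_eq, show ex (fun i => (⟨d i, h i⟩ : Fin p)) = d from by ext i; rfl]
    · push Not at h
      obtain ⟨i, hi⟩ := h
      convert Submodule.zero_mem _
      rw [MvPolynomial.monomial_eq, Ideal.Quotient.eq_zero_iff_mem, Finsupp.prod_fintype _ _ (by simp)]
      apply Ideal.mul_mem_left
      rw [← Finset.mul_prod_erase _ _ (Finset.mem_univ i)]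
      apply Ideal.mul_mem_right
      rw [← Nat.sub_add_cancel hi, pow_add]
      apply Ideal.mul_mem_left
      exact Ideal.subset_span ⟨i, rfl⟩

lemma li_mon : LinearIndependent k (mon p k n) := by
  classical
  rw [Fintype.linearIndependent_iff]
  intro c hc e
  have := congrArg (coefT p k n e) hc
  simpa [map_sum, coefT_mon] using this

noncomputable def bas : Basis (Fin n → Fin p) k (TruncPoly p k n) :=
  Basis.mk (li_mon p k n) (span_mon p k n)

lemma bas_apply (e) : bas p k n e = mon p k n e := by simp [bas]

lemma bas_repr (e) (f) : (bas p k n).repr f e = coefT p k n e f := by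
  classical
  have : (bas p k n).coord e = coefT p k n e := by
    apply (bas p k n).ext
    intro e'
    rw [bas_apply, coefT_mon, ← bas_apply]
    simp [Finsupp.single_apply]
  exact LinearMap.congr_fun this f

lemma fd : FiniteDimensional k (TruncPoly p k n) := (bas p k n).finiteDimensional_of_finite

lemma nontriv (hp : 0 < p) : Nontrivial (TruncPoly p k n) :=
  ⟨⟨mon p k n (fun _ => ⟨0, hp⟩), 0, (li_mon p k n).ne_zero _⟩⟩

lemma der_ext (D D' : Derivation k (TruncPoly p k n) (TruncPoly p k n))
    (h : ∀ i, D (truncX p k n i) = D' (truncX p k n i)) : D = D' := by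
  have hs : Algebra.adjoin k (Set.range (truncX p k n)) = ⊤ := by
    have := congrArg (Subalgebra.map (Ideal.Quotient.mkₐ k (truncIdeal p k n)))
      (MvPolynomial.adjoin_range_X (R := k) (σ := Fin n))
    rw [← Algebra.adjoin_image, ← Set.range_comp] at this
    rw [show truncX p k n = (Ideal.Quotient.mkₐ k (truncIdeal p k n)) ∘ MvPolynomial.X from rfl, this]
    rw [Algebra.map_top, AlgHom.range_eq_top]
    exact Ideal.Quotient.mkₐ_surjective _ _
  apply Derivation.ext_of_adjoin_eq_top _ hs
  rintro _ ⟨i, rfl⟩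
  exact h i

variable [CharP k p]

lemma PD_mk (i) (f) : truncPD p k n i (Ideal.Quotient.mk (truncIdeal p k n) f) =
    Ideal.Quotient.mk (truncIdeal p k n) (MvPolynomial.pderiv i f) := rfl

lemma PD_X (i j) : truncPD p k n i (truncX p k n j) = if i = j then 1 else 0 := by
  rw [truncX, PD_mk, MvPolynomial.pderiv_X, Pi.single_apply]
  by_cases h : i = j
  · simp [h]
  · simp [h, Ne.symm h, eq_comm]

lemma coefT_PD (hp : 0 < p) (i) (g) :
    coefT p k n (fun _ => ⟨p - 1, by omega⟩) (truncPD p k n i g) = 0 := by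
  obtain ⟨f, rfl⟩ := Ideal.Quotient.mk_surjective g
  rw [PD_mk, coefT_mk, MvPolynomial.coeff_pderiv]
  have : ((ex (p := p) (n := n) (fun _ => ⟨p - 1, by omega⟩) i : k) + 1) = 0 := by
    rw [ex_apply]
    simp only
    rw [← Nat.cast_succ, Nat.succ_eq_add_one, Nat.sub_add_cancel hp]
    simp
  rw [this, mul_zero]

lemma mon_eigen (D : Derivation k (TruncPoly p k n) (TruncPoly p k n)) (c : Fin n → k)
    (h : ∀ i, D (truncX p k n i) = c i • truncX p k n i) (e : Fin n → Fin p) :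
    D (mon p k n e) = (∑ i, (e i : k) * c i) • mon p k n e := by
  have hpow : ∀ i (m : ℕ), D (truncX p k n i ^ m) = ((m : k) * c i) • truncX p k n i ^ m := by
    intro i m
    induction m with
    | zero => simp
    | succ m ih =>
      rw [pow_succ, Derivation.leibniz, ih, h]
      simp only [smul_eq_mul, Nat.cast_add, Nat.cast_one, mul_smul_comm, add_mul, add_smul, one_mul]
      rw [mul_comm (truncX p k n i), add_comm]
  have : ∀ s : Finset (Fin n), D (∏ i ∈ s, truncX p k n i ^ (e i : ℕ)) =
      (∑ i ∈ s, (e i : k) * c i) • ∏ i ∈ s, truncX p k n i ^ (e i : ℕ) := by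
    intro s
    induction s using Finset.induction_on with
    | empty => simp
    | insert i s hi ih =>
      rw [Finset.prod_insert hi, Finset.sum_insert hi, Derivation.leibniz, ih, hpow]
      simp only [smul_eq_mul, mul_smul_comm, add_smul]
      rw [add_comm, mul_comm (∏ i ∈ s, _)]
  exact this _

lemma PD_X_mon (i) (e) : truncPD p k n i (truncX p k n i * mon p k n e) =
    ((e i : k) + 1) • mon p k n e := by
  have := mon_eigen p k n (truncX p k n i • truncPD p k n i) (fun j => if i = j then 1 else 0)
    (fun j => by simp only [Derivation.smul_apply, PD_X]; split_ifs with h <;> simp [h]) e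
  rw [Derivation.leibniz, PD_X, if_pos rfl]
  simp only [Derivation.smul_apply] at this
  rw [this]
  simp [add_smul]

lemma mon_mem_range (hp : 0 < p) (S : Submodule k (TruncPoly p k n))
    (hS : ∀ i g, truncPD p k n i g ∈ S) (e : Fin n → Fin p)
    (he : e ≠ fun _ => ⟨p - 1, by omega⟩) : mon p k n e ∈ S := by
  obtain ⟨i, hi⟩ : ∃ i, (e i : ℕ) + 1 < p := by
    by_contra! h
    apply he
    funext i
    apply Fin.ext
    have := h i
    have := (e i).isLt
    simp only
    omega
  have h0 : ((e i : k) + 1) ≠ 0 := by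
    intro h
    rw [← Nat.cast_succ, CharP.cast_eq_zero_iff k p] at h
    have := Nat.le_of_dvd (by omega) h
    omega
  have := hS i (truncX p k n i * mon p k n e)
  rw [PD_X_mon] at this
  exact (S.smul_mem_iff h0).1 this

end TP
end PE1

section PE2
open Module
namespace TP

def ix {r : ℕ} (j : Fin r) : Fin (2 * r + 1) := ⟨j.1, by have := j.isLt; omega⟩
def iy {r : ℕ} (j : Fin r) : Fin (2 * r + 1) := ⟨j.1 + r, by have := j.isLt; omega⟩

lemma ix_inj {r : ℕ} (i j : Fin r) : ix i = ix j ↔ i = j := by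
  simp [ix, Fin.ext_iff]
lemma iy_inj {r : ℕ} (i j : Fin r) : iy i = iy j ↔ i = j := by
  simp [iy, Fin.ext_iff]
lemma ix_ne_iy {r : ℕ} (i j : Fin r) : ix i ≠ iy j := by
  have := i.isLt
  simp only [ix, iy, Ne, Fin.ext_iff]; omega
lemma ix_ne_last {r : ℕ} (i : Fin r) : ix i ≠ Fin.last (2 * r) := by
  have := i.isLt
  simp only [ix, Ne, Fin.ext_iff, Fin.val_last]; omega
lemma iy_ne_last {r : ℕ} (i : Fin r) : iy i ≠ Fin.last (2 * r) := by
  have := i.isLt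
  simp only [iy, Ne, Fin.ext_iff, Fin.val_last]; omega

lemma fin_cases3 {r : ℕ} (i : Fin (2 * r + 1)) :
    (∃ j, i = ix j) ∨ (∃ j, i = iy j) ∨ i = Fin.last (2 * r) := by
  have hi := i.isLt
  by_cases h : i.1 < r
  · exact Or.inl ⟨⟨i.1, h⟩, rfl⟩
  · by_cases h' : i.1 < 2 * r
    · refine Or.inr (Or.inl ⟨⟨i.1 - r, by omega⟩, ?_⟩)
      simp only [iy, Fin.ext_iff]; omega
    · refine Or.inr (Or.inr ?_)
      simp only [Fin.ext_iff, Fin.val_last]; omega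

@[to_additive]
lemma prod_split0 {M : Type*} [CommMonoid M] (r : ℕ) (F : ℕ → M) :
    ∏ i : Fin (2 * r), F i.1 = ∏ j : Fin r, (F j.1 * F (j.1 + r)) := by
  rw [Finset.prod_mul_distrib]
  rw [Fin.prod_univ_eq_prod_range F, Fin.prod_univ_eq_prod_range F,
    Fin.prod_univ_eq_prod_range (fun j => F (j + r)), two_mul, Finset.prod_range_add]
  congr 1
  exact Finset.prod_congr rfl fun i _ => by rw [add_comm]

@[to_additive]
lemma prod_split {M : Type*} [CommMonoid M] (r : ℕ) (F : Fin (2 * r + 1) → M) :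
    ∏ i, F i = (∏ j : Fin r, (F (ix j) * F (iy j))) * F (Fin.last _) := by
  rw [Fin.prod_univ_castSucc]
  congr 1
  have := prod_split0 r (fun i => if h : i < 2 * r + 1 then F ⟨i, h⟩ else 1)
  convert this using 1
  · apply Finset.prod_congr rfl
    intro i _
    have := i.isLt
    rw [dif_pos (by omega)]; rfl
  · apply Finset.prod_congr rfl
    intro i _
    have := i.isLt
    rw [dif_pos (by omega), dif_pos (by omega)]; rfl

variable (p : ℕ) (k : Type*) [Field k] [CharP k p] (r : ℕ)

noncomputable def CD : ContactData k (TruncPoly p k (2 * r + 1)) r where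
  x j := truncX p k _ (ix j)
  y j := truncX p k _ (iy j)
  z := truncX p k _ (Fin.last _)
  dx j := truncPD p k _ (ix j)
  dy j := truncPD p k _ (iy j)
  dz := truncPD p k _ (Fin.last _)
  dx_x i j := by simp only [PD_X, ix_inj]
  dx_y i j := by rw [PD_X, if_neg (ix_ne_iy i j)]
  dx_z i := by rw [PD_X, if_neg (ix_ne_last i)]
  dy_x i j := by rw [PD_X, if_neg (ix_ne_iy j i).symm]
  dy_y i j := by simp only [PD_X, iy_inj]
  dy_z i := by rw [PD_X, if_neg (iy_ne_last i)]
  dz_x i := by rw [PD_X, if_neg (ix_ne_last i).symm]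
  dz_y i := by rw [PD_X, if_neg (iy_ne_last i).symm]
  dz_z := by rw [PD_X, if_pos rfl]
  ext' D D' hx hy hz := by
    apply der_ext
    intro i
    rcases fin_cases3 i with ⟨j, rfl⟩ | ⟨j, rfl⟩ | rfl
    · exact hx j
    · exact hy j
    · exact hz

lemma DK_eq_aux {k A : Type*} [Field k] [CommRing A] [Algebra k A] {r : ℕ} (C : ContactData k A r)
    (f : A) : (∑ i, ((C.x i * C.dz f - C.dy i f) • C.dx i
      + (C.y i * C.dz f + C.dx i f) • C.dy i))
      + (2 * f - ∑ j, (C.x j * C.dx j f + C.y j * C.dy j f)) • C.dz = C.K f := by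
  apply C.ext'
  · intro j
    simp [ContactData.sum_apply, ContactData.K_x, ContactData.Q]
  · intro j
    simp only [Derivation.add_apply, Derivation.smul_apply, ContactData.sum_apply, ContactData.K_y,
      ContactData.dx_y, ContactData.dy_y, ContactData.dz_y, ContactData.P]
    simp
    ring
  · simp only [Derivation.add_apply, Derivation.smul_apply, ContactData.sum_apply, ContactData.K_z,
      ContactData.dx_z, ContactData.dy_z, ContactData.dz_z, ContactData.P, ContactData.Q,
      Derivation.sub_apply, smul_eq_mul, mul_zero, add_zero, Finset.sum_const_zero, zero_add, mul_one]
    congr 1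
    exact Finset.sum_congr rfl fun i _ => by ring

lemma B_one {k A : Type*} [Field k] [CommRing A] [Algebra k A] {r : ℕ} (C : ContactData k A r)
    (g : A) : C.B 1 g = (2 : k) • C.dz g := by
  rw [ContactData.B_apply, ContactData.K_apply]
  simp [Algebra.smul_def, map_ofNat (algebraMap k A) 2]

lemma two_unit_aux {k A : Type*} [Field k] [CommRing A] [Algebra k A] (h : (2 : k) ≠ 0) :
    IsUnit (2 : A) := by
  have := (IsUnit.mk0 _ h).map (algebraMap k A)
  rwa [map_ofNat (algebraMap k A) 2] at this

lemma DK_eq (f) : DK p k r f = (CD p k r).K f := by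
  have hs : ∑ i : Fin (2 * r), truncX p k (2 * r + 1) ⟨i.1, by have := i.isLt; omega⟩ *
          truncPD p k (2 * r + 1) ⟨i.1, by have := i.isLt; omega⟩ f =
      ∑ j, ((CD p k r).x j * (CD p k r).dx j f + (CD p k r).y j * (CD p k r).dy j f) := by
    have := sum_split0 r (fun i => if h : i < 2 * r + 1 then
      truncX p k (2 * r + 1) ⟨i, h⟩ * truncPD p k (2 * r + 1) ⟨i, h⟩ f else 0)
    convert this using 1
    · apply Finset.sum_congr rfl
      intro i _
      have := i.isLt
      rw [dif_pos (by omega)]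
    · apply Finset.sum_congr rfl
      intro i _
      have := i.isLt
      rw [dif_pos (by omega), dif_pos (by omega)]; rfl
  have hD : DK p k r f = (∑ i, (((CD p k r).x i * (CD p k r).dz f - (CD p k r).dy i f) • (CD p k r).dx i
      + ((CD p k r).y i * (CD p k r).dz f + (CD p k r).dx i f) • (CD p k r).dy i))
      + (2 * f - ∑ j, ((CD p k r).x j * (CD p k r).dx j f + (CD p k r).y j * (CD p k r).dy j f)) •
        (CD p k r).dz := by
    rw [← hs]; rfl
  rw [hD]
  exact DK_eq_aux _ f

variable (hp3 : 3 ≤ p)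
include hp3

lemma two_ne : (2 : k) ≠ 0 := by
  intro h
  have h' : ((2 : ℕ) : k) = 0 := by exact_mod_cast h
  rw [CharP.cast_eq_zero_iff k p] at h'
  have := Nat.le_of_dvd (by norm_num) h'
  omega

lemma two_unit : IsUnit (2 : TruncPoly p k (2 * r + 1)) := by
  exact two_unit_aux (two_ne p k hp3)

lemma mem_ambient (D) : D ∈ contactAmbient p k r ↔ ∃ f, (CD p k r).K f = D := by
  constructor
  · intro h
    let T : LieSubalgebra k (WittAlg p k (2 * r + 1)) :=
      { LinearMap.range (CD p k r).Klin with
        lie_mem' := by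
          rintro _ _ ⟨f, rfl⟩ ⟨g, rfl⟩
          exact ⟨(CD p k r).B f g, ((CD p k r).lie_K (two_unit p k r hp3) f g).symm⟩ }
    have hle : contactAmbient p k r ≤ T := by
      apply LieSubalgebra.lieSpan_le.2
      rintro _ ⟨f, rfl⟩
      exact ⟨f, (DK_eq p k r f).symm⟩
    obtain ⟨f, hf⟩ := hle h
    exact ⟨f, hf⟩
  · rintro ⟨f, rfl⟩
    rw [← DK_eq]
    exact LieSubalgebra.subset_lieSpan ⟨f, rfl⟩

omit hp3 in
/-- potentials of the contact algebra -/
noncomputable def S : Submodule k (TruncPoly p k (2 * r + 1)) :=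
  (contactAlg p k r).toSubmodule.comap (CD p k r).Klin

omit hp3 in
lemma mem_S (f) : f ∈ S p k r ↔ (CD p k r).K f ∈ contactAlg p k r := Iff.rfl

lemma mem_contact (D) : D ∈ contactAlg p k r ↔ ∃ f ∈ S p k r, (CD p k r).K f = D := by
  constructor
  · intro h
    have hle : contactAlg p k r ≤ contactAmbient p k r := by
      apply LieSubalgebra.lieSpan_le.2
      rintro _ ⟨x, hx, y, hy, rfl⟩
      exact LieSubalgebra.lie_mem _ hx hy
    obtain ⟨f, rfl⟩ := (mem_ambient p k r hp3 D).1 (hle h)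
    exact ⟨f, h, rfl⟩
  · rintro ⟨f, hf, rfl⟩
    exact hf

lemma B_mem_S (f g) : (CD p k r).B f g ∈ S p k r := by
  rw [mem_S, ← (CD p k r).lie_K (two_unit p k r hp3)]
  exact LieSubalgebra.subset_lieSpan ⟨_, (mem_ambient p k r hp3 _).2 ⟨f, rfl⟩, _,
    (mem_ambient p k r hp3 _).2 ⟨g, rfl⟩, rfl⟩

lemma S_coef (hr : (2 * r + 4 : k) = 0) (f) (hf : f ∈ S p k r) :
    coefT p k _ (fun _ => ⟨p - 1, by omega⟩) f = 0 := by
  set I := coefT p k (2 * r + 1) (fun _ => ⟨p - 1, by omega⟩) with hI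
  have hIB : ∀ f g, I ((CD p k r).B f g) = 0 := by
    intro f g
    apply (CD p k r).int_B I _ _ _ hr f g
    · exact fun i g => coefT_PD p k _ (by omega) _ _
    · exact fun i g => coefT_PD p k _ (by omega) _ _
    · exact fun g => coefT_PD p k _ (by omega) _ _
  let T : LieSubalgebra k (WittAlg p k (2 * r + 1)) :=
      { (LinearMap.ker I).map (CD p k r).Klin with
        lie_mem' := by
          rintro _ _ ⟨f, -, rfl⟩ ⟨g, -, rfl⟩
          exact ⟨(CD p k r).B f g, hIB f g, ((CD p k r).lie_K (two_unit p k r hp3) f g).symm⟩ }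
  have hle : contactAlg p k r ≤ T := by
    apply LieSubalgebra.lieSpan_le.2
    rintro _ ⟨x, hx, y, hy, rfl⟩
    obtain ⟨f, rfl⟩ := (mem_ambient p k r hp3 _).1 hx
    obtain ⟨g, rfl⟩ := (mem_ambient p k r hp3 _).1 hy
    exact ⟨(CD p k r).B f g, hIB f g, ((CD p k r).lie_K (two_unit p k r hp3) f g).symm⟩
  obtain ⟨g, hg, hgf⟩ := hle hf
  have := (CD p k r).Klin_injective (two_unit p k r hp3) hgf
  rw [← this]
  exact hg

lemma dz_mem (g) : (CD p k r).dz g ∈ S p k r := by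
  have h := B_mem_S p k r hp3 1 g
  rw [B_one] at h
  exact ((S p k r).smul_mem_iff (two_ne p k hp3)).1 h

lemma dy_mem (i g) : (CD p k r).dy i g ∈ S p k r := by
  have h := B_mem_S p k r hp3 ((CD p k r).x i) g
  have h' := dz_mem p k r hp3 ((CD p k r).x i * g)
  have h1 : (CD p k r).B ((CD p k r).x i) g = (CD p k r).dy i g + (CD p k r).dz ((CD p k r).x i * g) := by
    rw [ContactData.B_apply, ContactData.K_apply]
    simp [ContactData.Q]
    ring
  rw [h1] at h
  exact ((S p k r).add_mem_iff_left h').1 h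

lemma dx_mem (i g) : (CD p k r).dx i g ∈ S p k r := by
  have h := B_mem_S p k r hp3 ((CD p k r).y i) g
  have h' := dz_mem p k r hp3 ((CD p k r).y i * g)
  have h1 : (CD p k r).B ((CD p k r).y i) g = -(CD p k r).dx i g + (CD p k r).dz ((CD p k r).y i * g) := by
    rw [ContactData.B_apply, ContactData.K_apply]
    simp [ContactData.P]
    ring
  rw [h1] at h
  exact neg_mem_iff.1 (((S p k r).add_mem_iff_left h').1 h)

lemma PD_mem (i g) : truncPD p k (2 * r + 1) i g ∈ S p k r := by
  rcases fin_cases3 i with ⟨j, rfl⟩ | ⟨j, rfl⟩ | rfl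
  · exact dx_mem p k r hp3 j g
  · exact dy_mem p k r hp3 j g
  · exact dz_mem p k r hp3 g

end TP
end PE2

section PE3
open Module
namespace TP

lemma diag_bound {k V ι : Type*} [Field k] [AddCommGroup V] [Module k V] [Fintype ι]
    (b : Basis ι k V) (T : Module.End k V) (c : ι → k) (h : ∀ i, T (b i) = c i • b i) :
    finrank k (T.maxGenEigenspace 0) ≤ Nat.card {i // c i = 0} := by
  classical
  have hrep : ∀ (x : V) (i : ι), b.repr (T x) i = c i * b.repr x i := by
    intro x i
    have : (b.coord i) ∘ₗ T = c i • b.coord i := by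
      apply b.ext
      intro j
      simp only [LinearMap.comp_apply, h, map_smul, LinearMap.smul_apply, Basis.coord_apply,
        Basis.repr_self, smul_eq_mul, Finsupp.single_apply]
      split_ifs with hh <;> simp [hh]
    exact LinearMap.congr_fun this x
  have hrep' : ∀ (n : ℕ) (x : V) (i : ι), b.repr ((T ^ n) x) i = c i ^ n * b.repr x i := by
    intro n
    induction n with
    | zero => simp
    | succ n ih => intro x i; rw [pow_succ, Module.End.mul_apply, ih, hrep]; ring
  let φ : T.maxGenEigenspace 0 →ₗ[k] ({i // c i = 0} → k) :=
    LinearMap.pi (fun i => (b.coord i.1) ∘ₗ (T.maxGenEigenspace 0).subtype)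
  have hφ : Function.Injective φ := by
    rw [← LinearMap.ker_eq_bot, LinearMap.ker_eq_bot']
    rintro ⟨x, hx⟩ h0
    rw [Module.End.mem_maxGenEigenspace] at hx
    obtain ⟨n, hn⟩ := hx
    apply Subtype.ext
    apply b.ext_elem
    intro i
    by_cases hi : c i = 0
    · have := congrFun h0 ⟨i, hi⟩
      simpa [φ] using this
    · simp only [zero_smul, sub_zero] at hn
      have := hrep' n x i
      rw [hn] at this
      simp only [map_zero, Finsupp.coe_zero, Pi.zero_apply] at this
      have h2 := (mul_eq_zero.1 this.symm).resolve_left (pow_ne_zero _ hi)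
      simpa using h2
  have := LinearMap.finrank_le_finrank_of_injective hφ
  rwa [finrank_pi, ← Nat.card_eq_fintype_card] at this

lemma exists_indep (k : Type*) [Field k] [Infinite k] (p : ℕ) [Fact p.Prime] [CharP k p] (N : ℕ) :
    ∃ t : k, ∀ v : Fin N → ℤ, ∑ l : Fin N, t ^ (l : ℕ) * (v l : k) = 0 → ∀ l, (v l : k) = 0 := by
  obtain ⟨t, ht⟩ := exists_generic k p (Fact.out : p.Prime).two_le N
  refine ⟨t, fun v hv l => ?_⟩
  have := Matrix.eq_zero_of_forall_index_sum_pow_mul_eq_zero (v := fun l => (v l : k)) ht ?_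
  · exact congrFun this l
  · intro j
    have h1 := congrArg (iterateFrobenius k p (j : ℕ)) hv
    simp only [map_sum, map_mul, map_pow, map_zero, map_intCast] at h1
    simpa [iterateFrobenius_def] using h1

section
variable {k A : Type*} [Field k] [CommRing A] [Algebra k A] {r : ℕ} (C : ContactData k A r)
/-- toral potential -/
noncomputable def tor (α : Fin r → k) (β : k) : A := ∑ j, α j • (C.x j * C.y j) + β • C.z

lemma dz_tor (α : Fin r → k) (β : k) : C.dz (tor C α β) = algebraMap k A β := by
  simp [tor, Algebra.algebraMap_eq_smul_one]

lemma P_tor (α : Fin r → k) (β : k) (j) : C.P j (tor C α β) = (β + α j) • C.y j := by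
  simp [tor, add_smul, add_comm]

lemma Q_tor (α : Fin r → k) (β : k) (j) : C.Q j (tor C α β) = (α j - β) • C.x j := by
  rw [sub_smul, sub_eq_add_neg]; simp [tor]

lemma K_tor_x (α : Fin r → k) (β : k) (j) : C.K (tor C α β) (C.x j) = (β - α j) • C.x j := by
  rw [ContactData.K_x, Q_tor, ← neg_smul, neg_sub]

lemma K_tor_y (α : Fin r → k) (β : k) (j) : C.K (tor C α β) (C.y j) = (β + α j) • C.y j := by
  rw [ContactData.K_y, P_tor]

lemma K_tor_z (α : Fin r → k) (β : k) : C.K (tor C α β) C.z = (2 * β) • C.z := by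
  rw [ContactData.K_z]
  simp only [P_tor, Q_tor]
  rw [tor, mul_add, Finset.mul_sum, add_sub_right_comm, ← Finset.sum_sub_distrib, Finset.sum_eq_zero,
    zero_add]
  · simp only [Algebra.smul_def, map_mul, map_ofNat (algebraMap k A) 2]; ring
  · intro j _
    simp only [Algebra.smul_def, map_add, map_sub]; ring

lemma two_alg (β : k) (a : A) : 2 * algebraMap k A β * a = (2 * β) • a := by
  rw [Algebra.smul_def, map_mul, map_ofNat (algebraMap k A) 2]

lemma tor_eq_dz (h2 : (2 : k) ≠ 0) (α : Fin r → k) (β : k) :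
    tor C α β = C.dz (C.z * ∑ j, α j • (C.x j * C.y j) + (β / 2) • (C.z * C.z)) := by
  have h3 : algebraMap k A (β / 2) * 2 = algebraMap k A β := by
    rw [← map_ofNat (algebraMap k A) 2, ← map_mul]; congr 1; field_simp
  simp [tor]
  rw [← two_mul]
  simp only [Algebra.smul_def]
  rw [← h3]; ring
end

variable (p : ℕ) (k : Type*) [Field k] [CharP k p] (r : ℕ)

/-- eigenvalue -/
noncomputable def ev (α : Fin r → k) (β : k) (e : Fin (2 * r + 1) → Fin p) : k :=
  ∑ j, ((e (ix j) : k) * (β - α j) + (e (iy j) : k) * (β + α j)) +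
    (e (Fin.last _) : k) * (2 * β) - 2 * β

lemma B_tor_mon (α : Fin r → k) (β : k) (e : Fin (2 * r + 1) → Fin p) :
    (CD p k r).B (tor (CD p k r) α β) (mon p k _ e) = ev p k r α β e • mon p k _ e := by
  let c : Fin (2 * r + 1) → k := fun i => if h : i.1 < r then β - α ⟨i.1, h⟩ else
    if h' : i.1 - r < r then β + α ⟨i.1 - r, h'⟩ else 2 * β
  have cx : ∀ j, c (ix j) = β - α j := by
    intro j
    have := j.isLt
    simp only [c]
    rw [dif_pos (by simp [ix])]
    rfl
  have cy : ∀ j, c (iy j) = β + α j := by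
    intro j
    have := j.isLt
    simp only [c]
    rw [dif_neg (by simp [iy]), dif_pos (by simp [iy])]
    congr 2
    simp [iy]
  have cz : c (Fin.last _) = 2 * β := by
    simp only [c]
    rw [dif_neg (by simp; omega), dif_neg (by simp; omega)]
  have := mon_eigen p k _ ((CD p k r).K (tor (CD p k r) α β)) c (fun i => by
    rcases fin_cases3 i with ⟨j, rfl⟩ | ⟨j, rfl⟩ | rfl
    · rw [cx]; exact K_tor_x _ _ _ _
    · rw [cy]; exact K_tor_y _ _ _ _
    · rw [cz]; exact K_tor_z _ _ _) e
  rw [ContactData.B_apply, this, dz_tor, ev, sum_split]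
  simp only [cx, cy, cz]
  rw [sub_smul (M := TruncPoly p k (2 * r + 1))]
  congr 1
  exact two_alg _ _

variable (hp3 : 3 ≤ p)
include hp3

lemma ev_top (α : Fin r → k) (β : k) :
    ev p k r α β (fun _ => ⟨p - 1, by omega⟩) = - (2 * r + 4) * β := by
  have h : ((p - 1 : ℕ) : k) = -1 := by
    rw [Nat.cast_sub (by omega)]; simp
  simp only [ev, h]
  rw [Finset.sum_congr rfl (fun j _ => (by ring : (-1 * (β - α j) + -1 * (β + α j)) = -2 * β))]
  simp
  ring

lemma S_top (hr : (2 * r + 4 : k) ≠ 0) : S p k r = ⊤ := by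
  rw [eq_top_iff]
  refine (span_mon p k _).trans (Submodule.span_le.2 ?_)
  rintro _ ⟨e, rfl⟩
  by_cases he : e = fun _ => ⟨p - 1, by omega⟩
  · have h1 := B_tor_mon p k r 0 1 e
    have h2 := B_mem_S p k r hp3 (tor (CD p k r) 0 1) (mon p k _ e)
    rw [h1, he, ev_top p k r hp3, mul_one] at h2
    rw [he]
    exact ((S p k r).smul_mem_iff (neg_ne_zero.2 hr)).1 h2
  · exact mon_mem_range p k _ (by omega) _ (PD_mem p k r hp3) e he

lemma S_sup : S p k r ⊔ Submodule.span k {mon p k _ (fun _ => ⟨p - 1, by omega⟩)} = ⊤ := by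
  rw [eq_top_iff]
  refine (span_mon p k _).trans (Submodule.span_le.2 ?_)
  rintro _ ⟨e, rfl⟩
  by_cases he : e = fun _ => ⟨p - 1, by omega⟩
  · apply Submodule.mem_sup_right
    rw [he]
    exact Submodule.mem_span_singleton_self _
  · exact Submodule.mem_sup_left (mon_mem_range p k _ (by omega) _ (PD_mem p k r hp3) e he)

lemma cast_inj (a b : Fin p) (h : (a : k) = (b : k)) : a = b := by
  have := (CharP.natCast_eq_natCast k p).1 h
  apply Fin.ext
  rwa [Nat.ModEq, Nat.mod_eq_of_lt a.isLt, Nat.mod_eq_of_lt b.isLt] at this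

lemma exists_tor [Fact p.Prime] [Infinite k] : ∃ α : Fin r → k, ∃ β : k,
    Nat.card {e // ev p k r α β e = 0} ≤ p ^ r := by
  obtain ⟨t, ht⟩ := exists_indep k p (r + 1)
  refine ⟨fun j => t ^ (j.1 + 1), 1, ?_⟩
  have key : ∀ e, ev p k r (fun j => t ^ (j.1 + 1)) 1 e = 0 →
      (∀ j, e (iy j) = e (ix j)) ∧
      ∑ j, ((e (ix j) : k) + (e (iy j) : k)) + 2 * (e (Fin.last _) : k) - 2 = 0 := by
    intro e he
    have h1 := ht (Fin.cons (∑ j, ((e (ix j) : ℤ) + (e (iy j) : ℤ)) + 2 * (e (Fin.last _) : ℤ) - 2)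
      (fun j => (e (iy j) : ℤ) - (e (ix j) : ℤ))) (by
        rw [Fin.sum_univ_succ, ← he]
        simp only [Fin.cons_zero, Fin.cons_succ, ev, Fin.val_zero, Fin.val_succ, pow_zero, one_mul]
        push_cast
        rw [add_sub_assoc, add_sub_assoc, add_right_comm, ← Finset.sum_add_distrib]
        congr 1
        · exact Finset.sum_congr rfl fun j _ => by ring
        · ring)
    constructor
    · intro j
      have := h1 j.succ
      simp only [Fin.cons_succ] at this
      push_cast at this
      exact cast_inj p k hp3 _ _ (sub_eq_zero.1 this)
    · have := h1 0
      simp only [Fin.cons_zero] at this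
      push_cast at this
      exact this
  have hinj : Function.Injective (fun e : {e // ev p k r (fun j => t ^ (j.1 + 1)) 1 e = 0} =>
      (fun j : Fin r => e.1 (ix j))) := by
    rintro ⟨e, he⟩ ⟨e', he'⟩ h
    obtain ⟨a, b⟩ := key e he
    obtain ⟨a', b'⟩ := key e' he'
    have hx : ∀ j, e (ix j) = e' (ix j) := fun j => congrFun h j
    have hy : ∀ j, e (iy j) = e' (iy j) := fun j => by rw [a, a', hx]
    apply Subtype.ext
    funext i
    rcases fin_cases3 i with ⟨j, rfl⟩ | ⟨j, rfl⟩ | rfl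
    · exact hx j
    · exact hy j
    · apply cast_inj p k hp3
      simp only [hx, hy] at b
      apply mul_left_cancel₀ (two_ne p k hp3)
      linear_combination b - b'
  have := Nat.card_le_card_of_injective _ hinj
  simpa using this

end TP
end PE3

section PE4
open Module
namespace TP
variable (p : ℕ) (k : Type*) [Field k] [CharP k p] (r : ℕ)
variable (hp3 : 3 ≤ p)
include hp3

lemma contact_fd : FiniteDimensional k (contactAlg p k r) := by
  have := fd p k (2 * r + 1)
  have hle : (contactAlg p k r).toSubmodule ≤ LinearMap.range (CD p k r).Klin := by
    intro D hD
    obtain ⟨f, -, hf⟩ := (mem_contact p k r hp3 D).1 hD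
    exact ⟨f, hf⟩
  exact Submodule.finiteDimensional_of_le hle

lemma engel_finrank (f) (hf : f ∈ S p k r) :
    finrank k (LieSubalgebra.engel k (⟨(CD p k r).K f, hf⟩ : contactAlg p k r)) =
    finrank k (S p k r ⊓ Module.End.maxGenEigenspace ((CD p k r).B f) 0 : Submodule k _) := by
  set x : contactAlg p k r := ⟨(CD p k r).K f, hf⟩ with hx
  have h2 := two_unit p k r hp3
  have hK := (CD p k r).Klin_injective h2
  have hpow : ∀ (n : ℕ) (g) (hg : g ∈ S p k r),
      ((((LieAlgebra.ad k (contactAlg p k r) x) ^ n) ⟨(CD p k r).K g, hg⟩ : contactAlg p k r) :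
        WittAlg p k (2 * r + 1)) = (CD p k r).K ((((CD p k r).B f) ^ n) g) := by
    intro n
    induction n with
    | zero => intro g hg; simp
    | succ n ih =>
      intro g hg
      rw [pow_succ, Module.End.mul_apply, pow_succ, Module.End.mul_apply]
      rw [← ih _ (B_mem_S p k r hp3 f g)]
      congr 3
      apply Subtype.ext
      exact (CD p k r).lie_K h2 f g
  have hmap : (LieSubalgebra.engel k x).toSubmodule.map ((contactAlg p k r).incl : contactAlg p k r →ₗ[k] WittAlg p k (2 * r + 1)) =
      (S p k r ⊓ Module.End.maxGenEigenspace ((CD p k r).B f) 0 : Submodule k _).map (CD p k r).Klin := by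
    ext D
    simp only [Submodule.mem_map]
    constructor
    · rintro ⟨⟨D, hD⟩, hE, rfl⟩
      obtain ⟨g, hg, rfl⟩ := (mem_contact p k r hp3 D).1 hD
      obtain ⟨n, hn⟩ := (LieSubalgebra.mem_engel_iff _ _ _).1 hE
      refine ⟨g, ⟨hg, ?_⟩, rfl⟩
      rw [SetLike.mem_coe, Module.End.mem_maxGenEigenspace]
      refine ⟨n, ?_⟩
      rw [zero_smul, sub_zero]
      apply hK
      rw [map_zero]
      have := hpow n g hg
      rw [hn] at this
      exact this.symm
    · rintro ⟨g, ⟨hg, hG⟩, rfl⟩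
      rw [SetLike.mem_coe, Module.End.mem_maxGenEigenspace] at hG
      obtain ⟨n, hn⟩ := hG
      rw [zero_smul, sub_zero] at hn
      refine ⟨⟨(CD p k r).K g, hg⟩, ?_, rfl⟩
      refine (LieSubalgebra.mem_engel_iff _ _ _).2 ⟨n, ?_⟩
      apply Subtype.ext
      rw [hpow n g hg, hn]
      exact map_zero (CD p k r).Klin
  have e1 := (Submodule.equivMapOfInjective ((contactAlg p k r).incl : contactAlg p k r →ₗ[k] WittAlg p k (2 * r + 1))
    Subtype.val_injective (LieSubalgebra.engel k x).toSubmodule).finrank_eq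
  have e2 := (Submodule.equivMapOfInjective (CD p k r).Klin hK
    (S p k r ⊓ Module.End.maxGenEigenspace ((CD p k r).B f) 0 : Submodule k _)).finrank_eq
  rw [hmap] at e1
  exact e1.trans e2.symm

lemma y_ne : ∏ j, (CD p k r).y j ^ (p - 1) ≠ 0 := by
  intro h
  have h1 : mon p k (2 * r + 1) (fun _ => ⟨p - 1, by omega⟩) = 0 := by
    rw [mon, prod_split, Finset.prod_mul_distrib]
    have : ∏ j, truncX p k (2 * r + 1) (iy j) ^ (p - 1) = 0 := h
    simp only
    rw [this, mul_zero, zero_mul]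
  exact (li_mon p k (2 * r + 1)).ne_zero _ h1

lemma G_ge [Fact p.Prime] [Infinite k] (f) :
    p ^ r ≤ finrank k (Module.End.maxGenEigenspace ((CD p k r).B f) 0) := by
  have := fd p k (2 * r + 1)
  have := nontriv p k (2 * r + 1) (by omega)
  refine ((CD p k r).ker_B_ge p hp3 (fun j => X_pow_p p k _ _) (fun j => X_pow_p p k _ _)
    (y_ne p k r hp3) f).trans ?_
  apply Submodule.finrank_mono
  intro g hg
  rw [Module.End.mem_maxGenEigenspace]
  exact ⟨1, by simpa using hg⟩

lemma S_finrank : finrank k (TruncPoly p k (2 * r + 1)) ≤ finrank k (S p k r) + 1 := by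
  have := fd p k (2 * r + 1)
  rw [← finrank_top, ← S_sup p k r hp3]
  refine (Submodule.finrank_add_le_finrank_add_finrank _ _).trans ?_
  have := finrank_span_le_card (R := k) ({mon p k (2 * r + 1) (fun _ => ⟨p - 1, by omega⟩)} : Set (TruncPoly p k (2 * r + 1)))
  simp only [Set.toFinset_singleton, Finset.card_singleton] at this
  omega

lemma tor_mem (α : Fin r → k) (β : k) : tor (CD p k r) α β ∈ S p k r := by
  rw [tor_eq_dz _ (two_ne p k hp3)]
  exact dz_mem p k r hp3 _

lemma G_le (α : Fin r → k) (β : k) :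
    finrank k (Module.End.maxGenEigenspace ((CD p k r).B (tor (CD p k r) α β)) 0) ≤
      Nat.card {e // ev p k r α β e = 0} :=
  diag_bound (bas p k (2 * r + 1)) _ _ (fun e => by rw [bas_apply]; exact B_tor_mon p k r α β e)

lemma main1 [Fact p.Prime] [Infinite k] (hr : (2 * r + 4 : k) ≠ 0) :
    lieRankOf k (contactAlg p k r) = p ^ r := by
  have := contact_fd p k r hp3
  have hS := S_top p k r hp3 hr
  apply lieRankOf_eq
  · rintro ⟨D, hD⟩
    obtain ⟨f, hf, rfl⟩ := (mem_contact p k r hp3 D).1 hD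
    rw [engel_finrank p k r hp3 f hf, hS, top_inf_eq]
    exact G_ge p k r hp3 f
  · obtain ⟨α, β, h⟩ := exists_tor p k r hp3
    refine ⟨⟨_, tor_mem p k r hp3 α β⟩, ?_⟩
    refine (engel_finrank p k r hp3 _ (tor_mem p k r hp3 α β)).le.trans ?_
    rw [hS, top_inf_eq]
    exact (G_le p k r hp3 α β).trans h

lemma main2 [Fact p.Prime] [Infinite k] (hr : (2 * r + 4 : k) = 0) :
    lieRankOf k (contactAlg p k r) = p ^ r - 1 := by
  have := contact_fd p k r hp3
  have := fd p k (2 * r + 1)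
  apply lieRankOf_eq
  · rintro ⟨D, hD⟩
    obtain ⟨f, hf, rfl⟩ := (mem_contact p k r hp3 D).1 hD
    rw [engel_finrank p k r hp3 f hf]
    have h1 := G_ge p k r hp3 f
    have h2 := S_finrank p k r hp3
    have h3 := Submodule.finrank_sup_add_finrank_inf_eq (S p k r) (Module.End.maxGenEigenspace ((CD p k r).B f) 0)
    have h4 := Submodule.finrank_le (S p k r ⊔ Module.End.maxGenEigenspace ((CD p k r).B f) 0)
    omega
  · obtain ⟨α, β, h⟩ := exists_tor p k r hp3
    refine ⟨⟨_, tor_mem p k r hp3 α β⟩, ?_⟩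
    refine (engel_finrank p k r hp3 _ (tor_mem p k r hp3 α β)).le.trans ?_
    have hlt : S p k r ⊓ Module.End.maxGenEigenspace ((CD p k r).B (tor (CD p k r) α β)) 0 <
        Module.End.maxGenEigenspace ((CD p k r).B (tor (CD p k r) α β)) 0 := by
      refine lt_of_le_of_ne inf_le_right fun he => ?_
      have hm : mon p k (2 * r + 1) (fun _ => ⟨p - 1, by omega⟩) ∈
          Module.End.maxGenEigenspace ((CD p k r).B (tor (CD p k r) α β)) 0 := by
        rw [Module.End.mem_maxGenEigenspace]
        refine ⟨1, ?_⟩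
        rw [zero_smul, sub_zero, pow_one, B_tor_mon, ev_top p k r hp3, hr, neg_zero, zero_mul, zero_smul]
      rw [← he] at hm
      have := S_coef p k r hp3 hr _ hm.1
      rw [coefT_mon, if_pos rfl] at this
      exact one_ne_zero this
    have := Submodule.finrank_lt_finrank_of_lt hlt
    have := (G_le p k r hp3 α β).trans h
    omega

end TP
end PE4

/-- Theorem 3.4.  Let `n = 2r + 1` and let `K(n)` be the restricted
contact algebra over `k`.  Then `rk(K(n)) = p^r` if `n + 3 ≢ 0 (mod p)`, and
`rk(K(n)) = p^r − 1` if `n + 3 ≡ 0 (mod p)`. -/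
theorem lieRank_contactAlg (p : ℕ) (hp : p.Prime) (hp3 : 3 ≤ p)
    (k : Type*) [Field k] [IsAlgClosed k] [CharP k p]
    (r : ℕ) (hr : 1 ≤ r) :
    (¬ (p ∣ (2 * r + 1) + 3) → lieRankOf k (contactAlg p k r) = p ^ r) ∧
    ((p ∣ (2 * r + 1) + 3) → lieRankOf k (contactAlg p k r) = p ^ r - 1) := by
  haveI : Fact p.Prime := ⟨hp⟩
  haveI : Infinite k := IsAlgClosed.instInfinite
  have h : (p ∣ (2 * r + 1) + 3) ↔ (2 * r + 4 : k) = 0 := by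
    rw [← CharP.cast_eq_zero_iff k p]
    push_cast
    rw [show (2 * (r : k) + 1 + 3) = 2 * r + 4 by ring]
  exact ⟨fun h' => TP.main1 p k r hp3 (fun h0 => h' (h.2 h0)), fun h' => TP.main2 p k r hp3 (h.1 h')⟩
end

section
/- Let n = 2r + 1 and let K(n) be the restricted contact algebra over k. Then K(n) contains no self-centralizing torus, except in the single case p = n = 3. -/
/-!
The truncated polynomial ring `A(n) = k[X₁,…,Xₙ]/(X₁^p,…,Xₙ^p)`, its partial derivatives,
the Jacobson–Witt algebra `W(n) = Der(A(n))`, and related Lie algebras of Cartan type.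
-/

set_option synthInstance.maxHeartbeats 1000000
set_option maxHeartbeats 1600000

theorem aux_semisimple {p : ℕ} {k : Type*} [Field k] [CharP k p]
    {V : Type*} [AddCommGroup V] [Module k V] (f : Module.End k V)
    (h : f ∈ Submodule.span k {z : Module.End k V | ∃ m : ℕ, 1 ≤ m ∧ z = f ^ (p ^ m)}) :
    ∃ P : Polynomial k, Squarefree P ∧ Polynomial.aeval f P = 0 ∧
      ∃ Q : Polynomial k, P = Polynomial.X - Q ∧
        Q ∈ Submodule.span k {z : Polynomial k | ∃ m : ℕ, 1 ≤ m ∧ z = Polynomial.X ^ (p ^ m)} := by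
  have key : ∀ z ∈ Submodule.span k {z : Module.End k V | ∃ m : ℕ, 1 ≤ m ∧ z = f ^ (p ^ m)},
      ∃ Q : Polynomial k, Polynomial.aeval f Q = z ∧ Polynomial.derivative Q = 0 ∧
        Q ∈ Submodule.span k {z : Polynomial k | ∃ m : ℕ, 1 ≤ m ∧ z = Polynomial.X ^ (p ^ m)} := by
    intro z hz
    induction hz using Submodule.span_induction with
    | mem x hx =>
      obtain ⟨m, hm, rfl⟩ := hx
      refine ⟨Polynomial.X ^ (p ^ m), by simp, ?_, Submodule.subset_span ⟨m, hm, rfl⟩⟩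
      rw [Polynomial.derivative_X_pow]
      obtain ⟨l, rfl⟩ : ∃ l, m = l + 1 := ⟨m - 1, by omega⟩
      simp [pow_succ]
    | zero => exact ⟨0, by simp, by simp, Submodule.zero_mem _⟩
    | add x y _ _ hx hy =>
      obtain ⟨Q, h1, h2, h3⟩ := hx
      obtain ⟨Q', h1', h2', h3'⟩ := hy
      exact ⟨Q + Q', by simp [h1, h1'], by simp [h2, h2'], Submodule.add_mem _ h3 h3'⟩
    | smul a x _ hx =>
      obtain ⟨Q, h1, h2, h3⟩ := hx
      exact ⟨a • Q, by simp [h1], by simp [h2], Submodule.smul_mem _ _ h3⟩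
  obtain ⟨Q, h1, h2, h3⟩ := key f h
  refine ⟨Polynomial.X - Q, ?_, by simp [h1], Q, rfl, h3⟩
  apply Polynomial.Separable.squarefree
  unfold Polynomial.Separable
  simp [h2]
  exact isCoprime_one_right

theorem aux_diag {k : Type*} [Field k] [IsAlgClosed k]
    {V : Type*} [AddCommGroup V] [Module k V] [FiniteDimensional k V] {ι : Type*}
    (f : ι → Module.End k V) (hc : ∀ i j, Commute (f i) (f j))
    (h : ∀ i, ∃ P : Polynomial k, Squarefree P ∧ Polynomial.aeval (f i) P = 0) :
    Submodule.span k {v : V | ∃ χ : ι → k, ∀ i, f i v = χ i • v} = ⊤ := by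
  have hs : ∀ i, (f i).IsSemisimple := fun i => by
    obtain ⟨P, h1, h2⟩ := h i
    exact Module.End.isSemisimple_of_squarefree_aeval_eq_zero h1 h2
  have := Module.End.iSup_iInf_maxGenEigenspace_eq_top_of_iSup_maxGenEigenspace_eq_top_of_commute
    f (fun i j _ => hc i j) (fun i => Module.End.iSup_maxGenEigenspace_eq_top _)
  rw [eq_top_iff, ← this]
  apply iSup_le
  intro χ v hv
  apply Submodule.subset_span
  refine ⟨χ, fun i => ?_⟩
  have := (Submodule.mem_iInf _).1 hv i
  rw [(hs i).isFinitelySemisimple.maxGenEigenspace_eq_eigenspace] at this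
  exact Module.End.mem_eigenspace_iff.1 this

theorem aux_isotropic {k : Type*} [Field k] [IsAlgClosed k]
    {V : Type*} [AddCommGroup V] [Module k V] (B : V →ₗ[k] V →ₗ[k] k)
    (hB : ∀ x y, B x y = B y x) (g₁ g₂ : V) (hg : LinearIndependent k ![g₁, g₂]) :
    ∃ s t : k, s • g₁ + t • g₂ ≠ 0 ∧ B (s • g₁ + t • g₂) (s • g₁ + t • g₂) = 0 := by
  rw [LinearIndependent.pair_iff] at hg
  by_cases h2 : B g₂ g₂ = 0
  · refine ⟨0, 1, fun h => ?_, by simp [h2]⟩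
    simpa using (hg 0 1 h).2
  · obtain ⟨t, ht⟩ := IsAlgClosed.exists_root
      (Polynomial.C (B g₂ g₂) * Polynomial.X ^ 2 + Polynomial.C (2 * B g₁ g₂) * Polynomial.X
        + Polynomial.C (B g₁ g₁)) (by rw [Polynomial.degree_quadratic h2]; decide)
    refine ⟨1, t, fun h => ?_, ?_⟩
    · simpa using (hg 1 t h).1
    · simp [Polynomial.IsRoot] at ht
      simp [hB g₂ g₁]
      linear_combination ht

theorem aux_linInd {p : ℕ} [hp : Fact p.Prime] {k : Type*} [Field k] [IsAlgClosed k] [CharP k p]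
    [Algebra (ZMod p) k] {T : Type*} (π : T → T) (m : ℕ) :
    ∀ (lam : Fin m → (T → k)), (∀ i x, lam i (π x) = lam i x ^ p) →
    LinearIndependent (ZMod p) lam → LinearIndependent k lam := by
  induction m with
  | zero => intro lam _ _; exact linearIndependent_empty_type
  | succ m ih =>
    intro lam hl hi
    rw [linearIndependent_finSucc] at hi ⊢
    refine ⟨ih _ (fun i x => hl _ x) hi.1, fun hmem => hi.2 ?_⟩
    have hind := ih (Fin.tail lam) (fun i x => hl _ x) hi.1
    obtain ⟨c, hc⟩ := (Submodule.mem_span_range_iff_exists_fun k).1 hmem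
    have hcx : ∀ x, ∑ i, c i * Fin.tail lam i x = lam 0 x := fun x => by
      rw [← hc]; simp [Finset.sum_apply]
    have hroot : ∀ i, ∃ d, d ^ p = c i ^ p - c i := fun i =>
      IsAlgClosed.exists_pow_nat_eq _ hp.out.pos
    choose d hd using hroot
    have hd0 : ∀ i, d i = 0 := by
      refine Fintype.linearIndependent_iff.1 hind d ?_
      funext x
      have h1 := hcx (π x)
      rw [hl, ← hcx x, sum_pow_char] at h1
      have : (∑ i, d i * Fin.tail lam i x) ^ p = 0 := by
        rw [sum_pow_char]
        simp only [mul_pow, hd, sub_mul, Finset.sum_sub_distrib] at h1 ⊢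
        rw [← h1, sub_eq_zero]
        exact Finset.sum_congr rfl fun i _ => by
          rw [show Fin.tail lam i (π x) = Fin.tail lam i x ^ p from hl _ _]
      simpa [Finset.sum_apply] using eq_zero_of_pow_eq_zero this
    have hcp : ∀ i, ∃ z : ZMod p, algebraMap (ZMod p) k z = c i := fun i => by
      have : c i ^ p = c i := by
        have := hd i
        rw [hd0, zero_pow hp.out.ne_zero] at this
        exact (sub_eq_zero.1 this.symm)
      have h2 := (Subfield.mem_bot_iff_pow_eq_self k p).2 this
      rw [Subfield.bot_eq_of_zMod_algebra p] at h2
      exact h2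
    choose z hz using hcp
    refine (Submodule.mem_span_range_iff_exists_fun _).2 ⟨z, ?_⟩
    rw [← hc]
    refine Finset.sum_congr rfl fun i _ => ?_
    rw [← hz i]
    funext x
    simp [Algebra.smul_def]

theorem aux_count {p : ℕ} [hp : Fact p.Prime] {k : Type*} [Field k] [IsAlgClosed k] [CharP k p]
    [Algebra (ZMod p) k] {T : Type*} [AddCommGroup T] [Module k T] [FiniteDimensional k T]
    (π : T → T) (n : ℕ) (lam : Fin n → (T →ₗ[k] k)) (hl : ∀ i x, lam i (π x) = lam i x ^ p)
    (ν : T → k) (a₀ : Fin n → ZMod p)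
    (ha₀ : ∀ x, ∑ i, algebraMap (ZMod p) k (a₀ i) * lam i x = ν x) :
    p ^ n ≤ p ^ (Module.finrank k T) *
      Nat.card {a : Fin n → ZMod p // ∀ x, ∑ i, algebraMap (ZMod p) k (a i) * lam i x = ν x} := by
  classical
  let Φ : (Fin n → ZMod p) →ₗ[ZMod p] (T → k) :=
    { toFun := fun a x => ∑ i, algebraMap (ZMod p) k (a i) * lam i x
      map_add' := fun a b => by
        funext x; simp [add_mul, Finset.sum_add_distrib]
      map_smul' := fun c a => by
        funext x
        simp [Algebra.smul_def, Finset.mul_sum, mul_assoc] }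
  have hΦ : ∀ a x, Φ a x = ∑ i, algebraMap (ZMod p) k (a i) * lam i x := fun _ _ => rfl
  -- bound on the range
  have hr : Module.finrank (ZMod p) (LinearMap.range Φ) ≤ Module.finrank k T := by
    let b := Module.finBasis (ZMod p) (LinearMap.range Φ)
    let v : Fin (Module.finrank (ZMod p) (LinearMap.range Φ)) → (T → k) := fun j => (b j : T → k)
    have hv : LinearIndependent (ZMod p) v :=
      b.linearIndependent.map' (LinearMap.range Φ).subtype (Submodule.ker_subtype _)
    have hfr : ∀ j x, v j (π x) = v j x ^ p := by
      intro j x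
      obtain ⟨a, ha⟩ := (b j).2
      have : v j = Φ a := ha.symm
      rw [this, hΦ, hΦ, sum_pow_char]
      refine Finset.sum_congr rfl fun i _ => ?_
      rw [mul_pow, hl, ← map_pow (algebraMap (ZMod p) k), ZMod.pow_card]
    have hk := aux_linInd π _ v hfr hv
    have hlin : ∀ j, ∃ w : T →ₗ[k] k, ∀ x, w x = v j x := by
      intro j
      obtain ⟨a, ha⟩ := (b j).2
      refine ⟨∑ i, algebraMap (ZMod p) k (a i) • lam i, fun x => ?_⟩
      have : v j = Φ a := ha.symm
      rw [this, hΦ]; simp [Algebra.smul_def]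
    choose w hw using hlin
    have hwl : LinearIndependent k w := by
      rw [Fintype.linearIndependent_iff] at hk ⊢
      intro g hg
      apply hk g
      funext x
      have := congrArg (fun φ : T →ₗ[k] k => φ x) hg
      simpa [hw] using this
    have := hwl.fintype_card_le_finrank
    simpa [Subspace.dual_finrank_eq] using this
  have hrk := LinearMap.finrank_range_add_finrank_ker Φ
  simp only [Module.finrank_fintype_fun_eq_card, Fintype.card_fin] at hrk
  have hcard : Nat.card (LinearMap.ker Φ) = p ^ Module.finrank (ZMod p) (LinearMap.ker Φ) := by
    rw [Module.natCard_eq_pow_finrank (K := ZMod p)]; simp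
  have hfib : Nat.card (LinearMap.ker Φ) ≤
      Nat.card {a : Fin n → ZMod p // ∀ x, ∑ i, algebraMap (ZMod p) k (a i) * lam i x = ν x} := by
    refine Nat.card_le_card_of_injective (fun a => ⟨a.1 + a₀, fun x => ?_⟩) ?_
    · rw [← hΦ, map_add, Pi.add_apply, LinearMap.mem_ker.1 a.2, hΦ, ha₀]; simp
    · intro a b h
      have := congrArg Subtype.val h
      exact Subtype.ext (add_right_cancel this)
  calc p ^ n = p ^ (Module.finrank (ZMod p) (LinearMap.range Φ)) *
        p ^ Module.finrank (ZMod p) (LinearMap.ker Φ) := by rw [← pow_add, hrk]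
    _ ≤ _ := by
      rw [← hcard]
      exact Nat.mul_le_mul (Nat.pow_le_pow_right hp.out.pos hr) hfib


/-- Abstract contact frame on a commutative algebra. -/
structure Ctc (p : ℕ) (k A : Type*) [Field k] [CommRing A] [Algebra k A] (r : ℕ) where
  a : Fin r → Derivation k A A
  b : Fin r → Derivation k A A
  d : Derivation k A A
  X : Fin r → A
  Y : Fin r → A
  Z : A
  aa : ∀ i j y, a i (a j y) = a j (a i y)
  bb : ∀ i j y, b i (b j y) = b j (b i y)
  ad : ∀ i y, a i (d y) = d (a i y)
  bd : ∀ i y, b i (d y) = d (b i y)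
  ab : ∀ i j y, a i (b j y) = b j (a i y) - if i = j then 2 * d y else 0
  aX : ∀ i j, a i (X j) = if i = j then 1 else 0
  bX : ∀ i j, b i (X j) = 0
  aY : ∀ i j, a i (Y j) = 0
  bY : ∀ i j, b i (Y j) = if i = j then 1 else 0
  dX : ∀ j, d (X j) = 0
  dY : ∀ j, d (Y j) = 0
  aZ : ∀ i, a i Z = Y i
  bZ : ∀ i, b i Z = - X i
  dZ : d Z = 1
  ext : ∀ D D' : Derivation k A A, (∀ i, D (X i) = D' (X i)) → (∀ i, D (Y i) = D' (Y i)) →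
    D Z = D' Z → D = D'
  eps : A →ₐ[k] k
  frob : ∀ y, y ^ p = algebraMap k A (eps y) ^ p
  pd : Fin (2 * r + 1) → Derivation k A A
  xs : Fin (2 * r + 1) → A
  pdxs : ∀ i j, pd i (xs j) = if i = j then 1 else 0
  epsxs : ∀ i, eps (xs i) = 0
  taylor : ∀ y, y - algebraMap k A (eps y) - ∑ i, eps (pd i y) • xs i ∈ (RingHom.ker eps) ^ 2
  fin : FiniteDimensional k A
  rank : Module.finrank k A = p ^ (2 * r + 1)
  tau : A →ₗ[k] k
  mem_of_tau : ∀ S : Submodule k A, (∀ y, d y ∈ S) → (∀ i y, a i y - Y i * d y ∈ S) →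
    (∀ i y, b i y + X i * d y ∈ S) → ∀ y, tau y = 0 → y ∈ S

namespace Ctc

variable {p : ℕ} {k A : Type*} [Field k] [CommRing A] [Algebra k A] {r : ℕ} (c : Ctc p k A r)

noncomputable def D (f : A) : Derivation k A A :=
  (2 * f) • c.d + ∑ i, (c.a i f • c.b i - c.b i f • c.a i)

theorem D_apply (f y : A) :
    c.D f y = 2 * f * c.d y + ∑ i, (c.a i f * c.b i y - c.b i f * c.a i y) := by
  have h : ∀ (F : Fin r → Derivation k A A), (∑ i, F i) y = ∑ i, F i y := fun F => by
    have := map_sum (Derivation.coeFnAddMonoidHom (R := k) (A := A) (M := A)) F Finset.univ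
    have h2 := congrFun this y
    rw [Finset.sum_apply] at h2
    exact h2
  rw [D, Derivation.add_apply, h]
  simp

noncomputable def br (f g : A) : A := c.D f g - 2 * c.d f * g

theorem D_symm (f g : A) : c.D f g + c.D g f = 2 * f * c.d g + 2 * g * c.d f := by
  rw [D_apply, D_apply]
  have : ∑ i, (c.a i f * c.b i g - c.b i f * c.a i g)
      + ∑ i, (c.a i g * c.b i f - c.b i g * c.a i f) = 0 := by
    rw [← Finset.sum_add_distrib]
    exact Finset.sum_eq_zero fun i _ => by ring
  linear_combination this

theorem D_X (f : A) (j : Fin r) : c.D f (c.X j) = - c.b j f := by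
  rw [D_apply]; simp [c.dX, c.bX, c.aX, Finset.sum_ite_eq']

theorem D_Y (f : A) (j : Fin r) : c.D f (c.Y j) = c.a j f := by
  rw [D_apply]; simp [c.dY, c.bY, c.aY, Finset.sum_ite_eq']

theorem D_Z (f : A) :
    c.D f c.Z + ∑ i, (c.X i * c.D f (c.Y i) - c.Y i * c.D f (c.X i)) = 2 * f := by
  simp only [D_X, D_Y]
  rw [D_apply]
  have : ∑ i, (c.a i f * c.b i c.Z - c.b i f * c.a i c.Z) +
      ∑ i, (c.X i * c.a i f - c.Y i * (- c.b i f)) = 0 := by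
    rw [← Finset.sum_add_distrib]
    refine Finset.sum_eq_zero fun i _ => ?_
    rw [c.aZ, c.bZ]; ring
  rw [c.dZ]
  linear_combination this

theorem br_Y (f g : A) (j : Fin r) :
    c.a j (c.br f g) = c.D f (c.a j g) - c.D g (c.a j f) := by
  have h1 : c.a j (∑ i, (c.a i f * c.b i g - c.b i f * c.a i g)) =
      ∑ i, (c.a i (c.a j f) * c.b i g - c.b i (c.a j f) * c.a i g)
      + ∑ i, (c.a i f * c.b i (c.a j g) - c.b i f * c.a i (c.a j g))
      - 2 * c.a j f * c.d g + 2 * c.d f * c.a j g := by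
    have h0 : (∑ i, if j = i then (- 2 * c.a j f * c.d g + 2 * c.d f * c.a j g) else 0) =
      (- 2 * c.a j f * c.d g + 2 * c.d f * c.a j g) := by simp
    rw [map_sum, sub_eq_add_neg, add_assoc, ← neg_mul, ← neg_mul, ← h0,
      ← Finset.sum_add_distrib, ← Finset.sum_add_distrib]
    refine Finset.sum_congr rfl fun i _ => ?_
    rw [map_sub, Derivation.leibniz, Derivation.leibniz, c.ab j i f, c.ab j i g, c.aa j i f,
      c.aa j i g]
    simp only [smul_eq_mul]
    split_ifs with h
    · subst h; ring
    · ring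
  have h2 : ∑ i, (c.a i (c.a j f) * c.b i g - c.b i (c.a j f) * c.a i g)
      + ∑ i, (c.a i g * c.b i (c.a j f) - c.b i g * c.a i (c.a j f)) = 0 := by
    rw [← Finset.sum_add_distrib]
    exact Finset.sum_eq_zero fun i _ => by ring
  rw [br, map_sub, D_apply, D_apply, D_apply, map_add, h1]
  simp only [Derivation.leibniz, smul_eq_mul, c.ad,
    show c.a j (2 : A) = 0 from Derivation.map_natCast (c.a j) 2]
  linear_combination h2

theorem br_X (f g : A) (j : Fin r) :
    c.b j (c.br f g) = c.D f (c.b j g) - c.D g (c.b j f) := by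
  have h1 : c.b j (∑ i, (c.a i f * c.b i g - c.b i f * c.a i g)) =
      ∑ i, (c.a i (c.b j f) * c.b i g - c.b i (c.b j f) * c.a i g)
      + ∑ i, (c.a i f * c.b i (c.b j g) - c.b i f * c.a i (c.b j g))
      - 2 * c.b j f * c.d g + 2 * c.d f * c.b j g := by
    have h0 : (∑ i, if i = j then (- 2 * c.b j f * c.d g + 2 * c.d f * c.b j g) else 0) =
      (- 2 * c.b j f * c.d g + 2 * c.d f * c.b j g) := by simp
    rw [map_sum, sub_eq_add_neg, add_assoc, ← neg_mul, ← neg_mul, ← h0,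
      ← Finset.sum_add_distrib, ← Finset.sum_add_distrib]
    refine Finset.sum_congr rfl fun i _ => ?_
    rw [map_sub, Derivation.leibniz, Derivation.leibniz, c.ab i j f, c.ab i j g, c.bb j i f,
      c.bb j i g]
    simp only [smul_eq_mul]
    split_ifs with h
    · subst h; ring
    · ring
  have h2 : ∑ i, (c.a i (c.b j f) * c.b i g - c.b i (c.b j f) * c.a i g)
      + ∑ i, (c.a i g * c.b i (c.b j f) - c.b i g * c.a i (c.b j f)) = 0 := by
    rw [← Finset.sum_add_distrib]
    exact Finset.sum_eq_zero fun i _ => by ring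
  rw [br, map_sub, D_apply, D_apply, D_apply, map_add, h1]
  simp only [Derivation.leibniz, smul_eq_mul, c.bd,
    show c.b j (2 : A) = 0 from Derivation.map_natCast (c.b j) 2]
  linear_combination h2

theorem br_Z_aux (f g : A) :
    ⁅c.D f, c.D g⁆ c.Z + ∑ i, (c.X i * ⁅c.D f, c.D g⁆ (c.Y i) - c.Y i * ⁅c.D f, c.D g⁆ (c.X i))
      = 2 * c.br f g := by
  have e : ∀ f g : A, c.D f (c.D g c.Z) +
      ∑ i, (c.X i * c.D f (c.D g (c.Y i)) - c.Y i * c.D f (c.D g (c.X i)))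
      + ∑ i, (c.a i f * c.b i g - c.b i f * c.a i g) = 2 * c.D f g := by
    intro f g
    have := congrArg (c.D f) (c.D_Z g)
    rw [map_add, map_sum, Derivation.leibniz,
      show c.D f (2 : A) = 0 from Derivation.map_natCast (c.D f) 2] at this
    simp only [smul_eq_mul, mul_zero, add_zero] at this
    rw [← this, add_assoc, ← Finset.sum_add_distrib]
    congr 1
    refine Finset.sum_congr rfl fun i _ => ?_
    rw [map_sub, Derivation.leibniz, Derivation.leibniz]
    simp only [smul_eq_mul, D_X, D_Y]
    ring
  have h1 := e f g
  have h2 := e g f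
  have h3 : ∑ i, (c.X i * ⁅c.D f, c.D g⁆ (c.Y i) - c.Y i * ⁅c.D f, c.D g⁆ (c.X i)) =
    ∑ i, (c.X i * c.D f (c.D g (c.Y i)) - c.Y i * c.D f (c.D g (c.X i))) -
    ∑ i, (c.X i * c.D g (c.D f (c.Y i)) - c.Y i * c.D g (c.D f (c.X i))) := by
    rw [← Finset.sum_sub_distrib]
    refine Finset.sum_congr rfl fun i _ => ?_
    rw [Derivation.commutator_apply, Derivation.commutator_apply]; ring
  rw [h3, Derivation.commutator_apply, br]
  have h4 := c.D_symm f g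
  have h5 := c.D_apply f g
  have h6 := c.D_apply g f
  linear_combination h1 - h2 + h5 - h6 - h4

theorem lie_D (f g : A) : ⁅c.D f, c.D g⁆ = c.D (c.br f g) := by
  have hX : ∀ i, ⁅c.D f, c.D g⁆ (c.X i) = c.D (c.br f g) (c.X i) := fun i => by
    rw [Derivation.commutator_apply]; simp only [D_X, br_X, map_neg]; ring
  have hY : ∀ i, ⁅c.D f, c.D g⁆ (c.Y i) = c.D (c.br f g) (c.Y i) := fun i => by
    rw [Derivation.commutator_apply]; simp only [D_Y, br_Y]
  refine c.ext _ _ hX hY ?_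
  have h1 := c.br_Z_aux f g
  have h2 := c.D_Z (c.br f g)
  simp only [hX, hY] at h1
  linear_combination h1 - h2

theorem D_add (f g : A) : c.D (f + g) = c.D f + c.D g := by
  ext y
  rw [Derivation.add_apply, D_apply, D_apply, D_apply, add_add_add_comm, ← Finset.sum_add_distrib]
  congr 1
  · ring
  · exact Finset.sum_congr rfl fun i _ => by rw [map_add, map_add]; ring

theorem D_smul (s : k) (f : A) : c.D (s • f) = s • c.D f := by
  ext y
  rw [Derivation.smul_apply, D_apply, D_apply, smul_add, Finset.smul_sum]
  congr 1
  · simp [Algebra.smul_def]; ring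
  · exact Finset.sum_congr rfl fun i _ => by
      rw [Derivation.map_smul, Derivation.map_smul]; simp only [Algebra.smul_def]; ring

noncomputable def DL : A →ₗ[k] Derivation k A A where
  toFun := c.D
  map_add' := c.D_add
  map_smul' := c.D_smul

theorem DL_apply (f : A) : c.DL f = c.D f := rfl

theorem D_inj (h2 : (2 : k) ≠ 0) {f : A} (hf : c.D f = 0) : f = 0 := by
  have h := c.D_Z f
  rw [hf] at h
  simp at h
  have h3 : (2 : k) • f = 0 := by rw [Algebra.smul_def, map_ofNat]; exact h.symm
  exact (smul_eq_zero.1 h3).resolve_left h2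

theorem D_mul (f g : A) (y : A) :
    c.D (f * g) y = f * c.D g y + g * c.D f y - 2 * (f * g) * c.d y := by
  have : ∑ i, (c.a i (f * g) * c.b i y - c.b i (f * g) * c.a i y) =
    f * ∑ i, (c.a i g * c.b i y - c.b i g * c.a i y) +
    g * ∑ i, (c.a i f * c.b i y - c.b i f * c.a i y) := by
    rw [Finset.mul_sum, Finset.mul_sum, ← Finset.sum_add_distrib]
    refine Finset.sum_congr rfl fun i _ => ?_
    simp only [Derivation.leibniz, smul_eq_mul]; ring
  rw [D_apply, D_apply, D_apply]
  linear_combination this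

theorem br_self (f : A) : c.br f f = 0 := by
  have : c.D f f = 2 * f * c.d f := by
    rw [D_apply, add_eq_left]
    exact Finset.sum_eq_zero fun i _ => by ring
  rw [br, this]; ring

theorem br_antisymm (f g : A) : c.br f g = - c.br g f := by
  have := c.D_symm f g
  rw [br, br]; linear_combination this

end Ctc


namespace Ctc

variable {p : ℕ} {k A : Type*} [Field k] [CommRing A] [Algebra k A] {r : ℕ} (c : Ctc p k A r)

abbrev m : Ideal A := RingHom.ker c.eps

theorem mem_m {y : A} : y ∈ c.m ↔ c.eps y = 0 := Iff.rfl

theorem isUnit_of (hp : p.Prime) {y : A} (hy : c.eps y ≠ 0) : IsUnit y := by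
  have h := c.frob y
  have hu : IsUnit (y ^ p) := by
    rw [h]; exact (IsUnit.map (algebraMap k A) (Ne.isUnit hy)).pow p
  exact (isUnit_pow_iff hp.ne_zero).1 hu

theorem pow_p (hp : p.Prime) {y : A} (hy : c.eps y = 0) : y ^ p = 0 := by
  rw [c.frob, hy, map_zero, zero_pow hp.ne_zero]

theorem m_nilp (hp : p.Prime) : ∃ N, c.m ^ N = ⊥ := by
  have := c.fin
  have hN : IsNoetherianRing A := isNoetherian_of_tower k inferInstance
  have : IsNilpotent c.m := by
    rw [Ideal.FG.isNilpotent_iff_le_nilradical (IsNoetherian.noetherian _)]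
    intro y hy
    exact ⟨p, c.pow_p hp hy⟩
  exact this

theorem der_pow (E : Derivation k A A) (I : Ideal A) (n : ℕ) {y : A} (hy : y ∈ I ^ (n + 1)) :
    E y ∈ I ^ n := by
  induction n generalizing y with
  | zero => simp
  | succ n ih =>
    rw [pow_succ] at hy
    induction hy using Submodule.mul_induction_on' with
    | mem_mul_mem u hu v hv =>
      rw [Derivation.leibniz, smul_eq_mul, smul_eq_mul]
      refine Ideal.add_mem _ (Ideal.mul_mem_right _ _ hu) ?_
      rw [mul_comm, pow_succ]
      exact Ideal.mul_mem_mul (ih hu) hv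
    | add u _ v _ hu hv => rw [map_add]; exact Ideal.add_mem _ hu hv

theorem der_pow' (E : Derivation k A A) (I : Ideal A) (hE : ∀ y, E y ∈ I ^ 2) (n : ℕ) {y : A}
    (hy : y ∈ I ^ n) : E y ∈ I ^ (n + 1) := by
  induction n generalizing y with
  | zero => exact Ideal.pow_le_pow_right (by omega) (hE y)
  | succ n ih =>
    rw [pow_succ] at hy
    induction hy using Submodule.mul_induction_on' with
    | mem_mul_mem u hu v hv =>
      rw [Derivation.leibniz, smul_eq_mul, smul_eq_mul]
      refine Ideal.add_mem _ ?_ ?_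
      · rw [add_assoc, pow_add]; exact Ideal.mul_mem_mul hu (hE v)
      · rw [mul_comm, pow_succ]; exact Ideal.mul_mem_mul (ih hu) hv
    | add u _ v _ hu hv => rw [map_add]; exact Ideal.add_mem _ hu hv

theorem nilp_of (hp : p.Prime) (E : Derivation k A A) (hE : ∀ y, E y ∈ c.m ^ 2) :
    ∃ N, ∀ y, (E : A → A)^[N] y = 0 := by
  obtain ⟨N, hN⟩ := c.m_nilp hp
  refine ⟨N, fun y => ?_⟩
  have : ∀ n, (E : A → A)^[n] y ∈ c.m ^ n := by
    intro n
    induction n with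
    | zero => simp
    | succ n ih => rw [Function.iterate_succ_apply']; exact der_pow' E _ hE n ih
  have h := this N
  rw [hN] at h
  exact h

/-- semisimple and nilpotent implies zero -/
theorem eq_zero_of_nilp {V : Type*} [AddCommGroup V] [Module k V] (E : Module.End k V)
    (hs : Submodule.span k {v : V | ∃ s : k, E v = s • v} = ⊤)
    (hn : ∃ N, ∀ y, (E : V → V)^[N] y = 0) : E = 0 := by
  obtain ⟨N, hN⟩ := hn
  refine LinearMap.ext_on_range (v := fun x : {v : V | ∃ s : k, E v = s • v} => x.1)
    (by simpa using hs) ?_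
  rintro ⟨v, s, hv⟩
  have : ∀ n, (E : V → V)^[n] v = s ^ n • v := by
    intro n
    induction n with
    | zero => simp
    | succ n ih => rw [Function.iterate_succ_apply', ih, map_smul, hv, smul_smul, pow_succ]
  have h := hN v
  rw [this] at h
  change E v = 0
  rw [hv]
  rcases smul_eq_zero.1 h with h | h
  · simp [eq_zero_of_pow_eq_zero h]
  · simp [h]

theorem mem_m_sq {y : A} (h0 : c.eps y = 0) (h : ∀ i, c.eps (c.pd i y) = 0) : y ∈ c.m ^ 2 := by
  have := c.taylor y
  simpa [h0, h] using this

theorem final_step (hp : p.Prime) (h2 : (2 : k) ≠ 0) (g : A) (hg : g ≠ 0) (hgg : g * g = 0)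
    (hs : Submodule.span k {v : A | ∃ s : k, c.D g v = s • v} = ⊤) : False := by
  have hs' : ¬ ∀ y, c.D g y ∈ c.m ^ 2 := by
    intro h
    have : (c.D g).toLinearMap = 0 := eq_zero_of_nilp (c.D g).toLinearMap hs (c.nilp_of hp _ h)
    apply hg
    apply c.D_inj h2
    ext y
    exact congrArg (fun E : A →ₗ[k] A => E y) this
  have two : ∀ x : A, 2 * x = 0 → x = 0 := by
    intro x hx
    have h3 : (2 : k) • x = 0 := by rw [Algebra.smul_def, map_ofNat]; exact hx
    exact (smul_eq_zero.1 h3).resolve_left h2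
  have hd : g * c.d g = 0 := by
    have := congrArg c.d hgg
    rw [Derivation.leibniz, map_zero, smul_eq_mul] at this
    exact two _ (by linear_combination this)
  have hgD : ∀ y, g * c.D g y = 0 := by
    intro y
    have := congrArg (c.D y) hgg
    rw [Derivation.leibniz, map_zero, smul_eq_mul] at this
    have h3 := c.D_symm g y
    have h4 : g * c.D y g = 0 := two _ (by linear_combination this)
    linear_combination g * h3 - h4 + 2 * y * hd + 2 * c.d y * hgg
  have hnu : ∀ y, g * y = 0 → c.eps y = 0 := by
    intro y hy
    by_contra h
    exact hg ((c.isUnit_of hp h).mul_left_eq_zero.1 hy)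
  have hDm : ∀ y, c.eps (c.D g y) = 0 := fun y => hnu _ (hgD y)
  have hDg : c.D g g = 0 := by
    have := c.br_self g
    rw [br] at this
    linear_combination this + 2 * hd
  -- an eigenvector outside `m ^ 2`
  obtain ⟨y, s, hy, hs0, hym⟩ : ∃ (y : A) (s : k), c.D g y = s • y ∧ s ≠ 0 ∧ y ∉ c.m ^ 2 := by
    by_contra! hcon
    apply hs'
    intro y
    have hy : y ∈ Submodule.span k {v : A | ∃ s : k, c.D g v = s • v} := by rw [hs]; trivial
    induction hy using Submodule.span_induction with
    | mem x hx =>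
      obtain ⟨s, hx⟩ := hx
      by_cases h0 : s = 0
      · rw [hx, h0, zero_smul]; exact Ideal.zero_mem _
      · rw [hx, Algebra.smul_def]; exact Ideal.mul_mem_left _ _ (hcon x s hx h0)
    | zero => rw [map_zero]; exact Ideal.zero_mem _
    | add u v _ _ hu hv => rw [map_add]; exact Ideal.add_mem _ hu hv
    | smul t u _ hu =>
      rw [Derivation.map_smul, Algebra.smul_def]; exact Ideal.mul_mem_left _ _ hu
  have hgy : g * y = 0 := by
    have := hgD y
    rw [hy, mul_smul_comm] at this
    exact (smul_eq_zero.1 this).resolve_left hs0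
  have hy0 := hnu y hgy
  obtain ⟨i, hi⟩ : ∃ i, c.eps (c.pd i y) ≠ 0 := by
    by_contra! h
    exact hym (c.mem_m_sq hy0 h)
  obtain ⟨v, hv⟩ := (c.isUnit_of hp hi).exists_left_inv
  set E : Derivation k A A := v • c.pd i with hE
  have hEy : E y = 1 := by rw [hE, Derivation.smul_apply, smul_eq_mul, hv]
  have e1 : g = - (y * E g) := by
    have := congrArg E hgy
    rw [Derivation.leibniz, map_zero, smul_eq_mul, smul_eq_mul, hEy] at this
    linear_combination this
  have e2 : y ^ 2 * E g = 0 := by linear_combination y * e1 - hgy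
  have e3 : 2 * g = y ^ 2 * E (E g) := by
    have := congrArg E e2
    rw [Derivation.leibniz, Derivation.leibniz_pow, map_zero, hEy] at this
    simp only [smul_eq_mul, nsmul_eq_mul] at this
    push_cast at this
    simp only [Nat.add_one_sub_one, pow_one, mul_one] at this
    linear_combination 2 * e1 - this
  obtain ⟨b, hb⟩ : ∃ b, g = y ^ 2 * b := by
    refine ⟨(2 : k)⁻¹ • E (E g), ?_⟩
    rw [mul_smul_comm, ← e3, ← map_ofNat (algebraMap k A), ← Algebra.smul_def, smul_smul,
      inv_mul_cancel₀ h2, one_smul]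
  by_cases hbu : c.eps b = 0
  · apply hs'
    have hg3 : g ∈ c.m ^ 3 := by
      rw [hb, pow_succ]
      exact Ideal.mul_mem_mul (Ideal.pow_mem_pow hy0 2) hbu
    intro x
    rw [D_apply]
    refine Ideal.add_mem _ (Ideal.mul_mem_right _ _ (Ideal.mul_mem_left _ _
      (Ideal.pow_le_pow_right (by omega) hg3))) (Ideal.sum_mem _ fun i _ => Ideal.sub_mem _ ?_ ?_)
    · exact Ideal.mul_mem_right _ _ (der_pow _ _ 2 hg3)
    · exact Ideal.mul_mem_right _ _ (der_pow _ _ 2 hg3)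
  · have h5 : y ^ 2 * (2 * (s • b) + c.D g b) = 0 := by
      have := hDg
      nth_rewrite 2 [hb] at this
      rw [Derivation.leibniz, Derivation.leibniz_pow, hy] at this
      simp only [smul_eq_mul, nsmul_eq_mul] at this
      push_cast at this
      simp only [Nat.add_one_sub_one, pow_one, Algebra.smul_def] at this ⊢
      linear_combination this
    have h6 : c.eps (2 * (s • b) + c.D g b) ≠ 0 := by
      rw [map_add, hDm, map_mul, map_smul, map_ofNat]
      simp [h2, hs0, hbu]
    have h7 := (c.isUnit_of hp h6).mul_left_eq_zero.1 h5
    exact hg (by rw [hb, h7, zero_mul])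

end Ctc


theorem aux_ad {p : ℕ} {k : Type*} [Field k] [CharP k p] (hp : p.Prime)
    {V : Type*} [AddCommGroup V] [Module k V] [Nontrivial V] (F : Module.End k V)
    (Q : Polynomial k)
    (hQ : Q ∈ Submodule.span k {z : Polynomial k | ∃ m : ℕ, 1 ≤ m ∧ z = Polynomial.X ^ (p ^ m)}) :
    Polynomial.aeval (LinearMap.mulLeft k F - LinearMap.mulRight k F) Q =
      LinearMap.mulLeft k (Polynomial.aeval F Q) - LinearMap.mulRight k (Polynomial.aeval F Q) := by
  have : CharP (Module.End k (Module.End k V)) p :=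
    charP_of_injective_algebraMap (algebraMap k (Module.End k (Module.End k V))).injective p
  have : Fact p.Prime := ⟨hp⟩
  induction hQ using Submodule.span_induction with
  | mem x hx =>
    obtain ⟨m, hm, rfl⟩ := hx
    rw [map_pow, map_pow, Polynomial.aeval_X, Polynomial.aeval_X,
      sub_pow_expChar_pow_of_commute _ _ (LinearMap.commute_mulLeft_right F F),
      LinearMap.pow_mulLeft, LinearMap.pow_mulRight]
  | zero => simp
  | add u v _ _ hu hv =>
    rw [map_add, map_add, hu, hv]
    ext y x
    simp [add_mul, mul_add]
    abel
  | smul s u _ hu =>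
    rw [map_smul, map_smul, hu]
    ext y x
    simp [smul_sub]

theorem wt_linear {k A : Type*} [Field k] [AddCommGroup A] [Module k A] {T : Type*}
    [AddCommGroup T] [Module k T] (L : T →ₗ[k] Module.End k A) (e : A) (he : e ≠ 0)
    (h : ∃ χ : T → k, ∀ f, L f e = χ f • e) : ∃ χ : T →ₗ[k] k, ∀ f, L f e = χ f • e := by
  obtain ⟨χ, hχ⟩ := h
  refine ⟨⟨⟨χ, fun f g => ?_⟩, fun s f => ?_⟩, hχ⟩
  · apply smul_left_injective k he
    simp only
    rw [← hχ, add_smul, ← hχ, ← hχ, map_add]; rfl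
  · apply smul_left_injective k he
    simp only
    rw [← hχ, map_smul, LinearMap.smul_apply, hχ, smul_smul]; rfl

namespace Ctc

variable {p : ℕ} {k A : Type*} [Field k] [CommRing A] [Algebra k A] {r : ℕ} (c : Ctc p k A r)

theorem br_mul (f e y : A) : c.br f (e * y) = e * c.D f y + y * c.br f e := by
  rw [br, br, Derivation.leibniz, smul_eq_mul, smul_eq_mul]; ring

noncomputable def J : A →ₗ[k] Module.End k A where
  toFun f := (c.D f).toLinearMap
  map_add' f g := by rw [D_add]; rfl
  map_smul' s g := by rw [D_smul]; rfl

theorem J_apply (f y : A) : c.J f y = c.D f y := rfl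

noncomputable def brL : A →ₗ[k] Module.End k A where
  toFun f :=
    { toFun := fun g => c.br f g
      map_add' := fun x y => by rw [br, br, br, map_add]; ring
      map_smul' := fun s x => by
        rw [br, br, Derivation.map_smul, mul_smul_comm, RingHom.id_apply, smul_sub] }
  map_add' f g := by
    ext x
    change c.br _ _ = c.br _ _ + c.br _ _
    rw [br, br, br, D_add, map_add, Derivation.add_apply]; ring
  map_smul' s f := by
    ext x
    change c.br _ _ = s • c.br _ _
    rw [br, br, D_smul, Derivation.map_smul, Derivation.smul_apply, smul_sub, mul_smul_comm,
      smul_mul_assoc]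

theorem brL_apply (f g : A) : c.brL f g = c.br f g := rfl

theorem J_br (f g : A) : c.J (c.br f g) = c.J f * c.J g - c.J g * c.J f := by
  ext y
  rw [J_apply, ← lie_D, Derivation.commutator_apply]; rfl

theorem J_inj (h2 : (2 : k) ≠ 0) : Function.Injective c.J := by
  rw [injective_iff_map_eq_zero]
  intro f hf
  apply c.D_inj h2
  ext y
  exact congrArg (fun E : A →ₗ[k] A => E y) hf

theorem J_aeval (f : A) (P : Polynomial k) (g : A) :
    c.J (Polynomial.aeval (c.brL f) P g) =
      Polynomial.aeval (LinearMap.mulLeft k (c.J f) - LinearMap.mulRight k (c.J f)) P (c.J g) := by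
  have hpow : ∀ n : ℕ, c.J ((c.brL f ^ n) g) =
      ((LinearMap.mulLeft k (c.J f) - LinearMap.mulRight k (c.J f)) ^ n) (c.J g) := by
    intro n
    induction n with
    | zero => simp
    | succ n ih =>
      rw [pow_succ', pow_succ', Module.End.mul_apply, Module.End.mul_apply, ← ih, brL_apply, J_br]
      simp
  induction P using Polynomial.induction_on' with
  | add P Q hP hQ =>
    rw [map_add, map_add, LinearMap.add_apply, LinearMap.add_apply, map_add, hP, hQ]
  | monomial n s =>
    rw [Polynomial.aeval_monomial, Polynomial.aeval_monomial]
    rw [Module.End.mul_apply, Module.End.mul_apply, ← hpow, Module.algebraMap_end_apply,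
      Module.algebraMap_end_apply, map_smul]

/-- the hypotheses on a torus -/
structure Tor (T : Submodule k A) : Prop where
  hp : p.Prime
  hp3 : 3 ≤ p
  hr : 1 ≤ r
  h1 : ∀ f ∈ T, c.J f ∈ Submodule.span k
    {z : Module.End k A | ∃ m : ℕ, 1 ≤ m ∧ z = (c.J f) ^ (p ^ m)}
  h2 : ∀ f ∈ T, ∃ f' ∈ T, c.J f' = (c.J f) ^ p
  h3 : ∀ φ, c.tau φ = 0 → (∀ f ∈ T, c.br f φ = 0) → φ ∈ T
  h4 : ∀ f ∈ T, ∀ g ∈ T, c.br f g = 0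

namespace Tor
variable {c} {T : Submodule k A} (t : c.Tor T)
include t

theorem two_ne [CharP k p] : (2 : k) ≠ 0 := by
  intro h
  have : ((2 : ℕ) : k) = 0 := by exact_mod_cast h
  rw [CharP.cast_eq_zero_iff k p] at this
  have := Nat.le_of_dvd (by norm_num) this
  have := t.hp3
  omega

theorem nontriv : Nontrivial A := by
  have := c.rank
  have h := t.hp.pos
  exact Module.nontrivial_of_finrank_pos (R := k) (by rw [this]; positivity)

theorem ss_D [CharP k p] {f : A} (hf : f ∈ T) :
    ∃ P : Polynomial k, Squarefree P ∧ Polynomial.aeval (c.J f) P = 0 := by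
  obtain ⟨P, h1, h2, -⟩ := aux_semisimple (c.J f) (t.h1 f hf)
  exact ⟨P, h1, h2⟩

theorem ss_br [CharP k p] {f : A} (hf : f ∈ T) :
    ∃ P : Polynomial k, Squarefree P ∧ Polynomial.aeval (c.brL f) P = 0 := by
  obtain ⟨P, h1, h2, Q, rfl, hQ⟩ := aux_semisimple (c.J f) (t.h1 f hf)
  refine ⟨_, h1, ?_⟩
  have := t.nontriv
  ext g
  apply c.J_inj t.two_ne
  rw [J_aeval, map_sub, aux_ad t.hp _ _ hQ, Polynomial.aeval_X]
  rw [map_sub, Polynomial.aeval_X, sub_eq_zero] at h2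
  rw [← h2, sub_self]
  simp

theorem comm_D {f g : A} (hf : f ∈ T) (hg : g ∈ T) : Commute (c.J f) (c.J g) := by
  have := c.J_br f g
  rw [t.h4 f hf g hg, map_zero] at this
  exact (sub_eq_zero.1 this.symm)

theorem comm_br [CharP k p] {f g : A} (hf : f ∈ T) (hg : g ∈ T) :
    Commute (c.brL f) (c.brL g) := by
  change _ * _ = _ * _
  ext x
  apply c.J_inj t.two_ne
  have := t.comm_D hf hg
  rw [Module.End.mul_apply, Module.End.mul_apply, brL_apply, brL_apply, brL_apply, brL_apply,
    J_br, J_br, J_br, J_br]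
  simp only [mul_sub, sub_mul, ← mul_assoc]
  rw [this.eq]
  simp only [mul_assoc]
  rw [this.eq]
  abel

theorem span_D [CharP k p] [IsAlgClosed k] :
    Submodule.span k {v : A | ∃ χ : T → k, ∀ f : T, c.D f v = χ f • v} = ⊤ := by
  have := c.fin
  exact aux_diag (fun f : T => c.J f) (fun f g => t.comm_D f.2 g.2) (fun f => t.ss_D f.2)

theorem span_br [CharP k p] [IsAlgClosed k] :
    Submodule.span k {v : A | ∃ χ : T → k, ∀ f : T, c.br f v = χ f • v} = ⊤ := by
  have := c.fin
  exact aux_diag (fun f : T => c.brL f) (fun f g => t.comm_br f.2 g.2) (fun f => t.ss_br f.2)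

theorem span_D1 [CharP k p] [IsAlgClosed k] {f : A} (hf : f ∈ T) :
    Submodule.span k {v : A | ∃ s : k, c.D f v = s • v} = ⊤ := by
  rw [eq_top_iff, ← t.span_D]
  apply Submodule.span_mono
  rintro v ⟨χ, h⟩
  exact ⟨χ ⟨f, hf⟩, h ⟨f, hf⟩⟩

theorem exists_unit [CharP k p] [IsAlgClosed k] :
    ∃ e : A, c.eps e ≠ 0 ∧ ∃ χ : T →ₗ[k] k, ∀ f : T, c.br f e = χ f • e := by
  obtain ⟨e, he, h⟩ : ∃ e : A, c.eps e ≠ 0 ∧ ∃ χ : T → k, ∀ f : T, c.br f e = χ f • e := by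
    by_contra! hcon
    have : Submodule.span k {v : A | ∃ χ : T → k, ∀ f : T, c.br f v = χ f • v} ≤
        LinearMap.ker c.eps.toLinearMap := by
      rw [Submodule.span_le]
      rintro v ⟨χ, h⟩
      by_contra h0
      obtain ⟨f, hf⟩ := hcon v h0 χ
      exact hf (h f)
    rw [t.span_br] at this
    have h1 : c.eps 1 = 0 := this (Submodule.mem_top : (1 : A) ∈ ⊤)
    simp at h1
  refine ⟨e, he, wt_linear (c.brL.comp T.subtype) e ?_ h⟩
  rintro rfl
  simp at he

end Tor
end Ctc

namespace Ctc

variable {p : ℕ} {k A : Type*} [Field k] [CommRing A] [Algebra k A] {r : ℕ} {c : Ctc p k A r}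

theorem D_pow (f : A) (m : ℕ) (y : A) :
    c.D (f ^ (m + 1)) y = (m + 1) * f ^ m * c.D f y - 2 * m * f ^ (m + 1) * c.d y := by
  induction m with
  | zero => simp
  | succ m ih =>
    rw [pow_succ, D_mul, ih]; push_cast; ring

namespace Tor
variable {T : Submodule k A} (t : c.Tor T)
include t

theorem natCast_p [CharP k p] : (p : A) = 0 := by
  have : ((p : k) : k) = 0 := CharP.cast_eq_zero k p
  have h := congrArg (algebraMap k A) this
  rwa [map_natCast, map_zero] at h

theorem core [CharP k p] [IsAlgClosed k] (f0 g : A) (hf0 : ∀ f ∈ T, c.br f f0 = 0)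
    (hg : g ∈ T) (hg0 : g ≠ 0) (hgm : c.eps g = 0)
    (himp : f0 ^ (p - 1) * (g * g) = 0 → g * g = 0)
    (htau : c.tau (f0 ^ (p - 1) * (g * g)) = 0) : False := by
  obtain ⟨q, hq⟩ : ∃ q, p = q + 2 := ⟨p - 2, by have := t.hp3; omega⟩
  have hpA : (q : A) + 2 = 0 := by
    have := t.natCast_p
    rw [hq] at this; exact_mod_cast this
  rw [show p - 1 = q + 1 by omega] at himp htau
  have e0 : ∀ E : Derivation k A A, E (f0 ^ (q + 1) * (g * g)) =
      (q + 1) * f0 ^ q * E f0 * (g * g) + f0 ^ (q + 1) * (2 * g * E g) := by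
    intro E
    rw [Derivation.leibniz, Derivation.leibniz, Derivation.leibniz_pow]
    simp only [smul_eq_mul, nsmul_eq_mul, Nat.add_sub_cancel]
    push_cast; ring
  have hφT : f0 ^ (q + 1) * (g * g) ∈ T := by
    refine t.h3 _ htau fun f hf => ?_
    have h1 : c.D f f0 = 2 * c.d f * f0 := sub_eq_zero.1 (hf0 f hf)
    have h2 : c.D f g = 2 * c.d f * g := sub_eq_zero.1 (t.h4 f hf g hg)
    rw [br, e0, h1, h2]
    linear_combination (2 * c.d f * f0 ^ (q + 1) * g ^ 2) * hpA
  have e1 : ∀ y, c.D (f0 ^ (q + 1) * (g * g)) y = g * (2 * f0 ^ (q + 1) * c.D g y +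
      g * ((q + 1) * f0 ^ q * c.D f0 y - 2 * (q + 2) * f0 ^ (q + 1) * c.d y)) := by
    intro y
    rw [D_mul, D_mul, D_pow]; ring
  have hgg : c.D g g = 2 * c.d g * g := sub_eq_zero.1 (c.br_self g)
  have e2 : ∃ w, c.D (f0 ^ (q + 1) * (g * g)) g = g ^ 2 * w := by
    rw [e1, hgg]
    exact ⟨_, by rw [show ∀ x : A, g * (2 * f0 ^ (q + 1) * (2 * c.d g * g) + g * x) =
      g ^ 2 * (2 * f0 ^ (q + 1) * (2 * c.d g) + x) by intro x; ring]⟩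
  obtain ⟨w, hw⟩ := e2
  have hnil : ∀ y, ∀ n, ∃ u, (c.D (f0 ^ (q + 1) * (g * g)) : A → A)^[n] y = g ^ n * u := by
    intro y n
    induction n with
    | zero => exact ⟨y, by simp⟩
    | succ n ih =>
      obtain ⟨u, hu⟩ := ih
      rw [Function.iterate_succ_apply', hu, Derivation.leibniz, Derivation.leibniz_pow, hw, e1 u]
      rcases n with _ | n
      · exact ⟨_, by simp; rfl⟩
      · simp only [smul_eq_mul, nsmul_eq_mul, Nat.add_sub_cancel]
        refine ⟨2 * f0 ^ (q + 1) * c.D g u +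
          g * ((q + 1) * f0 ^ q * c.D f0 u - 2 * (q + 2) * f0 ^ (q + 1) * c.d u)
          + u * (((n + 1 : ℕ) : A) * w), ?_⟩
        ring
  have hJ : c.J (f0 ^ (q + 1) * (g * g)) = 0 := by
    refine eq_zero_of_nilp _ (t.span_D1 hφT) ⟨p, fun y => ?_⟩
    obtain ⟨u, hu⟩ := hnil y p
    rw [c.pow_p t.hp hgm, zero_mul] at hu
    exact hu
  have hφ0 := c.J_inj t.two_ne (hJ.trans (map_zero _).symm)
  exact c.final_step t.hp t.two_ne g hg0 (himp hφ0) (t.span_D1 hg)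

theorem step3' [CharP k p] [IsAlgClosed k] (f0 : A) (hf0 : ∀ f ∈ T, c.br f f0 = 0)
    (l : T →ₗ[k] k) (hl : ∀ g : T, l g = 0 → c.eps g = 0 ∧
      (f0 ^ (p - 1) * (g * g : A) = 0 → (g * g : A) = 0)) : Module.finrank k T ≤ 2 := by
  have := c.fin
  by_contra! hd
  have h1 := LinearMap.finrank_range_add_finrank_ker l
  have h2 : Module.finrank k (LinearMap.range l) ≤ 1 := by
    simpa using Submodule.finrank_le (LinearMap.range l)
  have h3 : 1 < Module.finrank k (LinearMap.ker l) := by omega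
  have : Nontrivial (LinearMap.ker l) := Module.nontrivial_of_finrank_pos (R := k) (by omega)
  obtain ⟨g₁, hg₁⟩ := exists_ne (0 : LinearMap.ker l)
  obtain ⟨g₂, hg₂⟩ := exists_linearIndependent_pair_of_one_lt_finrank (R := k) (M := LinearMap.ker l) h3 hg₁
  let B0 : A →ₗ[k] A →ₗ[k] k := (LinearMap.mul k A).compr₂
    (c.tau.comp (LinearMap.mulLeft k (f0 ^ (p - 1))))
  let ι : LinearMap.ker l →ₗ[k] A := T.subtype.comp (LinearMap.ker l).subtype
  have hB0 : ∀ x y, B0 x y = c.tau (f0 ^ (p - 1) * (x * y)) := fun x y => rfl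
  obtain ⟨s, u, hne, hB⟩ := aux_isotropic (B0.compl₁₂ ι ι)
    (fun x y => by rw [LinearMap.compl₁₂_apply, LinearMap.compl₁₂_apply, hB0, hB0, mul_comm (ι x)])
    g₁ g₂ hg₂
  set g := s • g₁ + u • g₂ with hg
  rw [LinearMap.compl₁₂_apply, hB0] at hB
  obtain ⟨h4, h5⟩ := hl g.1 g.2
  exact t.core f0 (ι g) hf0 g.1.2 (fun h => hne (Subtype.ext (Subtype.ext h))) h4 h5 hB

theorem step3 [CharP k p] [IsAlgClosed k] : Module.finrank k T ≤ 2 := by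
  by_cases hC : ∃ e, c.eps e ≠ 0 ∧ ∀ f ∈ T, c.br f e = 0
  · obtain ⟨e, he, hf⟩ := hC
    refine t.step3' e hf (c.eps.toLinearMap.comp T.subtype) fun g hg => ⟨hg, fun h => ?_⟩
    exact ((c.isUnit_of t.hp he).pow _).mul_right_eq_zero.1 h
  · push Not at hC
    have hCm : ∀ f, (∀ g ∈ T, c.br g f = 0) → c.eps f = 0 := by
      intro f hf
      by_contra h
      obtain ⟨g, hg, h'⟩ := hC f h
      exact h' (hf g hg)
    obtain ⟨e, he, μ, hμ⟩ := t.exists_unit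
    obtain ⟨f1, hf1⟩ : ∃ f, μ f ≠ 0 := by
      by_contra! h
      obtain ⟨g, hg, h'⟩ := hC e he
      exact h' (by rw [hμ ⟨g, hg⟩, h, zero_smul])
    set f0 : T := (μ f1)⁻¹ • f1 with hf0
    have hμ0 : μ f0 = 1 := by rw [hf0, map_smul, smul_eq_mul, inv_mul_cancel₀ hf1]
    refine t.step3' f0 (fun f hf => t.h4 f hf _ f0.2) μ fun g hg =>
      ⟨hCm _ fun f hf => t.h4 f hf _ g.2, ?_⟩
    have hDe : ∀ f : T, c.D e f = - (μ f • e) + 2 * (f * c.d e) := by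
      intro f
      have h1 := c.D_symm f e
      have h2 := hμ f
      rw [br] at h2
      linear_combination h1 - h2
    have key : ∀ m, m < p → (f0 : A) ^ m * (g * g : A) = 0 → (g * g : A) = 0 := by
      intro m
      induction m with
      | zero => intro _ h; simpa using h
      | succ m ih =>
        intro hm h
        apply ih (by omega)
        have h1 := congrArg (c.D e) h
        rw [map_zero, Derivation.leibniz, Derivation.leibniz, Derivation.leibniz_pow, hDe, hDe,
          hμ0, hg] at h1
        simp only [smul_eq_mul, nsmul_eq_mul, Nat.add_sub_cancel, one_smul, zero_smul] at h1
        push_cast at h1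
        have h2 : e * (((m : A) + 1) * ((f0 : A) ^ m * (g * g : A))) = 0 := by
          linear_combination (-1 : A) * h1 + (4 + 2 * ((m : A) + 1)) * c.d e * h
        have h3 := (c.isUnit_of t.hp he).mul_right_eq_zero.1 h2
        have h4 : ((m + 1 : ℕ) : k) • ((f0 : A) ^ m * (g * g : A)) = 0 := by
          rw [Algebra.smul_def, map_natCast]; push_cast; exact h3
        refine (smul_eq_zero.1 h4).resolve_left fun h5 => ?_
        rw [CharP.cast_eq_zero_iff k p] at h5
        exact absurd (Nat.le_of_dvd (by omega) h5) (by omega)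
    exact key _ (by have := t.hp3; omega)

end Tor
end Ctc

namespace Ctc

variable {p : ℕ} {k A : Type*} [Field k] [CommRing A] [Algebra k A] {r : ℕ} (c : Ctc p k A r)

noncomputable def grad : A →ₗ[k] (Fin (2 * r + 1) → k) :=
  LinearMap.pi fun i => c.eps.toLinearMap.comp (c.pd i).toLinearMap

theorem grad_apply (y : A) (i) : c.grad y i = c.eps (c.pd i y) := rfl

theorem grad_surj : Function.Surjective c.grad := by
  intro v
  refine ⟨∑ i, v i • c.xs i, ?_⟩
  funext j
  rw [grad_apply, map_sum, map_sum]
  simp only [Derivation.map_smul, c.pdxs, map_smul]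
  simp

theorem exists_coords (W : Set A) (hW : Submodule.span k W = ⊤) :
    ∃ y : Fin (2 * r + 1) → A, (∀ i, y i ∈ W) ∧ LinearIndependent k (fun i => c.grad (y i)) ∧
      Submodule.span k (Set.range fun i => c.grad (y i)) = ⊤ := by
  obtain ⟨b, hbW, hbs, hbl⟩ := exists_linearIndependent k (c.grad '' W)
  have hs : Submodule.span k b = ⊤ := by
    rw [hbs, ← Submodule.map_span, hW, Submodule.map_top, LinearMap.range_eq_top]
    exact c.grad_surj
  let B : Module.Basis b k (Fin (2 * r + 1) → k) :=
    Module.Basis.mk hbl (by rw [Subtype.range_coe_subtype, Set.ofPred_mem_eq, hs])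
  have : Finite b := Module.Finite.finite_basis B
  have := Fintype.ofFinite b
  have hc : Fintype.card b = 2 * r + 1 := by
    rw [← Module.finrank_eq_card_basis B, Module.finrank_fin_fun]
  let σ : Fin (2 * r + 1) ≃ b := (Fintype.equivFinOfCardEq hc).symm
  choose y hyW hy using fun i => hbW (σ i).2
  refine ⟨y, hyW, ?_, ?_⟩
  · simp only [hy]
    exact hbl.comp σ σ.injective
  · simp only [hy]
    rw [← hs]
    congr 1
    ext x
    constructor
    · rintro ⟨i, rfl⟩; exact (σ i).2
    · intro hx; exact ⟨σ.symm ⟨x, hx⟩, by simp⟩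

theorem adjoin_top (hp : p.Prime) (y : Fin (2 * r + 1) → A)
    (hy : Submodule.span k (Set.range fun i => c.grad (y i)) = ⊤) :
    Algebra.adjoin k (Set.range y) = ⊤ := by
  set B := Algebra.adjoin k (Set.range y) with hB
  have hyB : ∀ i, y i ∈ B := fun i => Algebra.subset_adjoin ⟨i, rfl⟩
  have h1 : ∀ v ∈ c.m, ∃ b ∈ B, b ∈ c.m ∧ v - b ∈ c.m ^ 2 := by
    intro v hv
    have : c.grad v ∈ Submodule.span k (Set.range fun i => c.grad (y i)) := by rw [hy]; trivial
    obtain ⟨s, hs⟩ := (Submodule.mem_span_range_iff_exists_fun k).1 this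
    have hbm : ∑ i, s i • (y i - algebraMap k A (c.eps (y i))) ∈ c.m := by
      rw [mem_m, map_sum]
      exact Finset.sum_eq_zero fun i _ => by simp
    refine ⟨∑ i, s i • (y i - algebraMap k A (c.eps (y i))), ?_, hbm, ?_⟩
    · exact Subalgebra.sum_mem _ fun i _ => Subalgebra.smul_mem _
        (Subalgebra.sub_mem _ (hyB i) (Subalgebra.algebraMap_mem _ _)) _
    · refine c.mem_m_sq (Ideal.sub_mem _ hv hbm) fun j => ?_
      have h2 := congrFun hs j
      rw [Finset.sum_apply] at h2
      simp only [Pi.smul_apply, grad_apply] at h2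
      rw [map_sub, map_sub, ← h2, map_sum, map_sum, sub_eq_zero]
      refine Finset.sum_congr rfl fun i _ => ?_
      rw [Derivation.map_smul, map_smul, map_sub, Derivation.map_algebraMap, sub_zero]
  have h2 : ∀ s, ∀ v ∈ c.m ^ s, ∃ b ∈ B, b ∈ c.m ^ s ∧ v - b ∈ c.m ^ (s + 1) := by
    intro s
    induction s with
    | zero =>
      intro v _
      refine ⟨algebraMap k A (c.eps v), Subalgebra.algebraMap_mem _ _, by simp, ?_⟩
      rw [zero_add, pow_one, mem_m]; simp
    | succ s ih =>
      intro z hz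
      rw [pow_succ] at hz
      induction hz using Submodule.mul_induction_on' with
      | mem_mul_mem u hu v hv =>
        obtain ⟨b, hb, hbm, hub⟩ := ih u hu
        obtain ⟨b', hb', hbm', hvb⟩ := h1 v hv
        refine ⟨b * b', Subalgebra.mul_mem _ hb hb', ?_, ?_⟩
        · rw [pow_succ]; exact Ideal.mul_mem_mul hbm hbm'
        · have : u * v - b * b' = (u - b) * v + b * (v - b') := by ring
          rw [this]
          refine Ideal.add_mem _ ?_ ?_
          · rw [pow_succ]; exact Ideal.mul_mem_mul hub hv
          · rw [add_assoc, pow_add]; exact Ideal.mul_mem_mul hbm hvb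
      | add u _ v _ hu hv =>
        obtain ⟨b, hb, hbm, hub⟩ := hu
        obtain ⟨b', hb', hbm', hvb⟩ := hv
        refine ⟨b + b', Subalgebra.add_mem _ hb hb', Ideal.add_mem _ hbm hbm', ?_⟩
        rw [show u + v - (b + b') = (u - b) + (v - b') by ring]
        exact Ideal.add_mem _ hub hvb
  have h3 : ∀ s z, ∃ b ∈ B, z - b ∈ c.m ^ s := by
    intro s z
    induction s with
    | zero => exact ⟨0, Subalgebra.zero_mem _, by simp⟩
    | succ s ih =>
      obtain ⟨b, hb, h⟩ := ih
      obtain ⟨b', hb', -, h'⟩ := h2 s _ h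
      exact ⟨b + b', Subalgebra.add_mem _ hb hb', by rwa [← sub_sub]⟩
  obtain ⟨N, hN⟩ := c.m_nilp hp
  rw [eq_top_iff]
  intro z _
  obtain ⟨b, hb, h⟩ := h3 N z
  rw [hN] at h
  rw [sub_eq_zero.1 h]
  exact hb

/-- monomials in the coordinates `y` -/
noncomputable def mon [NeZero p] (y : Fin (2 * r + 1) → A) (a : Fin (2 * r + 1) → ZMod p) : A :=
  ∏ i, y i ^ (a i).val

include c in
theorem span_mon [hp : Fact p.Prime] (y : Fin (2 * r + 1) → A)
    (hy : Algebra.adjoin k (Set.range y) = ⊤) :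
    Submodule.span k (Set.range (mon (p := p) y)) = ⊤ := by
  classical
  have h1 : Submodule.span k (Submonoid.closure (Set.range y) : Set A) = ⊤ := by
    rw [← Algebra.adjoin_eq_span, hy]; rfl
  rw [eq_top_iff, ← h1, Submodule.span_le]
  intro z hz
  suffices h : ∃ (s : k) (a : _), z = s • mon (p := p) y a by
    obtain ⟨s, a, rfl⟩ := h
    exact Submodule.smul_mem _ _ (Submodule.subset_span ⟨a, rfl⟩)
  have : Fact (1 < p) := ⟨hp.out.one_lt⟩
  induction hz using Submonoid.closure_induction with
  | mem x hx =>
    obtain ⟨i, rfl⟩ := hx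
    refine ⟨1, Pi.single i 1, ?_⟩
    rw [one_smul, mon, Finset.prod_eq_single i]
    · simp [ZMod.val_one]
    · intro j _ hj; simp [hj]
    · simp
  | one => exact ⟨1, 0, by simp [mon]⟩
  | mul u v _ _ hu hv =>
    obtain ⟨s, a, rfl⟩ := hu
    obtain ⟨s', a', rfl⟩ := hv
    have hi : ∀ i, ∃ w : k, y i ^ (a i).val * y i ^ (a' i).val = w • y i ^ (a i + a' i).val := by
      intro i
      refine ⟨(c.eps (y i) ^ p) ^ (((a i).val + (a' i).val) / p), ?_⟩
      rw [← pow_add, ZMod.val_add]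
      conv_lhs => rw [← Nat.div_add_mod ((a i).val + (a' i).val) p, pow_add, pow_mul, c.frob]
      rw [Algebra.smul_def, map_pow, map_pow]
    choose w hw using hi
    refine ⟨s * s' * ∏ i, w i, a + a', ?_⟩
    rw [smul_mul_smul_comm, mul_smul (s * s')]
    congr 1
    simp only [mon]
    rw [← Finset.prod_mul_distrib, Finset.prod_congr rfl fun i _ => hw i]
    simp only [Algebra.smul_def, Finset.prod_mul_distrib, map_prod, Pi.add_apply]

theorem D_mon [NeZero p] [CharP k p] [Algebra (ZMod p) k] (E : Derivation k A A)
    (y : Fin (2 * r + 1) → A)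
    (l : Fin (2 * r + 1) → k) (hl : ∀ i, E (y i) = l i • y i) (a : Fin (2 * r + 1) → ZMod p) :
    E (mon y a) = (∑ i, algebraMap (ZMod p) k (a i) * l i) • mon y a := by
  have hpow : ∀ i (n : ℕ), E (y i ^ n) = ((n : k) * l i) • y i ^ n := by
    intro i n
    induction n with
    | zero => simp
    | succ n ih =>
      rw [pow_succ, Derivation.leibniz, ih, hl]
      simp only [smul_eq_mul]
      simp only [Algebra.smul_def, map_mul, map_natCast, map_add, map_one, Nat.cast_add, Nat.cast_one]
      push_cast
      ring
  have hcast : ∀ z : ZMod p, algebraMap (ZMod p) k z = (z.val : k) := by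
    intro z
    conv_lhs => rw [← ZMod.natCast_zmod_val z, map_natCast]
  simp only [hcast]
  have : ∀ S : Finset (Fin (2 * r + 1)), E (∏ i ∈ S, y i ^ (a i).val) =
      (∑ i ∈ S, ((a i).val : k) * l i) • ∏ i ∈ S, y i ^ (a i).val := by
    classical
    intro S
    induction S using Finset.induction_on with
    | empty => simp
    | insert i S hi ih =>
      rw [Finset.prod_insert hi, Finset.sum_insert hi, Derivation.leibniz, ih, hpow]
      simp only [smul_eq_mul]
      simp only [Algebra.smul_def, map_add]
      ring
  exact this _

namespace Tor
variable {c} {T : Submodule k A} (t : c.Tor T)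
include t

/-- centralizer -/
theorem C_le (C : Submodule k A) (hC : ∀ x ∈ C, ∀ f ∈ T, c.br f x = 0) :
    Module.finrank k C ≤ Module.finrank k T + 1 := by
  have := c.fin
  have h1 := LinearMap.finrank_range_add_finrank_ker (c.tau.comp C.subtype)
  have h2 : Module.finrank k (LinearMap.range (c.tau.comp C.subtype)) ≤ 1 := by
    simpa using Submodule.finrank_le (LinearMap.range (c.tau.comp C.subtype))
  have h3 : Module.finrank k (LinearMap.ker (c.tau.comp C.subtype)) ≤ Module.finrank k T := by
    let ι : LinearMap.ker (c.tau.comp C.subtype) →ₗ[k] T :=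
      LinearMap.codRestrict T (C.subtype.comp (Submodule.subtype _))
        (fun x => t.h3 _ x.2 (hC _ x.1.2))
    refine LinearMap.finrank_le_finrank_of_injective (f := ι) ?_
    intro x y hxy
    exact Subtype.ext (Subtype.ext (congrArg (fun z : T => (z : A)) hxy))
  omega

theorem step4 [CharP k p] [IsAlgClosed k] (hT : T ≠ ⊥) :
    p ^ (2 * r + 1) ≤ p ^ (Module.finrank k T) * (Module.finrank k T + 1) := by
  classical
  have := c.fin
  have : Fact p.Prime := ⟨t.hp⟩
  letI : Algebra (ZMod p) k := ZMod.algebra k p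
  obtain ⟨y, hyW, hyl, hys⟩ := c.exists_coords _ t.span_D
  have hspan := c.span_mon y (c.adjoin_top t.hp y hys)
  have hlin : LinearIndependent k (mon (p := p) y) := by
    refine linearIndependent_of_top_le_span_of_card_eq_finrank hspan.ge ?_
    rw [c.rank]; simp [ZMod.card]
  have hy0 : ∀ i, y i ≠ 0 := by
    intro i h
    apply hyl.ne_zero i
    simp only [h, map_zero]
  have hlam : ∀ i, ∃ χ : T →ₗ[k] k, ∀ f : T, c.D f (y i) = χ f • y i := fun i =>
    wt_linear (c.J.comp T.subtype) (y i) (hy0 i) (hyW i)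
  choose lam hlam using hlam
  choose π hπT hπ using t.h2
  have hl : ∀ i (x : T), lam i ⟨π x.1 x.2, hπT _ _⟩ = lam i x ^ p := by
    intro i x
    apply smul_left_injective k (hy0 i)
    simp only
    rw [← hlam, ← J_apply, hπ]
    have : ∀ n : ℕ, (c.J x ^ n) (y i) = lam i x ^ n • y i := by
      intro n
      induction n with
      | zero => simp
      | succ n ih =>
        rw [pow_succ', Module.End.mul_apply, ih, map_smul, J_apply, hlam, smul_smul, pow_succ]
    exact this p
  obtain ⟨e, he, μ, hμ⟩ := t.exists_unit
  have hu := c.isUnit_of t.hp he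
  have hD : ∀ (f : T) a, c.D f (mon y a) = (∑ i, algebraMap (ZMod p) k (a i) * lam i f) • mon y a :=
    fun f a => D_mon (c.D f) y (fun i => lam i f) (fun i => hlam i f) a
  obtain ⟨f, hfT, hf0⟩ := Submodule.exists_mem_ne_zero_of_ne_bot hT
  obtain ⟨b, hb⟩ := hu.dvd (a := f)
  have hbs : b ∈ Submodule.span k (Set.range (mon (p := p) y)) := by rw [hspan]; trivial
  obtain ⟨s, hs⟩ := (Submodule.mem_span_range_iff_exists_fun k).1 hbs
  obtain ⟨a₀, ha₀⟩ : ∃ a, s a ≠ 0 := by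
    by_contra! h
    apply hf0
    rw [hb, ← hs]
    simp [h]
  have hw : ∀ x : T, ∑ i, algebraMap (ZMod p) k (a₀ i) * lam i x = - μ x := by
    intro x
    have h1 := t.h4 x x.2 f hfT
    rw [hb, br_mul, hμ, mul_smul_comm, mul_comm b e, ← mul_smul_comm, ← mul_add] at h1
    have h2 := hu.mul_right_eq_zero.1 h1
    rw [← hs, map_sum, Finset.smul_sum, ← Finset.sum_add_distrib] at h2
    have h3 : ∑ a, (s a * ((∑ i, algebraMap (ZMod p) k (a i) * lam i x) + μ x)) •
        mon (p := p) y a = 0 := by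
      rw [← h2]
      refine Finset.sum_congr rfl fun a _ => ?_
      rw [Derivation.map_smul, hD, smul_smul, smul_smul, ← add_smul]
      congr 1; ring
    have h4 := Fintype.linearIndependent_iff.1 hlin _ h3 a₀
    exact eq_neg_of_add_eq_zero_left ((mul_eq_zero.1 h4).resolve_left ha₀)
  have hcount := aux_count (fun x : T => (⟨π x.1 x.2, hπT _ _⟩ : T)) (2 * r + 1) lam hl
    (fun x => - μ x) a₀ hw
  refine hcount.trans (Nat.mul_le_mul_left _ ?_)
  set F := {a : Fin (2 * r + 1) → ZMod p //
    ∀ x : T, ∑ i, algebraMap (ZMod p) k (a i) * lam i x = - μ x}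
  have hF : LinearIndependent k (fun a : F => e * mon (p := p) y a.1) := by
    have h1 : LinearIndependent k (fun a : F => mon (p := p) y a.1) :=
      hlin.comp _ Subtype.val_injective
    refine h1.map' (LinearMap.mulLeft k e) ?_
    rw [LinearMap.ker_eq_bot']
    intro z hz
    exact hu.mul_right_eq_zero.1 hz
  have hfin := finrank_span_eq_card hF
  rw [Nat.card_eq_fintype_card, ← hfin]
  refine t.C_le _ ?_
  intro x hx g hg
  induction hx using Submodule.span_induction with
  | mem z hz =>
    obtain ⟨a, rfl⟩ := hz
    have h1 := hD ⟨g, hg⟩ a.1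
    have h2 := hμ ⟨g, hg⟩
    simp only at h1 h2
    rw [br_mul, h1, h2, a.2 ⟨g, hg⟩, mul_smul_comm, mul_smul_comm, mul_comm, ← add_smul]
    simp
  | zero => rw [← brL_apply, map_zero]
  | add u v _ _ hu hv => rw [← brL_apply, map_add, brL_apply, brL_apply, hu, hv, add_zero]
  | smul s u _ hu => rw [← brL_apply, map_smul, brL_apply, hu, smul_zero]

theorem main [CharP k p] [IsAlgClosed k] : p = 3 ∧ r = 1 := by
  have := c.fin
  have hp3 := t.hp3
  have hr := t.hr
  have h27 : p ^ 3 ≤ p ^ (2 * r + 1) := Nat.pow_le_pow_right (by omega) (by omega)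
  have hT : T ≠ ⊥ := by
    intro h
    have h1 := t.C_le ⊤ (by
      intro x _ f hf
      rw [h, Submodule.mem_bot] at hf
      rw [hf, ← brL_apply, map_zero]; rfl)
    rw [finrank_top, c.rank, h, finrank_bot] at h1
    nlinarith [pow_le_pow_left₀ (by norm_num) hp3 3]
  have h1 := t.step3
  have h2 := t.step4 hT
  have h0 : Module.finrank k T ≠ 0 := fun h => hT (Submodule.finrank_eq_zero.1 h)
  obtain h | h : Module.finrank k T = 1 ∨ Module.finrank k T = 2 := by omega
  · rw [h, pow_one] at h2
    have h5 : p ^ 3 = p * (p * p) := by ring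
    have h6 : p * (p * p) ≤ p * 2 := by omega
    have := Nat.le_of_mul_le_mul_left h6 (by omega)
    nlinarith
  · rw [h] at h2
    have hr1 : r = 1 := by
      by_contra hne
      have : p ^ 5 ≤ p ^ (2 * r + 1) := Nat.pow_le_pow_right (by omega) (by omega)
      have h5 : p ^ 5 = p ^ 3 * p ^ 2 := by ring
      have h6 : 27 ≤ p ^ 3 := by simpa using pow_le_pow_left₀ (by norm_num) hp3 3
      nlinarith [sq_nonneg p]
    refine ⟨?_, hr1⟩
    have h5 : p ^ 3 = p * p ^ 2 := by ring
    have h6 : p * p ^ 2 ≤ 3 * p ^ 2 := by omega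
    have := Nat.le_of_mul_le_mul_right h6 (by positivity)
    omega

end Tor
end Ctc

section TP
variable (p : ℕ) (k : Type*) [Field k] (n : ℕ)

theorem tp_coeff {f : MvPolynomial (Fin n) k} (hf : f ∈ truncIdeal p k n) :
    ∀ e : Fin n →₀ ℕ, (∀ i, e i < p) → MvPolynomial.coeff e f = 0 := by
  induction hf using Submodule.span_induction with
  | mem x hx =>
    obtain ⟨j, rfl⟩ := hx
    intro e he
    rw [MvPolynomial.coeff_X_pow, if_neg]
    rintro rfl
    simpa using he j
  | zero => intro e _; simp
  | add x y _ _ hx hy => intro e he; rw [MvPolynomial.coeff_add, hx e he, hy e he, add_zero]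
  | smul a x _ hx =>
    intro e he
    rw [smul_eq_mul, MvPolynomial.coeff_mul]
    refine Finset.sum_eq_zero fun q hq => ?_
    rw [hx, mul_zero]
    intro i
    have := DFunLike.congr_fun (Finset.HasAntidiagonal.mem_antidiagonal.1 hq) i
    have h2 := he i
    simp only [Finsupp.add_apply] at this
    omega

noncomputable def tpE (a : Fin n → Fin p) : Fin n →₀ ℕ :=
  Finsupp.equivFunOnFinite.symm fun i => (a i : ℕ)

theorem tpE_apply (a : Fin n → Fin p) (i) : tpE p n a i = a i := rfl

noncomputable def tpCoeff (a : Fin n → Fin p) : TruncPoly p k n →ₗ[k] k :=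
  Submodule.liftQ ((truncIdeal p k n).restrictScalars k) (MvPolynomial.lcoeff k (tpE p n a))
    (fun _ hf => tp_coeff p k n hf _ fun i => (a i).2)

theorem tpCoeff_mk (a : Fin n → Fin p) (f : MvPolynomial (Fin n) k) :
    tpCoeff p k n a (Ideal.Quotient.mk _ f) = MvPolynomial.coeff (tpE p n a) f := rfl

noncomputable def tpM (a : Fin n → Fin p) : TruncPoly p k n :=
  Ideal.Quotient.mk _ (MvPolynomial.monomial (tpE p n a) 1)

theorem tpCoeff_M (a b : Fin n → Fin p) :
    tpCoeff p k n a (tpM p k n b) = if a = b then 1 else 0 := by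
  rw [tpM, tpCoeff_mk, MvPolynomial.coeff_monomial]
  have : tpE p n b = tpE p n a ↔ a = b := by
    constructor
    · intro h
      funext i
      have := DFunLike.congr_fun h i
      exact Fin.ext this.symm
    · rintro rfl; rfl
  simp only [this]

theorem tp_smul (s : k) (f : MvPolynomial (Fin n) k) :
    (Ideal.Quotient.mk (truncIdeal p k n) (s • f)) = s • Ideal.Quotient.mk (truncIdeal p k n) f :=
  rfl

theorem tp_span : Submodule.span k (Set.range (tpM p k n)) = ⊤ := by
  rw [eq_top_iff]
  intro y _
  obtain ⟨f, rfl⟩ := Ideal.Quotient.mk_surjective y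
  rw [MvPolynomial.as_sum f, map_sum]
  refine Submodule.sum_mem _ fun e _ => ?_
  rw [← mul_one (MvPolynomial.coeff e f), ← smul_eq_mul, ← MvPolynomial.smul_monomial, tp_smul]
  refine Submodule.smul_mem _ _ ?_
  by_cases he : ∀ i, e i < p
  · refine Submodule.subset_span ⟨fun i => ⟨e i, he i⟩, ?_⟩
    rw [tpM]
    have h : tpE p n (fun i => ⟨e i, he i⟩) = e := by ext i; rfl
    rw [h]
  · push Not at he
    obtain ⟨i, hi⟩ := he
    have : Ideal.Quotient.mk (truncIdeal p k n) (MvPolynomial.monomial e 1) = 0 := by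
      rw [Ideal.Quotient.eq_zero_iff_mem]
      have h : e = (e - Finsupp.single i p) + Finsupp.single i p := by
        rw [tsub_add_cancel_of_le]
        exact Finsupp.single_le_iff.2 hi
      rw [h, ← mul_one (1 : k), ← MvPolynomial.monomial_mul,
        ← MvPolynomial.X_pow_eq_monomial]
      exact Ideal.mul_mem_left _ _ (Ideal.subset_span ⟨i, rfl⟩)
    rw [this]; exact Submodule.zero_mem _

theorem tp_linInd : LinearIndependent k (tpM p k n) := by
  rw [Fintype.linearIndependent_iff]
  intro g hg a
  have := congrArg (tpCoeff p k n a) hg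
  rw [map_sum, map_zero] at this
  simpa [tpCoeff_M] using this

noncomputable def tpBasis : Module.Basis (Fin n → Fin p) k (TruncPoly p k n) :=
  Module.Basis.mk (tp_linInd p k n) (tp_span p k n).ge

theorem tp_sum (y : TruncPoly p k n) : y = ∑ a, tpCoeff p k n a y • tpM p k n a := by
  have h : y ∈ Submodule.span k (Set.range (tpM p k n)) := by rw [tp_span]; trivial
  obtain ⟨s, hs⟩ := (Submodule.mem_span_range_iff_exists_fun k).1 h
  have : ∀ a, tpCoeff p k n a y = s a := by
    intro a
    rw [← hs, map_sum]
    simp [tpCoeff_M]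
  simp only [this, hs]

theorem tp_fin : FiniteDimensional k (TruncPoly p k n) := (tpBasis p k n).finiteDimensional_of_finite

theorem tp_rank : Module.finrank k (TruncPoly p k n) = p ^ n := by
  rw [Module.finrank_eq_card_basis (tpBasis p k n)]; simp

variable [CharP k p]

theorem tp_pd_mk (i : Fin n) (f : MvPolynomial (Fin n) k) :
    truncPD p k n i (Ideal.Quotient.mk _ f) = Ideal.Quotient.mk _ (MvPolynomial.pderiv i f) := rfl

theorem tp_pd_X (i j : Fin n) : truncPD p k n i (truncX p k n j) = if i = j then 1 else 0 := by
  rw [truncX, tp_pd_mk, MvPolynomial.pderiv_X, Pi.single_apply]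
  split_ifs with h1 h2 h2
  · simp
  · exact absurd h1.symm h2
  · exact absurd h2.symm h1
  · simp

theorem tp_ind {P : TruncPoly p k n → Prop} (hC : ∀ s : k, P (algebraMap k _ s))
    (hadd : ∀ x y, P x → P y → P (x + y)) (hX : ∀ x i, P x → P (x * truncX p k n i)) (y) : P y := by
  obtain ⟨f, rfl⟩ := Ideal.Quotient.mk_surjective y
  induction f using MvPolynomial.induction_on with
  | C s => exact hC s
  | add f g hf hg => rw [map_add]; exact hadd _ _ hf hg
  | mul_X f i hf => rw [map_mul]; exact hX _ _ hf

theorem tp_ext (D D' : Derivation k (TruncPoly p k n) (TruncPoly p k n))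
    (h : ∀ i, D (truncX p k n i) = D' (truncX p k n i)) : D = D' := by
  ext y
  induction y using tp_ind with
  | hC s => rw [Derivation.map_algebraMap, Derivation.map_algebraMap]
  | hadd x y hx hy => rw [map_add, map_add, hx, hy]
  | hX x i hx => rw [Derivation.leibniz, Derivation.leibniz, hx, h]

theorem tp_comm (i j : Fin n) (y) :
    truncPD p k n i (truncPD p k n j y) = truncPD p k n j (truncPD p k n i y) := by
  have : ⁅truncPD p k n i, truncPD p k n j⁆ = 0 := by
    apply tp_ext
    intro l
    rw [Derivation.commutator_apply, tp_pd_X, tp_pd_X]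
    split_ifs <;> simp
  have h := congrArg (fun D => D y) this
  rw [Derivation.commutator_apply] at h
  exact sub_eq_zero.1 h

theorem tp_X_pow (i : Fin n) : truncX p k n i ^ p = 0 := by
  rw [truncX, ← map_pow, Ideal.Quotient.eq_zero_iff_mem]
  exact Ideal.subset_span ⟨i, rfl⟩

noncomputable def tpEps (hp : p ≠ 0) : TruncPoly p k n →ₐ[k] k :=
  Ideal.Quotient.liftₐ (truncIdeal p k n) (MvPolynomial.aeval (fun _ => (0 : k))) (by
    intro f hf
    have : truncIdeal p k n ≤ RingHom.ker (MvPolynomial.aeval (fun _ : Fin n => (0 : k))) := by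
      rw [Ideal.span_le]
      rintro _ ⟨i, rfl⟩
      simp [RingHom.mem_ker, hp]
    exact this hf)

theorem tpEps_X (hp : p ≠ 0) (i) : tpEps p k n hp (truncX p k n i) = 0 := by
  rw [truncX, tpEps]
  erw [Ideal.Quotient.lift_mk]
  simp

theorem tp_frob (hp : p.Prime) (y : TruncPoly p k n) :
    y ^ p = algebraMap k _ (tpEps p k n hp.ne_zero y) ^ p := by
  have : Nontrivial (TruncPoly p k n) := (tpEps p k n hp.ne_zero).toRingHom.domain_nontrivial
  have : CharP (TruncPoly p k n) p :=
    charP_of_injective_algebraMap (algebraMap k (TruncPoly p k n)).injective p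
  have : Fact p.Prime := ⟨hp⟩
  induction y using tp_ind with
  | hC s => rw [AlgHom.commutes]; rfl
  | hadd x y hx hy => rw [add_pow_char, hx, hy, map_add, map_add, add_pow_char]
  | hX x i hx => rw [mul_pow, tp_X_pow, map_mul, tpEps_X, mul_zero, mul_zero, map_zero,
      zero_pow hp.ne_zero]

theorem tp_taylor (hp : p.Prime) (y : TruncPoly p k n) :
    y - algebraMap k _ (tpEps p k n hp.ne_zero y) - ∑ i, tpEps p k n hp.ne_zero (truncPD p k n i y) •
      truncX p k n i ∈ (RingHom.ker (tpEps p k n hp.ne_zero)) ^ 2 := by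
  induction y using tp_ind with
  | hC s => simp
  | hadd x y hx hy =>
    have := Ideal.add_mem _ hx hy
    convert this using 1
    simp only [map_add, add_smul, Finset.sum_add_distrib]
    ring
  | hX x i hx =>
    have h1 : ∑ j, tpEps p k n hp.ne_zero (truncPD p k n j (x * truncX p k n i)) •
        truncX p k n j = tpEps p k n hp.ne_zero x • truncX p k n i := by
      rw [Finset.sum_eq_single i]
      · rw [Derivation.leibniz, tp_pd_X, if_pos rfl, smul_eq_mul, smul_eq_mul, map_add, map_mul,
          map_mul, tpEps_X]; simp
      · intro j _ hj
        rw [Derivation.leibniz, tp_pd_X, if_neg hj, smul_eq_mul, smul_eq_mul, map_add, map_mul,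
          map_mul, tpEps_X]; simp
      · simp
    have h2 : tpEps p k n hp.ne_zero x • truncX p k n i =
        algebraMap k _ (tpEps p k n hp.ne_zero x) * truncX p k n i := by
      exact @Algebra.smul_def k (TruncPoly p k n) _ _ _ _ _
    rw [h1, map_mul, tpEps_X, mul_zero, map_zero, sub_zero, h2, ← sub_mul, pow_two]
    refine Ideal.mul_mem_mul ?_ ?_
    · rw [RingHom.mem_ker, map_sub, AlgHom.commutes]; simp
    · exact tpEps_X p k n _ i

theorem tp_mem (hp : p.Prime) (S : Submodule k (TruncPoly p k n))
    (hS : ∀ i y, truncPD p k n i y ∈ S) (y : TruncPoly p k n)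
    (hy : tpCoeff p k n (fun _ => ⟨p - 1, by have := hp.pos; omega⟩) y = 0) : y ∈ S := by
  rw [tp_sum p k n y]
  refine Submodule.sum_mem _ fun a _ => ?_
  by_cases ha : a = fun _ => ⟨p - 1, by have := hp.pos; omega⟩
  · rw [ha, hy, zero_smul]; exact Submodule.zero_mem _
  · refine Submodule.smul_mem _ _ ?_
    obtain ⟨i, hi⟩ := Function.ne_iff.1 ha
    have hi' : (a i : ℕ) + 1 < p := by
      have h1 := (a i).2
      have h2 : (a i : ℕ) ≠ p - 1 := fun h => hi (Fin.ext h)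
      omega
    have hne : (((a i : ℕ) + 1 : ℕ) : k) ≠ 0 := by
      rw [Ne, CharP.cast_eq_zero_iff k p]
      intro h
      exact absurd (Nat.le_of_dvd (by omega) h) (by omega)
    have h3 := hS i (Ideal.Quotient.mk _
      (MvPolynomial.monomial (tpE p n a + Finsupp.single i 1) (1 : k)))
    rw [tp_pd_mk, MvPolynomial.pderiv_monomial, add_tsub_cancel_right, Finsupp.add_apply,
      tpE_apply, Finsupp.single_eq_same, mul_comm, ← smul_eq_mul, ← MvPolynomial.smul_monomial,
      tp_smul] at h3
    exact (Submodule.smul_mem_iff _ hne).1 h3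

end TP


theorem Ctc.mem_of_br {p : ℕ} {k A : Type*} [Field k] [CommRing A] [Algebra k A] {r : ℕ}
    (c : Ctc p k A r) (h2 : (2 : k) ≠ 0) (S : Submodule k A) (hS : ∀ f g, c.br f g ∈ S)
    (φ : A) (hφ : c.tau φ = 0) : φ ∈ S := by
  have hd : ∀ y, c.d y ∈ S := by
    intro y
    have h := hS 1 y
    have h1 : c.br 1 y = (2 : k) • c.d y := by
      rw [Ctc.br, c.D_apply, Algebra.smul_def, map_ofNat]
      simp
    rw [h1] at h
    exact (Submodule.smul_mem_iff _ h2).1 h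
  refine c.mem_of_tau S hd (fun i y => ?_) (fun i y => ?_) φ hφ
  · have h := hS (c.Y i) y
    have h1 : c.br (c.Y i) y = 2 * c.Y i * c.d y - c.a i y := by
      rw [Ctc.br, c.D_apply]
      simp [c.dY, c.aY, c.bY, Finset.sum_ite_eq', sub_eq_add_neg]
    have h3 : c.a i y - c.Y i * c.d y = c.d (c.Y i * y) - c.br (c.Y i) y := by
      rw [h1, Derivation.leibniz, c.dY, smul_eq_mul, smul_eq_mul]; ring
    rw [h3]; exact Submodule.sub_mem _ (hd _) h
  · have h := hS (c.X i) y
    have h1 : c.br (c.X i) y = 2 * c.X i * c.d y + c.b i y := by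
      rw [Ctc.br, c.D_apply]
      simp [c.dX, c.aX, c.bX, Finset.sum_ite_eq']
    have h3 : c.b i y + c.X i * c.d y = c.br (c.X i) y - c.d (c.X i * y) := by
      rw [h1, Derivation.leibniz, c.dX, smul_eq_mul, smul_eq_mul]; ring
    rw [h3]; exact Submodule.sub_mem _ h (hd _)

section TP
variable (r : ℕ)

def iX (i : Fin r) : Fin (2 * r + 1) := ⟨i.1, by have := i.isLt; omega⟩
def iY (i : Fin r) : Fin (2 * r + 1) := ⟨i.1 + r, by have := i.isLt; omega⟩

theorem i_cases {P : Fin (2 * r + 1) → Prop} (hX : ∀ i, P (iX r i)) (hY : ∀ i, P (iY r i))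
    (hZ : P (Fin.last (2 * r))) (j) : P j := by
  by_cases h1 : j.1 < r
  · exact hX ⟨j, h1⟩
  · by_cases h2 : j.1 < 2 * r
    · have h := hY ⟨j.1 - r, by omega⟩
      have e : iY r ⟨j.1 - r, by omega⟩ = j := Fin.ext (by simp only [iY]; omega)
      rwa [e] at h
    · have e : j = Fin.last (2 * r) := Fin.ext (by simp only [Fin.val_last]; omega)
      rwa [e]

theorem iXX (i j : Fin r) : iX r i = iX r j ↔ i = j := by simp [iX, Fin.ext_iff]
theorem iYY (i j : Fin r) : iY r i = iY r j ↔ i = j := by simp [iY, Fin.ext_iff]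
theorem iXY (i j : Fin r) : iX r i ≠ iY r j := by
  have := i.2; simp only [iX, iY, ne_eq, Fin.ext_iff]; omega
theorem iYX (i j : Fin r) : iY r i ≠ iX r j := (iXY r j i).symm
theorem iXZ (i : Fin r) : iX r i ≠ Fin.last (2 * r) := by
  have := i.2; simp only [iX, ne_eq, Fin.ext_iff, Fin.val_last]; omega
theorem iYZ (i : Fin r) : iY r i ≠ Fin.last (2 * r) := by
  have := i.2; simp only [iY, ne_eq, Fin.ext_iff, Fin.val_last]; omega

variable (p : ℕ) (k : Type*) [Field k] [CharP k p]

local notation "TA" => TruncPoly p k (2 * r + 1)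
local notation "x_" => truncX p k (2 * r + 1)
local notation "d_" => truncPD p k (2 * r + 1)

noncomputable def ca (i : Fin r) : Derivation k TA TA :=
  d_ (iX r i) + x_ (iY r i) • d_ (Fin.last (2 * r))
noncomputable def cb (i : Fin r) : Derivation k TA TA :=
  d_ (iY r i) - x_ (iX r i) • d_ (Fin.last (2 * r))

theorem ca_apply (i : Fin r) (y : TA) :
  ca r p k i y = d_ (iX r i) y + x_ (iY r i) * d_ (Fin.last (2 * r)) y := rfl
theorem cb_apply (i : Fin r) (y : TA) :
  cb r p k i y = d_ (iY r i) y - x_ (iX r i) * d_ (Fin.last (2 * r)) y := by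
  rw [cb, Derivation.sub_apply]; rfl

theorem dXX (i j) : d_ (iX r i) (x_ (iX r j)) = if i = j then 1 else 0 := by
  rw [tp_pd_X]; simp only [iXX]
theorem dYY (i j) : d_ (iY r i) (x_ (iY r j)) = if i = j then 1 else 0 := by
  rw [tp_pd_X]; simp only [iYY]
theorem dXY (i j) : d_ (iX r i) (x_ (iY r j)) = 0 := by rw [tp_pd_X, if_neg (iXY r i j)]
theorem dYX (i j) : d_ (iY r i) (x_ (iX r j)) = 0 := by rw [tp_pd_X, if_neg (iYX r i j)]
theorem dXZ (i) : d_ (iX r i) (x_ (Fin.last _)) = 0 := by rw [tp_pd_X, if_neg (iXZ r i)]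
theorem dYZ (i) : d_ (iY r i) (x_ (Fin.last _)) = 0 := by rw [tp_pd_X, if_neg (iYZ r i)]
theorem dZX (i) : d_ (Fin.last _) (x_ (iX r i)) = 0 := by rw [tp_pd_X, if_neg (iXZ r i).symm]
theorem dZY (i) : d_ (Fin.last _) (x_ (iY r i)) = 0 := by rw [tp_pd_X, if_neg (iYZ r i).symm]
theorem dZZ : d_ (Fin.last _) (x_ (Fin.last _)) = 1 := by rw [tp_pd_X, if_pos rfl]

theorem tp_lz (D : Derivation k TA TA) (x y : TA) : D (x * y) = x * D y + y * D x := D.leibniz x y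

noncomputable def tpCtc (hp : p.Prime) : Ctc p k TA r where
  a := ca r p k
  b := cb r p k
  d := d_ (Fin.last _)
  X i := x_ (iX r i)
  Y i := x_ (iY r i)
  Z := x_ (Fin.last _)
  aa i j y := by
    simp only [ca_apply, map_add, tp_lz, dXY, dZY]
    rw [tp_comm p k _ (iX r i) (iX r j), tp_comm p k _ (iX r i) (Fin.last _),
      tp_comm p k _ (iX r j) (Fin.last _)]
    ring
  bb i j y := by
    simp only [cb_apply, map_sub, tp_lz, dYX, dZX]
    rw [tp_comm p k _ (iY r i) (iY r j), tp_comm p k _ (iY r i) (Fin.last _),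
      tp_comm p k _ (iY r j) (Fin.last _)]
    ring
  ad i y := by
    simp only [ca_apply, map_add, tp_lz, dZY]
    rw [tp_comm p k _ (iX r i) (Fin.last _)]
    ring
  bd i y := by
    simp only [cb_apply, map_sub, tp_lz, dZX]
    rw [tp_comm p k _ (iY r i) (Fin.last _)]
    ring
  ab i j y := by
    simp only [ca_apply, cb_apply, map_sub, map_add, tp_lz, dZX, dZY, dXX, dYY]
    rw [tp_comm p k _ (iX r i) (iY r j), tp_comm p k _ (iX r i) (Fin.last _),
      tp_comm p k _ (iY r j) (Fin.last _)]
    by_cases h : i = j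
    · subst h
      simp only [if_true]
      ring
    · rw [if_neg h, if_neg h, if_neg (fun h' => h h'.symm)]
      ring
  aX i j := by rw [ca_apply, dXX, dZX, mul_zero, add_zero]
  bX i j := by rw [cb_apply, dYX, dZX, mul_zero, sub_zero]
  aY i j := by rw [ca_apply, dXY, dZY, mul_zero, add_zero]
  bY i j := by rw [cb_apply, dYY, dZY, mul_zero, sub_zero]
  dX j := dZX r p k j
  dY j := dZY r p k j
  aZ i := by rw [ca_apply, dXZ, dZZ, mul_one, zero_add]
  bZ i := by rw [cb_apply, dYZ, dZZ, mul_one, zero_sub]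
  dZ := dZZ r p k
  ext D D' h1 h2 h3 := tp_ext p k _ D D' (i_cases r h1 h2 h3)
  eps := tpEps p k _ hp.ne_zero
  frob := tp_frob p k _ hp
  pd := d_
  xs := x_
  pdxs := tp_pd_X p k _
  epsxs := tpEps_X p k _ _
  taylor := tp_taylor p k _ hp
  fin := tp_fin p k _
  rank := tp_rank p k _
  tau := tpCoeff p k _ (fun _ => ⟨p - 1, by have := hp.pos; omega⟩)
  mem_of_tau S h1 h2 h3 y hy := by
    refine tp_mem p k _ hp S ?_ y hy
    refine i_cases r (fun i y => ?_) (fun i y => ?_) (fun y => h1 y)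
    · have := h2 i y
      rwa [ca_apply, add_sub_cancel_right] at this
    · have := h3 i y
      rwa [cb_apply, sub_add_cancel] at this

theorem sum_two (F : Fin (2 * r + 1) → TA) :
    ∑ i : Fin (2 * r), F ⟨i.1, by have := i.isLt; omega⟩ = ∑ i : Fin r, (F (iX r i) + F (iY r i)) := by
  rw [Finset.sum_add_distrib]
  refine (Fintype.sum_equiv (finCongr (two_mul r)) _
    (fun i : Fin (r + r) => F ⟨i.1, by have := i.isLt; omega⟩) (fun i => rfl)).trans ?_
  rw [Fin.sum_univ_add]
  congr 1
  refine Finset.sum_congr rfl fun i _ => ?_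
  congr 1
  exact Fin.ext (by simp [iY, add_comm])

theorem DK_eq (hp : p.Prime) (f : TA) : DK p k r f = (tpCtc r p k hp).D f := by
  have h : ∀ (F : Fin r → Derivation k TA TA) (y : TA), (∑ i, F i) y = ∑ i, F i y := fun F y => by
    have := map_sum (Derivation.coeFnAddMonoidHom (R := k) (A := TA) (M := TA)) F Finset.univ
    have h2 := congrFun this y
    rw [Finset.sum_apply] at h2
    exact h2
  ext y
  rw [Ctc.D_apply]
  have e1 : DK p k r f y = ∑ i : Fin r, ((x_ (iX r i) * d_ (Fin.last _) f - d_ (iY r i) f) *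
      d_ (iX r i) y + (x_ (iY r i) * d_ (Fin.last _) f + d_ (iX r i) f) * d_ (iY r i) y) +
      (2 * f - ∑ i : Fin r, (x_ (iX r i) * d_ (iX r i) f + x_ (iY r i) * d_ (iY r i) f))
        * d_ (Fin.last _) y := by
    rw [← sum_two r p k (fun j => x_ j * d_ j f)]
    rw [DK, Derivation.add_apply, h]
    rfl
  rw [e1, sub_mul, Finset.sum_mul]
  change _ = 2 * f * d_ (Fin.last _) y +
    ∑ i, (ca r p k i f * cb r p k i y - cb r p k i f * ca r p k i y)
  have e2 : ∀ u v w z : TA, u - v = w → u + (z - v) = z + w := by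
    intro u v w z h; rw [← h]; ring
  apply e2
  rw [← Finset.sum_sub_distrib]
  refine Finset.sum_congr rfl fun i _ => ?_
  simp only [ca_apply, cb_apply]
  ring

theorem contact_range (hp : p.Prime) {x : WittAlg p k (2 * r + 1)} (hx : x ∈ contactAlg p k r) :
    ∃ f, x = (tpCtc r p k hp).D f := by
  set c := tpCtc r p k hp
  let R : LieSubalgebra k (WittAlg p k (2 * r + 1)) :=
    { LinearMap.range c.DL with
      lie_mem' := by
        rintro _ _ ⟨f, rfl⟩ ⟨g, rfl⟩
        exact ⟨c.br f g, (c.lie_D f g).symm⟩ }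
  have h1 : contactAmbient p k r ≤ R := by
    refine LieSubalgebra.lieSpan_le.2 ?_
    rintro _ ⟨f, rfl⟩
    exact ⟨f, (DK_eq r p k hp f).symm⟩
  have h2 : contactAlg p k r ≤ R := by
    refine LieSubalgebra.lieSpan_le.2 ?_
    rintro _ ⟨u, hu, v, hv, rfl⟩
    exact R.lie_mem (h1 hu) (h1 hv)
  obtain ⟨f, hf⟩ := h2 hx
  exact ⟨f, hf.symm⟩

theorem contact_br (hp : p.Prime) (f g : TA) :
    (tpCtc r p k hp).D ((tpCtc r p k hp).br f g) ∈ contactAlg p k r := by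
  rw [← Ctc.lie_D, ← DK_eq, ← DK_eq]
  exact LieSubalgebra.subset_lieSpan ⟨_, LieSubalgebra.subset_lieSpan ⟨f, rfl⟩, _,
    LieSubalgebra.subset_lieSpan ⟨g, rfl⟩, rfl⟩

end TP

/-- Corollary 3.5.  Let `n = 2r + 1` and let `K(n)` be the restricted
contact algebra over `k`.  Then `K(n)` contains no self-centralizing torus, except in the
single case `p = n = 3`. -/
theorem contactAlg_no_selfCentralizing_torus (p : ℕ) (hp : p.Prime) (hp3 : 3 ≤ p)
    (k : Type*) [Field k] [IsAlgClosed k] [CharP k p]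
    (r : ℕ) (hr : 1 ≤ r)
    (T : Submodule k (WittAlg p k (2 * r + 1)))
    (hT : IsTorusIn p k (2 * r + 1) (contactAlg p k r) T)
    (hself : ∀ x ∈ contactAlg p k r,
      ((∀ y ∈ T, ⁅x, y⁆ = 0) ↔ x ∈ T)) :
    p = 3 ∧ 2 * r + 1 = 3 := by
  obtain ⟨hTK, -, hTp, hTs⟩ := hT
  let c := tpCtc r p k hp
  have h2 : (2 : k) ≠ 0 := by
    intro h
    have h' : ((2 : ℕ) : k) = 0 := by exact_mod_cast h
    rw [CharP.cast_eq_zero_iff k p] at h'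
    have := Nat.le_of_dvd (by norm_num) h'
    omega
  have hrange : ∀ x ∈ T, ∃ f, x = c.D f := fun x hx => contact_range r p k hp (hTK x hx)
  have t : c.Tor (T.comap c.DL) :=
    { hp := hp
      hp3 := hp3
      hr := hr
      h1 := fun f hf => hTs (c.D f) hf
      h2 := fun f hf => by
        obtain ⟨y, hy, hy2⟩ := hTp (c.D f) hf
        obtain ⟨f', rfl⟩ := hrange y hy
        exact ⟨f', hy, hy2⟩
      h3 := fun φ hφ hC => by
        have hmem : φ ∈ ((contactAlg p k r).toSubmodule).comap c.DL :=
          c.mem_of_br h2 _ (fun f g => contact_br r p k hp f g) φ hφ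
        refine (hself (c.D φ) hmem).1 fun y hy => ?_
        obtain ⟨f, rfl⟩ := hrange y hy
        rw [c.lie_D, c.br_antisymm, hC f hy, neg_zero]
        exact map_zero c.DL
      h4 := fun f hf g hg => by
        have := (hself (c.D f) (hTK _ hf)).2 hf (c.D g) hg
        rw [c.lie_D] at this
        exact c.D_inj h2 this }
  obtain ⟨h3, h4⟩ := t.main
  exact ⟨h3, by omega⟩
end
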